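/- arXiv:1711.11176 — 2 statements merged into one kernel-verified Lean document; each statement's English description precedes it below -/
import Mathlib

section
/- Let P_1 and P_2 be convex bodies in ℝ^d. For 0 ≤ i ≤ d write V_i = V(P_1, …, P_1, P_2, …, P_2) with P_1 repeated i times and P_2 repeated d−i times. Then the sequence V_0, V_1, …, V_d is log-concave: V_i^2 ≥ V_{i−1} · V_{i+1} for all 1 ≤ i ≤ d−1. -/
open Pointwise MeasureTheory

/-- The mixed volume of `d` convex bodies in `ℝ^d`:
`V(P_1, …, P_d) = ∑_{S ⊆ {1,…,d}} (−1)^{d−|S|} vol(∑_{i∈S} P_i)`. -/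
noncomputable def mixedVolume {d : ℕ} (P : Fin d → Set (EuclideanSpace ℝ (Fin d))) : ℝ :=
  ∑ S : Finset (Fin d), (-1 : ℝ) ^ (d - S.card) * (volume (∑ i ∈ S, P i)).toReal

/-- If every eigenvector of a real symmetric matrix with a positive eigenvalue is a multiple of
`s`, then the matrix is negative semidefinite on the orthogonal complement of `s`. -/
theorem Matrix.IsHermitian.dotProduct_mulVec_nonpos {J : Type*} [Fintype J] [DecidableEq J]
    {S : Matrix J J ℝ} (hS : S.IsHermitian) (s : J → ℝ)
    (hs : ∀ (l : ℝ) (x : J → ℝ), 0 < l → S.mulVec x = l • x → ∃ t : ℝ, x = t • s)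
    (y : J → ℝ) (hy : y ⬝ᵥ s = 0) : y ⬝ᵥ S.mulVec y ≤ 0 := by
  set b := hS.eigenvectorBasis with hb
  have hdec : ∑ a, (b.repr (WithLp.toLp 2 y) a) • (b a : J → ℝ) = y := by
    have := b.sum_repr (WithLp.toLp 2 y)
    have h2 := congrArg (WithLp.ofLp) this
    simpa using h2
  have hS2 : S.mulVec y = ∑ a, (b.repr (WithLp.toLp 2 y) a * hS.eigenvalues a) • (b a : J → ℝ) := by
    conv_lhs => rw [← hdec]
    rw [Matrix.mulVec_sum]
    refine Finset.sum_congr rfl fun a _ => ?_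
    rw [Matrix.mulVec_smul, hS.mulVec_eigenvectorBasis, smul_smul]
  have hin : ∀ a, y ⬝ᵥ (b a : J → ℝ) = b.repr (WithLp.toLp 2 y) a := by
    intro a
    rw [b.repr_apply_apply, EuclideanSpace.inner_eq_star_dotProduct]
    simp
  rw [hS2, dotProduct_sum]
  refine Finset.sum_nonpos fun a _ => ?_
  rw [dotProduct_smul, hin, smul_eq_mul]
  rcases le_or_gt (hS.eigenvalues a) 0 with h | h
  · nlinarith [mul_self_nonneg (b.repr (WithLp.toLp 2 y) a)]
  · obtain ⟨t, ht⟩ := hs _ _ h (hS.mulVec_eigenvectorBasis a)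
    have : b.repr (WithLp.toLp 2 y) a = 0 := by
      rw [← hin, ht, dotProduct_smul, hy, smul_zero]
    simp [this]

/-- A Perron–Frobenius argument: a symmetric matrix `M` with nonnegative off-diagonal entries and
connected support, with a positive vector `e` whose image is positive, is negative semidefinite
on the `M`-orthogonal complement of `e` as soon as it satisfies a Bochner type inequality. -/
theorem Matrix.IsHermitian.nonpos_of_bochner {J : Type*} [Fintype J] [DecidableEq J]
    {M : Matrix J J ℝ} (hM : M.IsHermitian) (e p : J → ℝ) (he : ∀ i, 0 < e i) (hp : ∀ i, 0 < p i)
    (hMe : M.mulVec e = p) (hoff : ∀ i j, i ≠ j → 0 ≤ M i j)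
    (hconn : ∀ z : J → ℝ, (∀ i j, i ≠ j → M i j ≠ 0 → z i = z j) → ∀ i j, z i = z j)
    (hboch : ∀ x : J → ℝ, x ⬝ᵥ M.mulVec x ≤ ∑ i, e i * (M.mulVec x i) ^ 2 / p i)
    (x : J → ℝ) (hx : x ⬝ᵥ p = 0) : x ⬝ᵥ M.mulVec x ≤ 0 := by
  have hsym : ∀ i j, M i j = M j i := fun i j => by
    have := hM.apply i j; simpa using this.symm
  set r : J → ℝ := fun i => √(e i / p i) with hr
  have hr0 : ∀ i, 0 < r i := fun i => Real.sqrt_pos.2 (div_pos (he i) (hp i))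
  have hr2 : ∀ i, r i * r i = e i / p i := fun i =>
    Real.mul_self_sqrt (div_pos (he i) (hp i)).le
  set S : Matrix J J ℝ := Matrix.of fun i j => r i * M i j * r j with hSdef
  have hS : S.IsHermitian := by
    ext i j
    simp [hSdef, hsym i j]; ring
  have hSv : ∀ (y : J → ℝ) i, S.mulVec y i = r i * M.mulVec (fun j => r j * y j) i := by
    intro y i
    simp only [Matrix.mulVec, dotProduct, hSdef, Matrix.of_apply, Finset.mul_sum]
    exact Finset.sum_congr rfl fun j _ => by ring
  have hpos : ∀ (l : ℝ) (y : J → ℝ), 0 < l → S.mulVec y = l • y →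
      ∃ t : ℝ, y = t • (fun i => p i * r i) := by
    intro l y hl hy
    set x : J → ℝ := fun j => r j * y j with hxdef
    have hMx : ∀ i, M.mulVec x i = l * (p i / e i) * x i := by
      intro i
      have h1 : r i * M.mulVec x i = l * y i := by
        rw [← hSv]; simp [hy]
      have h2 : r i * (r i * M.mulVec x i) = l * x i := by rw [h1, hxdef]; ring
      rw [← mul_assoc, hr2] at h2
      have := (he i).ne'; have := (hp i).ne'
      field_simp at h2 ⊢
      linarith
    set z : J → ℝ := fun i => x i / e i with hz
    have hxz : ∀ i, x i = e i * z i := fun i => by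
      have := (he i).ne'
      simp only [hz]; field_simp
    set W : ℝ := ∑ i, p i * e i * z i ^ 2 with hW
    have hQ : x ⬝ᵥ M.mulVec x = l * W := by
      simp only [dotProduct, hMx, hW, Finset.mul_sum]
      refine Finset.sum_congr rfl fun i _ => ?_
      rw [hxz]; have := (he i).ne'; field_simp
    have hQ2 : x ⬝ᵥ M.mulVec x ≤ l ^ 2 * W := by
      refine (hboch x).trans_eq ?_
      simp only [hMx, hW, Finset.mul_sum]
      refine Finset.sum_congr rfl fun i _ => ?_
      rw [hxz]; have := (he i).ne'; have := (hp i).ne'; field_simp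
    have hid : x ⬝ᵥ M.mulVec x = W - 1 / 2 * ∑ i, ∑ j, M i j * e i * e j * (z i - z j) ^ 2 := by
      have hW1 : W = ∑ i, ∑ j, M i j * e i * e j * z i ^ 2 := by
        rw [hW]
        refine Finset.sum_congr rfl fun i _ => ?_
        rw [← hMe]
        simp only [Matrix.mulVec, dotProduct, Finset.sum_mul]
        exact Finset.sum_congr rfl fun j _ => by ring
      have hW2 : W = ∑ i, ∑ j, M i j * e i * e j * z j ^ 2 := by
        rw [hW1, Finset.sum_comm]
        refine Finset.sum_congr rfl fun i _ => Finset.sum_congr rfl fun j _ => ?_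
        rw [hsym]; ring
      have h3 : x ⬝ᵥ M.mulVec x = ∑ i, ∑ j, M i j * e i * e j * (z i * z j) := by
        simp only [Matrix.mulVec, dotProduct, Finset.mul_sum]
        refine Finset.sum_congr rfl fun i _ => Finset.sum_congr rfl fun j _ => ?_
        rw [hxz i, hxz j]; ring
      have h4 : ∑ i, ∑ j, M i j * e i * e j * (z i - z j) ^ 2 =
          ∑ i, ∑ j, M i j * e i * e j * z i ^ 2 + ∑ i, ∑ j, M i j * e i * e j * z j ^ 2
            - 2 * ∑ i, ∑ j, M i j * e i * e j * (z i * z j) := by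
        simp only [Finset.mul_sum, ← Finset.sum_add_distrib, ← Finset.sum_sub_distrib]
        exact Finset.sum_congr rfl fun i _ => Finset.sum_congr rfl fun j _ => by ring
      rw [h4, ← hW1, ← hW2, h3]; ring
    have hterm : ∀ i j, 0 ≤ M i j * e i * e j * (z i - z j) ^ 2 := by
      intro i j
      rcases eq_or_ne i j with rfl | hij
      · simp
      · have := hoff i j hij; have := (he i).le; have := (he j).le; positivity
    have hsum0 : 0 ≤ ∑ i, ∑ j, M i j * e i * e j * (z i - z j) ^ 2 :=
      Finset.sum_nonneg fun i _ => Finset.sum_nonneg fun j _ => hterm i j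
    have hW0 : 0 ≤ W := Finset.sum_nonneg fun i _ => by
      have := (he i).le; have := (hp i).le; positivity
    have hsum : ∑ i, ∑ j, M i j * e i * e j * (z i - z j) ^ 2 = 0 := by
      rcases hW0.eq_or_lt with h | h
      · nlinarith
      · have : 1 ≤ l := by
          by_contra hl1
          push Not at hl1
          have : l * W ≤ l ^ 2 * W := hQ ▸ hQ2
          nlinarith [mul_pos hl h]
        nlinarith
    have hzc : ∀ i j, z i = z j := by
      refine hconn z fun i j _ hMij => ?_
      have h1 := (Finset.sum_eq_zero_iff_of_nonneg
        (fun i _ => Finset.sum_nonneg fun j _ => hterm i j)).1 hsum i (Finset.mem_univ _)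
      have h2 := (Finset.sum_eq_zero_iff_of_nonneg (fun j _ => hterm i j)).1 h1 j
        (Finset.mem_univ _)
      have h3 : M i j * e i * e j ≠ 0 :=
        mul_ne_zero (mul_ne_zero hMij (he i).ne') (he j).ne'
      have := (mul_eq_zero.1 h2).resolve_left h3
      have := pow_eq_zero_iff (two_ne_zero) |>.1 this
      linarith
    rcases isEmpty_or_nonempty J with hJ | ⟨⟨i0⟩⟩
    · exact ⟨0, funext fun i => (hJ.false i).elim⟩
    · refine ⟨z i0, funext fun i => ?_⟩
      have h1 : r i * y i = e i * z i0 := by rw [hzc i0 i, ← hxz]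
      have h2 : r i * (r i * y i) = r i * e i * z i0 := by rw [h1]; ring
      rw [← mul_assoc, hr2] at h2
      have := (he i).ne'; have := (hp i).ne'
      simp only [Pi.smul_apply, smul_eq_mul]
      field_simp at h2
      linarith
  have := hS.dotProduct_mulVec_nonpos _ hpos (fun i => x i / r i) (by
    simp only [dotProduct] at hx ⊢
    rw [← hx]
    refine Finset.sum_congr rfl fun i _ => ?_
    have := (hr0 i).ne'
    field_simp)
  have heq : (fun i => x i / r i) ⬝ᵥ S.mulVec (fun i => x i / r i) = x ⬝ᵥ M.mulVec x := by
    simp only [dotProduct, hSv]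
    have : (fun j => r j * (x j / r j)) = x := funext fun j => by
      have := (hr0 j).ne'
      field_simp
    rw [this]
    refine Finset.sum_congr rfl fun i _ => ?_
    have := (hr0 i).ne'
    field_simp
  rwa [heq] at this

/-- A symmetric bilinear form that is positive at `e` and negative semidefinite on the orthogonal
complement of `e` satisfies the reversed Cauchy–Schwarz inequality. -/
theorem LinearMap.BilinForm.mul_le_sq_of_lorentzian {V : Type*} [AddCommGroup V] [Module ℝ V]
    (B : LinearMap.BilinForm ℝ V) (hB : ∀ x y, B x y = B y x) (e : V)
    (hneg : ∀ x, B x e = 0 → B x x ≤ 0) (x y : V) (hy : 0 < B y y) :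
    B x x * B y y ≤ B x y ^ 2 := by
  have hye : B y e ≠ 0 := fun h => absurd (hneg y h) (not_le.2 hy)
  set x' := B y y • x - B x y • y with hx'
  have h1 : B x' y = 0 := by simp [hx']; ring
  have h2 : B x' x' = B y y * (B x x * B y y - B x y ^ 2) := by
    simp [hx', hB y x]; ring
  set z := B y e • x' - B x' e • y with hz
  have h3 : B z e = 0 := by
    simp only [hz, map_sub, map_smul, LinearMap.sub_apply, LinearMap.smul_apply,
      smul_eq_mul]
    ring
  have h4 : B z z = B y e ^ 2 * B x' x' + B x' e ^ 2 * B y y := by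
    simp only [hz, map_sub, map_smul, LinearMap.sub_apply, LinearMap.smul_apply,
      smul_eq_mul, hB y x', h1]
    ring
  have h5 := hneg z h3
  have h6 : B x' x' ≤ 0 := by
    by_contra hc
    push Not at hc
    have : 0 < B y e ^ 2 := by positivity
    nlinarith [mul_pos this hc, mul_nonneg (sq_nonneg (B x' e)) hy.le]
  rw [h2] at h6
  nlinarith [nonpos_of_mul_nonpos_right h6 hy]

namespace MvPolynomial

variable {ι : Type*}

/-- The derivative of a polynomial in the direction `c`. -/
noncomputable def dirDeriv (c : ι → ℝ) : Derivation ℝ (MvPolynomial ι ℝ) (MvPolynomial ι ℝ) :=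
  mkDerivation ℝ fun i => C (c i)

/-- The iterated derivative of a polynomial in the directions listed in `L`. -/
noncomputable def iterDirDeriv (L : List (ι → ℝ)) : Module.End ℝ (MvPolynomial ι ℝ) :=
  (L.map fun c => (dirDeriv c : MvPolynomial ι ℝ →ₗ[ℝ] MvPolynomial ι ℝ)).prod

@[simp]
theorem dirDeriv_X (c : ι → ℝ) (i : ι) : dirDeriv c (X i) = C (c i) := by
  simp [dirDeriv, mkDerivation_X]

theorem dirDeriv_add (c c' : ι → ℝ) (f : MvPolynomial ι ℝ) :
    dirDeriv (c + c') f = dirDeriv c f + dirDeriv c' f := by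
  have : dirDeriv (c + c') = dirDeriv c + dirDeriv c' := derivation_ext fun i => by simp
  rw [this]; rfl

theorem dirDeriv_smul (a : ℝ) (c : ι → ℝ) (f : MvPolynomial ι ℝ) :
    dirDeriv (a • c) f = a • dirDeriv c f := by
  have : dirDeriv (a • c) = a • dirDeriv c := derivation_ext fun i => by simp [smul_eq_C_mul]
  rw [this]; rfl

theorem dirDeriv_comm (c c' : ι → ℝ) (f : MvPolynomial ι ℝ) :
    dirDeriv c (dirDeriv c' f) = dirDeriv c' (dirDeriv c f) := by
  have : ⁅dirDeriv c, dirDeriv c'⁆ = (0 : Derivation ℝ (MvPolynomial ι ℝ) (MvPolynomial ι ℝ)) :=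
    derivation_ext fun i => by
      rw [Derivation.commutator_apply]; simp
  have h := congrArg (fun D : Derivation ℝ (MvPolynomial ι ℝ) (MvPolynomial ι ℝ) => D f) this
  simp only [Derivation.commutator_apply, Derivation.coe_zero, Pi.zero_apply] at h
  exact sub_eq_zero.1 h

theorem dirDeriv_single [DecidableEq ι] (i : ι) (f : MvPolynomial ι ℝ) :
    dirDeriv (Pi.single i 1) f = pderiv i f := by
  have : dirDeriv (Pi.single i 1) = (pderiv i : Derivation ℝ _ (MvPolynomial ι ℝ)) :=
    derivation_ext fun j => by
      rw [dirDeriv_X, pderiv_X]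
      by_cases h : j = i <;> simp [h]
  rw [this]

theorem dirDeriv_eq_sum [Fintype ι] (c : ι → ℝ) (f : MvPolynomial ι ℝ) :
    dirDeriv c f = ∑ i, c i • pderiv i f := by
  classical
  have hsum : ∀ (s : Finset ι) (g : MvPolynomial ι ℝ),
      (∑ i ∈ s, c i • (pderiv i : Derivation ℝ _ (MvPolynomial ι ℝ))) g =
        ∑ i ∈ s, c i • pderiv i g := fun s g => by
    induction s using Finset.induction_on with
    | empty => simp
    | insert a s ha ih => rw [Finset.sum_insert ha, Finset.sum_insert ha, ← ih]; rfl
  have : dirDeriv c = ∑ i, c i • (pderiv i : Derivation ℝ _ (MvPolynomial ι ℝ)) :=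
    derivation_ext fun j => by
      rw [dirDeriv_X, hsum, Finset.sum_eq_single j]
      · simp [smul_eq_C_mul]
      · intro i _ hij
        simp [pderiv_X_of_ne hij.symm]
      · simp
  rw [this, hsum]

theorem IsHomogeneous.dirDeriv [Fintype ι] {n : ℕ} {f : MvPolynomial ι ℝ}
    (hf : f.IsHomogeneous (n + 1)) (c : ι → ℝ) : (dirDeriv c f).IsHomogeneous n := by
  rw [dirDeriv_eq_sum]
  refine IsHomogeneous.sum _ _ _ fun i _ => ?_
  rw [smul_eq_C_mul]
  simpa using (isHomogeneous_C ι (c i)).mul hf.pderiv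

theorem eval_dirDeriv_self [Fintype ι] {n : ℕ} {f : MvPolynomial ι ℝ}
    (hf : f.IsHomogeneous n) (c : ι → ℝ) : eval c (dirDeriv c f) = n * eval c f := by
  rw [dirDeriv_eq_sum]
  have := congrArg (eval c) hf.sum_X_mul_pderiv
  simp only [map_sum, smul_eq_C_mul, map_mul, eval_X, eval_C, nsmul_eq_mul, map_natCast] at this ⊢
  exact this

@[simp]
theorem iterDirDeriv_nil (f : MvPolynomial ι ℝ) : iterDirDeriv [] f = f := rfl

theorem iterDirDeriv_cons (c : ι → ℝ) (L : List (ι → ℝ)) (f : MvPolynomial ι ℝ) :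
    iterDirDeriv (c :: L) f = dirDeriv c (iterDirDeriv L f) := rfl

theorem dirDeriv_iterDirDeriv (c : ι → ℝ) (L : List (ι → ℝ)) (f : MvPolynomial ι ℝ) :
    dirDeriv c (iterDirDeriv L f) = iterDirDeriv L (dirDeriv c f) := by
  induction L with
  | nil => rfl
  | cons a L ih => rw [iterDirDeriv_cons, iterDirDeriv_cons, ← ih, dirDeriv_comm]

theorem IsHomogeneous.eval_eq_constantCoeff {f : MvPolynomial ι ℝ} (hf : f.IsHomogeneous 0)
    (c : ι → ℝ) : eval c f = constantCoeff f := by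
  obtain ⟨a, rfl⟩ : ∃ a, f = C a := ⟨_, totalDegree_eq_zero_iff_eq_C.1 (by
    simpa using hf.totalDegree_le)⟩
  simp

theorem constantCoeff_iterDirDeriv_replicate [Fintype ι] {m : ℕ} (c : ι → ℝ)
    {f : MvPolynomial ι ℝ} (hf : f.IsHomogeneous m) :
    constantCoeff (iterDirDeriv (List.replicate m c) f) = m.factorial * eval c f := by
  induction m generalizing f with
  | zero => simp [hf.eval_eq_constantCoeff c]
  | succ m ih =>
    rw [List.replicate_succ, iterDirDeriv_cons, dirDeriv_iterDirDeriv, ih (hf.dirDeriv c),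
      eval_dirDeriv_self hf, Nat.factorial_succ]
    push_cast; ring

/-- The mixed second derivative form `(x, y) ↦ ∂_x ∂_y ∂_L f (0)`. -/
noncomputable def hessForm [Fintype ι] (f : MvPolynomial ι ℝ) (L : List (ι → ℝ)) :
    LinearMap.BilinForm ℝ (ι → ℝ) :=
  LinearMap.mk₂ ℝ (fun x y => constantCoeff (dirDeriv x (dirDeriv y (iterDirDeriv L f))))
    (fun x x' y => by rw [dirDeriv_add, map_add])
    (fun a x y => by rw [dirDeriv_smul, constantCoeff_smul])
    (fun x y y' => by rw [dirDeriv_add, map_add, map_add])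
    (fun a x y => by rw [dirDeriv_smul, Derivation.map_smul, constantCoeff_smul])

theorem hessForm_apply [Fintype ι] (f : MvPolynomial ι ℝ) (L : List (ι → ℝ)) (x y : ι → ℝ) :
    hessForm f L x y = constantCoeff (dirDeriv x (dirDeriv y (iterDirDeriv L f))) := rfl

theorem hessForm_comm [Fintype ι] (f : MvPolynomial ι ℝ) (L : List (ι → ℝ)) (x y : ι → ℝ) :
    hessForm f L x y = hessForm f L y x := by
  rw [hessForm_apply, hessForm_apply, dirDeriv_comm]

theorem hessForm_congr_right [Fintype ι] {f : MvPolynomial ι ℝ} (L : List (ι → ℝ)) {y y' : ι → ℝ}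
    (h : dirDeriv y f = dirDeriv y' f) (x : ι → ℝ) : hessForm f L x y = hessForm f L x y' := by
  rw [hessForm_apply, hessForm_apply, dirDeriv_iterDirDeriv, h, ← dirDeriv_iterDirDeriv]

theorem hessForm_congr_left [Fintype ι] {f : MvPolynomial ι ℝ} (L : List (ι → ℝ)) {y y' : ι → ℝ}
    (h : dirDeriv y f = dirDeriv y' f) (x : ι → ℝ) : hessForm f L y x = hessForm f L y' x := by
  rw [hessForm_comm, hessForm_congr_right L h, hessForm_comm]

/-- The local conditions on a polynomial `f` which, imposed on all its squarefree partial
derivatives, force the mixed second derivatives in directions from `T` to be Lorentzian.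
The polynomial is thought of as the volume of the face `S` of a simple polytope as a function of
the support numbers of the polytope. -/
structure FaceCond [Fintype ι] (T : Set (ι → ℝ)) (n : ℕ) (S : Finset ι) (f : MvPolynomial ι ℝ) :
    Prop where
  homogeneous : f.IsHomogeneous n
  pos : ∀ c ∈ T, 0 < eval c f
  logConcave : ∀ c ∈ T, ∀ x, eval c f * eval c (dirDeriv x (dirDeriv x f)) ≤
    eval c (dirDeriv x f) ^ 2
  slack : ∀ c ∈ T, ∃ e : ι → ℝ, (∀ k ∈ S, e k = 0) ∧ (∀ k ∉ S, 0 < e k) ∧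
    dirDeriv e f = dirDeriv c f
  shift : ∀ x : ι → ℝ, ∃ y : ι → ℝ, (∀ k ∈ S, y k = 0) ∧ dirDeriv y f = dirDeriv x f

/-- A polynomial all of whose nonzero squarefree partial derivatives satisfy `FaceCond`. -/
def Hereditary [Fintype ι] [DecidableEq ι] (T : Set (ι → ℝ)) :
    ℕ → Finset ι → MvPolynomial ι ℝ → Prop
  | 0, S, f => f = 0 ∨ FaceCond T 0 S f
  | n + 1, S, f => f = 0 ∨ (FaceCond T (n + 1) S f ∧
      ∀ i ∉ S, Hereditary T n (insert i S) (pderiv i f))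

section

variable [Fintype ι] {T : Set (ι → ℝ)} {n : ℕ} {S : Finset ι} {f : MvPolynomial ι ℝ}

theorem Hereditary.faceCond [DecidableEq ι] (hf : Hereditary T n S f) (h0 : f ≠ 0) :
    FaceCond T n S f := by
  cases n with
  | zero => exact hf.resolve_left h0
  | succ n => exact (hf.resolve_left h0).1

theorem Hereditary.pderiv [DecidableEq ι] (hf : Hereditary T (n + 1) S f) {i : ι} (hi : i ∉ S) :
    Hereditary T n (insert i S) (MvPolynomial.pderiv i f) := by
  rcases hf with rfl | hf
  · rw [map_zero]
    cases n <;> exact Or.inl rfl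
  · exact hf.2 i hi

theorem dirDeriv_eq_sum_of_slack {e : ι → ℝ} (he : ∀ k ∈ S, e k = 0) [DecidableEq ι]
    (f : MvPolynomial ι ℝ) :
    dirDeriv e f = ∑ i ∈ Sᶜ, e i • MvPolynomial.pderiv i f := by
  rw [dirDeriv_eq_sum, ← Finset.sum_compl_add_sum S]
  simp only [add_eq_left]
  exact Finset.sum_eq_zero fun i hi => by rw [he i hi, zero_smul]

theorem Hereditary.constantCoeff_pos [DecidableEq ι] (hT : T.Nonempty)
    (hf : Hereditary T n S f) (h0 : f ≠ 0) (L : List (ι → ℝ)) (hL : L.length = n)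
    (hLT : ∀ c ∈ L, c ∈ T) : 0 < constantCoeff (iterDirDeriv L f) := by
  induction n generalizing S f L with
  | zero =>
    obtain ⟨c, hc⟩ := hT
    rw [List.length_eq_zero_iff.1 hL, iterDirDeriv_nil,
      ← (hf.faceCond h0).homogeneous.eval_eq_constantCoeff c]
    exact (hf.faceCond h0).pos c hc
  | succ n ih =>
    obtain ⟨c, L, rfl⟩ : ∃ c L', L = c :: L' := List.exists_cons_of_length_eq_add_one hL
    have hc : c ∈ T := hLT c (by simp)
    have hfc := hf.faceCond h0
    obtain ⟨e, heS, hepos, hef⟩ := hfc.slack c hc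
    have hne : dirDeriv c f ≠ 0 := fun h => by
      have := eval_dirDeriv_self hfc.homogeneous c
      rw [h, map_zero] at this
      have h2 := hfc.pos c hc
      have : (0 : ℝ) < (n + 1 : ℕ) * eval c f := by positivity
      linarith
    have hnn : ∀ i ∉ S, MvPolynomial.pderiv i f ≠ 0 →
        0 < constantCoeff (iterDirDeriv L (MvPolynomial.pderiv i f)) := fun i hi hi0 =>
      ih (hf.pderiv hi) hi0 L (by simpa using hL) fun c hc => hLT c (by simp [hc])
    have hex : ∃ i ∉ S, MvPolynomial.pderiv i f ≠ 0 := by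
      by_contra! hall
      apply hne
      rw [← hef, dirDeriv_eq_sum_of_slack heS]
      exact Finset.sum_eq_zero fun i hi => by rw [hall i (by simpa using hi), smul_zero]
    obtain ⟨j, hjS, hj⟩ := hex
    rw [iterDirDeriv_cons, dirDeriv_iterDirDeriv, ← hef, dirDeriv_eq_sum_of_slack heS, map_sum,
      map_sum]
    refine Finset.sum_pos' (fun i hi => ?_) ⟨j, by simpa using hjS, ?_⟩
    · have hi : i ∉ S := by simpa using hi
      rw [map_smul, constantCoeff_smul, smul_eq_mul]
      by_cases hi0 : MvPolynomial.pderiv i f = 0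
      · simp [hi0]
      · exact (mul_pos (hepos i hi) (hnn i hi hi0)).le
    · rw [map_smul, constantCoeff_smul, smul_eq_mul]
      exact mul_pos (hepos j hjS) (hnn j hjS hj)

theorem FaceCond.hessForm_replicate (hf : FaceCond T (n + 2) S f) {c : ι → ℝ} (hc : c ∈ T)
    (x : ι → ℝ) :
    hessForm f (List.replicate n c) x x * hessForm f (List.replicate n c) c c ≤
      hessForm f (List.replicate n c) x c ^ 2 := by
  have hx : hessForm f (List.replicate n c) x x =
      n.factorial * eval c (dirDeriv x (dirDeriv x f)) := by
    rw [hessForm_apply, dirDeriv_iterDirDeriv, dirDeriv_iterDirDeriv,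
      constantCoeff_iterDirDeriv_replicate _ ((hf.homogeneous.dirDeriv x).dirDeriv x)]
  have hxc : hessForm f (List.replicate n c) x c = (n + 1).factorial * eval c (dirDeriv x f) := by
    rw [hessForm_apply, dirDeriv_comm, dirDeriv_iterDirDeriv, dirDeriv_iterDirDeriv,
      ← constantCoeff_iterDirDeriv_replicate _ (hf.homogeneous.dirDeriv x), List.replicate_succ,
      iterDirDeriv_cons, dirDeriv_iterDirDeriv]
  have hcc : hessForm f (List.replicate n c) c c = (n + 2).factorial * eval c f := by
    rw [hessForm_apply, ← constantCoeff_iterDirDeriv_replicate _ hf.homogeneous,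
      List.replicate_succ, List.replicate_succ, iterDirDeriv_cons, iterDirDeriv_cons]
  have hA := hf.pos c hc
  set A := eval c f with hAdef
  set B := eval c (dirDeriv x f) with hB
  set Q := eval c (dirDeriv x (dirDeriv x f)) with hQ
  set s : ℝ := B / ((n + 2) * A) with hs
  have hsA : s * ((n + 2) * A) = B := by
    rw [hs]; field_simp
  have hcf : eval c (dirDeriv c f) = (n + 2) * A := by
    rw [eval_dirDeriv_self hf.homogeneous]; push_cast; ring
  have hccf : eval c (dirDeriv c (dirDeriv c f)) = (n + 1) * ((n + 2) * A) := by
    rw [eval_dirDeriv_self (hf.homogeneous.dirDeriv c), hcf]; push_cast; ring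
  have hcxf : eval c (dirDeriv c (dirDeriv x f)) = (n + 1) * B := by
    rw [eval_dirDeriv_self (hf.homogeneous.dirDeriv x)]; push_cast; ring
  have h := hf.logConcave c hc (x + (-s) • c)
  simp only [dirDeriv_add, dirDeriv_smul, map_add, Derivation.map_smul, dirDeriv_comm x c f,
    smul_eval, hcf,
    hccf, hcxf, ← hAdef, ← hB, ← hQ] at h
  have h1 : B + -s * ((n + 2) * A) = 0 := by linarith
  rw [h1] at h
  have h2 : (n + 2) * A * Q ≤ (n + 1) * B ^ 2 := by
    have : A * Q ≤ (n + 1) * s * A * B := by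
      have h3 : (n + 1 : ℝ) * s * A * (s * ((n + 2) * A)) = (n + 1) * s * A * B := by rw [hsA]
      nlinarith [h3]
    have h4 : (n + 1 : ℝ) * (s * ((n + 2) * A)) * B = (n + 1) * B * B := by rw [hsA]
    have h5 : (n + 2 : ℝ) * (A * Q) ≤ (n + 2) * ((n + 1) * s * A * B) :=
      mul_le_mul_of_nonneg_left this (by positivity)
    nlinarith
  rw [hx, hxc, hcc, Nat.factorial_succ (n + 1), Nat.factorial_succ n]
  push_cast
  have h6 := mul_le_mul_of_nonneg_left h2
    (show (0 : ℝ) ≤ (n.factorial : ℝ) ^ 2 * (n + 1) by positivity)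
  nlinarith

end

end MvPolynomial

namespace MvPolynomial

variable {ι : Type*} [Fintype ι] {T : Set (ι → ℝ)}

theorem hessForm_single_single [DecidableEq ι] (f : MvPolynomial ι ℝ) (L : List (ι → ℝ)) (i j : ι) :
    hessForm f L (Pi.single i 1) (Pi.single j 1) =
      constantCoeff (iterDirDeriv L (MvPolynomial.pderiv j (MvPolynomial.pderiv i f))) := by
  rw [hessForm_apply, dirDeriv_iterDirDeriv, dirDeriv_iterDirDeriv, dirDeriv_comm,
    dirDeriv_single, dirDeriv_single]

theorem hessForm_cons (f : MvPolynomial ι ℝ) (L : List (ι → ℝ)) (c x y : ι → ℝ) :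
    hessForm f (c :: L) x y = hessForm (dirDeriv c f) L x y := by
  rw [hessForm_apply, hessForm_apply, iterDirDeriv_cons, dirDeriv_iterDirDeriv]

theorem hessForm_cons_eq_sum_of_slack [DecidableEq ι] (f : MvPolynomial ι ℝ)
    (L : List (ι → ℝ)) {S : Finset ι}
    {c e : ι → ℝ} (he : ∀ k ∈ S, e k = 0) (hef : dirDeriv e f = dirDeriv c f) (x y : ι → ℝ) :
    hessForm f (c :: L) x y =
      ∑ i ∈ Sᶜ, e i * hessForm (MvPolynomial.pderiv i f) L x y := by
  rw [hessForm_cons, ← hef, dirDeriv_eq_sum_of_slack he]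
  simp only [hessForm_apply, map_sum, map_smul, Derivation.map_smul, constantCoeff_smul,
    smul_eq_mul]

/-- Reduction of the Lorentzian property to directions supported on the relevant facets. -/
theorem Hereditary.nonpos_of_facets [DecidableEq ι] {n : ℕ} {S : Finset ι} {f : MvPolynomial ι ℝ}
    (hT : T.Nonempty) (hf : Hereditary T (n + 3) S f) (h0 : f ≠ 0)
    {c : ι → ℝ} (hc : c ∈ T) {L : List (ι → ℝ)} (hL : L.length = n) (hLT : ∀ c ∈ L, c ∈ T)
    {e : ι → ℝ} (heS : ∀ k ∈ S, e k = 0) (hepos : ∀ k ∉ S, 0 < e k)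
    (hef : dirDeriv e f = dirDeriv c f)
    (ih : ∀ i ∉ S, ∀ x, hessForm (MvPolynomial.pderiv i f) L x x *
      hessForm (MvPolynomial.pderiv i f) L c c ≤ hessForm (MvPolynomial.pderiv i f) L x c ^ 2)
    (x : ι → ℝ) (hx : hessForm f (c :: L) x e = 0) : hessForm f (c :: L) x x ≤ 0 := by
  classical
  have hfc := hf.faceCond h0
  have hLT' : ∀ c' ∈ c :: L, c' ∈ T := by simpa [hc] using hLT
  -- the relevant facets
  let J := {i : ι // i ∉ S ∧ MvPolynomial.pderiv i f ≠ 0}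
  let ext : (J → ℝ) → ι → ℝ := fun y i =>
    if h : i ∉ S ∧ MvPolynomial.pderiv i f ≠ 0 then y ⟨i, h⟩ else 0
  have hextS : ∀ y, ∀ k ∈ S, ext y k = 0 := fun y k hk => by simp [ext, hk]
  have hext : ∀ y (j : J), ext y j = y j := fun y j => by
    simp only [ext]; rw [dif_pos j.2]
  have hsum : ∀ (g : ι → ℝ), (∀ i ∉ S, MvPolynomial.pderiv i f = 0 → g i = 0) →
      ∑ i ∈ Sᶜ, g i = ∑ j : J, g j := by
    intro g hg
    rw [← Finset.sum_filter_of_ne (p := fun i => MvPolynomial.pderiv i f ≠ 0)]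
    · symm
      refine Finset.sum_bij (fun (j : J) _ => (j : ι)) ?_ ?_ ?_ ?_
      · intro j _; simpa using j.2
      · intro j _ j' _ h; exact Subtype.ext h
      · intro i hi; exact ⟨⟨i, by simpa using hi⟩, Finset.mem_univ _, rfl⟩
      · intro j _; rfl
    · intro i hi hne h
      exact hne (hg i (by simpa using hi) h)
  -- a direction can be replaced by its restriction to the relevant facets
  have hres : ∀ y : ι → ℝ, (∀ k ∈ S, y k = 0) →
      dirDeriv (ext fun j => y j) f = dirDeriv y f := by
    intro y hy
    rw [dirDeriv_eq_sum_of_slack hy, dirDeriv_eq_sum_of_slack (hextS fun j => y j)]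
    refine Finset.sum_congr rfl fun i hi => ?_
    by_cases hi0 : MvPolynomial.pderiv i f = 0
    · simp [hi0]
    · have : i ∉ S ∧ MvPolynomial.pderiv i f ≠ 0 := ⟨by simpa using hi, hi0⟩
      rw [show ext (fun j => y j) i = y i from hext (fun j => y j) ⟨i, this⟩]
  have hpd : ∀ i ∉ S, Hereditary T (n + 2) (insert i S) (MvPolynomial.pderiv i f) :=
    fun i hi => hf.pderiv hi
  have hpos : ∀ j : J, ∀ c₁ ∈ T, ∀ c₂ ∈ T,
      0 < hessForm (MvPolynomial.pderiv (j : ι) f) L c₁ c₂ := by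
    intro j c₁ h₁ c₂ h₂
    refine (hpd j j.2.1).constantCoeff_pos hT j.2.2 (c₁ :: c₂ :: L) (by simp [hL]) ?_
    simpa [h₁, h₂] using hLT
  have hpp : ∀ L : List (ι → ℝ), L.length = n + 1 → (∀ c ∈ L, c ∈ T) → ∀ i j : J, i ≠ j →
      MvPolynomial.pderiv (j : ι) (MvPolynomial.pderiv (i : ι) f) ≠ 0 →
      0 < hessForm f L (Pi.single (i : ι) 1) (Pi.single (j : ι) 1) := by
    intro L hL hLT i j hij h
    rw [hessForm_single_single]
    refine ((hpd i i.2.1).pderiv (i := j) ?_).constantCoeff_pos hT h L hL hLT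
    simp only [Finset.mem_insert, not_or]
    exact ⟨fun h => hij (Subtype.ext h.symm), j.2.1⟩
  -- the matrix
  let M : Matrix J J ℝ := Matrix.of fun i j =>
    hessForm f (c :: L) (Pi.single (i : ι) 1) (Pi.single (j : ι) 1)
  have hM : M.IsHermitian := by
    ext i j
    simp only [M, Matrix.conjTranspose_apply, Matrix.of_apply, star_trivial]
    exact hessForm_comm _ _ _ _
  have hexts : ∀ y : J → ℝ, ext y = ∑ j, y j • (Pi.single (j : ι) 1 : ι → ℝ) := by
    intro y
    ext i
    simp only [Finset.sum_apply, Pi.smul_apply, smul_eq_mul]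
    by_cases h : i ∉ S ∧ MvPolynomial.pderiv i f ≠ 0
    · rw [show ext y i = y ⟨i, h⟩ from hext y ⟨i, h⟩, Finset.sum_eq_single ⟨i, h⟩]
      · simp
      · intro j _ hj
        rw [Pi.single_eq_of_ne, mul_zero]
        exact fun h' => hj (Subtype.ext h'.symm)
      · simp
    · simp only [ext]
      rw [dif_neg h, Finset.sum_eq_zero]
      intro j _
      rw [Pi.single_eq_of_ne, mul_zero]
      rintro rfl; exact h j.2
  have hMv : ∀ (y : J → ℝ) (i : J),
      M.mulVec y i = hessForm f (c :: L) (Pi.single (i : ι) 1) (ext y) := by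
    intro y i
    rw [hexts, map_sum]
    simp only [map_smul, smul_eq_mul, Matrix.mulVec, dotProduct, M, Matrix.of_apply]
    exact Finset.sum_congr rfl fun j _ => mul_comm _ _
  have hMM : ∀ y z : J → ℝ, y ⬝ᵥ M.mulVec z = hessForm f (c :: L) (ext y) (ext z) := by
    intro y z
    conv_rhs => rw [hexts y, map_sum, LinearMap.sum_apply]
    simp only [map_smul, LinearMap.smul_apply, smul_eq_mul, dotProduct, hMv]
  have hsingle : ∀ (i : ι) (y : ι → ℝ), hessForm f (c :: L) (Pi.single i 1) y =
      hessForm (MvPolynomial.pderiv i f) L y c := by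
    intro i y
    rw [hessForm_comm, hessForm_apply, hessForm_apply, dirDeriv_iterDirDeriv _ (c :: L),
      dirDeriv_single, iterDirDeriv_cons]
  -- the positive vector
  let e' : J → ℝ := fun j => e j
  have hee : dirDeriv (ext e') f = dirDeriv c f := (hres e heS).trans hef
  let p : J → ℝ := fun j => hessForm (MvPolynomial.pderiv (j : ι) f) L c c
  have hMe : M.mulVec e' = p := by
    funext j
    rw [hMv, hessForm_congr_right _ hee, hsingle]
  have key := hM.nonpos_of_bochner e' p (fun j => hepos j j.2.1) (fun j => hpos j c hc c hc) hMe
    ?_ ?_ ?_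
  · obtain ⟨y, hyS, hyf⟩ := hfc.shift x
    have hyx : dirDeriv (ext fun j => y j) f = dirDeriv x f := (hres y hyS).trans hyf
    have := key (fun j => y j) ?_
    · rw [hMM, hessForm_congr_left _ hyx, hessForm_congr_right _ hyx] at this
      exact this
    · rw [← hMe, hMM, hessForm_congr_left _ hyx, hessForm_congr_right _ (hee.trans hef.symm), hx]
  · intro i j hij
    by_cases h : MvPolynomial.pderiv (j : ι) (MvPolynomial.pderiv (i : ι) f) = 0
    · simp only [M, Matrix.of_apply]
      rw [hessForm_single_single, h, map_zero, map_zero]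
    · exact (hpp (c :: L) (by simp [hL]) hLT' i j hij h).le
  · intro z hz
    -- the Hessian at `c`
    set R := List.replicate (n + 1) c with hR
    have hRT : ∀ c' ∈ R, c' ∈ T := fun c' h => by rw [List.eq_of_mem_replicate h]; exact hc
    set m : J → ℝ := fun j => e j * hessForm f R (Pi.single (j : ι) 1) c with hm
    have hmpos : ∀ j, 0 < m j := by
      intro j
      refine mul_pos (hepos j j.2.1) ?_
      rw [hessForm_comm, hessForm_apply, dirDeriv_iterDirDeriv _ R, dirDeriv_single]
      exact (hpd j j.2.1).constantCoeff_pos hT j.2.2 (c :: R) (by simp [hR])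
        (by simpa [hc] using hRT)
    have hRe : ∀ (y y' : J → ℝ), (∀ i j, i ≠ j → M i j ≠ 0 → y' i = y' j) →
        hessForm f R (ext fun j => e j * y j) (ext fun j => e j * y' j) =
          ∑ j, m j * (y j * y' j) := by
      intro y y' hy'
      have h1 : ∀ j : J, hessForm f R (Pi.single (j : ι) 1) (ext fun j => e j * y' j) =
          y' j * hessForm f R (Pi.single (j : ι) 1) c := by
        intro j
        rw [← hessForm_congr_right _ hee, hexts fun j => e j * y' j, hexts e', map_sum,
          map_sum, Finset.mul_sum]
        refine Finset.sum_congr rfl fun k _ => ?_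
        rw [map_smul, map_smul, smul_eq_mul, smul_eq_mul]
        by_cases h : hessForm f R (Pi.single (j : ι) 1) (Pi.single (k : ι) 1) = 0
        · rw [h]; ring
        · have hjk : y' j = y' k := by
            by_cases hjk : j = k
            · rw [hjk]
            · refine hy' j k hjk (hpp (c :: L) (by simp [hL]) hLT' j k hjk ?_).ne'
              intro h'
              rw [hessForm_single_single, h', map_zero, map_zero] at h
              exact h rfl
          rw [hjk]; ring
      conv_lhs => rw [hexts (fun j => e j * y j), map_sum, LinearMap.sum_apply]
      refine Finset.sum_congr rfl fun j _ => ?_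
      rw [map_smul, LinearMap.smul_apply, h1, smul_eq_mul, hm]
      ring
    have hext1 : (ext fun j => e j * 1) = ext e' := by simp [e']
    have hlc := hfc.hessForm_replicate hc (ext fun j => e j * z j)
    rw [← hessForm_congr_right _ hee, ← hessForm_congr_right _ hee,
      ← hessForm_congr_left _ hee, ← hext1, hRe z z hz,
      hRe (fun _ => 1) (fun _ => 1) (fun _ _ _ _ => rfl),
      hRe z (fun _ => 1) (fun _ _ _ _ => rfl)] at hlc
    have hvar : ∑ i, ∑ j, m i * m j * (z i - z j) ^ 2 ≤ 0 := by
      have : ∑ i, ∑ j, m i * m j * (z i - z j) ^ 2 =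
          2 * ((∑ j, m j * (z j * z j)) * (∑ j, m j * (1 * 1)) - (∑ j, m j * (z j * 1)) ^ 2) := by
        have h1 : ∀ i j, m i * m j * (z i - z j) ^ 2 = m i * (z i * z i) * (m j * (1 * 1)) +
            m i * (1 * 1) * (m j * (z j * z j)) -
            2 * (m i * (z i * 1) * (m j * (z j * 1))) := fun i j => by ring
        simp only [h1, Finset.sum_sub_distrib, Finset.sum_add_distrib, ← Finset.mul_sum,
          ← Finset.sum_mul]
        ring
      linarith
    have h0 : ∀ i j, 0 ≤ m i * m j * (z i - z j) ^ 2 := fun i j => by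
      have := hmpos i; have := hmpos j; positivity
    intro i j
    have h1 := (Finset.sum_eq_zero_iff_of_nonneg fun i _ => Finset.sum_nonneg fun j _ => h0 i j).1
      (hvar.antisymm (Finset.sum_nonneg fun i _ => Finset.sum_nonneg fun j _ => h0 i j)) i
      (Finset.mem_univ i)
    have h2 := (Finset.sum_eq_zero_iff_of_nonneg fun j _ => h0 i j).1 h1 j (Finset.mem_univ j)
    have h3 : (z i - z j) ^ 2 = 0 :=
      (mul_eq_zero.1 h2).resolve_left (mul_pos (hmpos i) (hmpos j)).ne'
    exact sub_eq_zero.1 (pow_eq_zero_iff two_ne_zero |>.1 h3)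
  · intro y
    rw [hMM, hessForm_cons_eq_sum_of_slack f L heS hef, hsum]
    · refine Finset.sum_le_sum fun j _ => ?_
      rw [hMv, hsingle, mul_div_assoc]
      refine mul_le_mul_of_nonneg_left ?_ (hepos j j.2.1).le
      rw [le_div_iff₀ (hpos j c hc c hc)]
      exact ih j j.2.1 (ext y)
    · intro i hi h
      rw [h]; simp [hessForm_apply]

/-- The mixed second derivatives of a hereditary polynomial are Lorentzian. -/
theorem Hereditary.lorentz [DecidableEq ι] (hT : T.Nonempty) {n : ℕ} {S : Finset ι}
    {f : MvPolynomial ι ℝ} (hf : Hereditary T (n + 2) S f) {L : List (ι → ℝ)}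
    (hL : L.length = n) (hLT : ∀ c ∈ L, c ∈ T) (x : ι → ℝ) {c : ι → ℝ} (hc : c ∈ T) :
    hessForm f L x x * hessForm f L c c ≤ hessForm f L x c ^ 2 := by
  induction n generalizing S f L x c with
  | zero =>
    by_cases h0 : f = 0
    · simp [h0, hessForm_apply]
    · rw [List.length_eq_zero_iff.1 hL]
      exact (hf.faceCond h0).hessForm_replicate hc x
  | succ n ih =>
    by_cases h0 : f = 0
    · simp [h0, hessForm_apply]
    obtain ⟨a, L, rfl⟩ : ∃ a L', L = a :: L' := List.exists_cons_of_length_eq_add_one hL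
    have ha : a ∈ T := hLT a (by simp)
    have hLT' : ∀ c ∈ L, c ∈ T := fun c hc => hLT c (by simp [hc])
    have hL' : L.length = n := by simpa using hL
    obtain ⟨e, heS, hepos, hef⟩ := (hf.faceCond h0).slack a ha
    refine LinearMap.BilinForm.mul_le_sq_of_lorentzian _ (hessForm_comm f _) e ?_ x c ?_
    · intro y hy
      exact hf.nonpos_of_facets hT h0 ha hL' hLT' heS hepos hef
        (fun i hi x => ih (hf.pderiv hi) hL' hLT' x ha) y hy
    · exact hf.constantCoeff_pos hT h0 (c :: c :: a :: L) (by simp [hL']) (by simpa [hc] using hLT)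

end MvPolynomial

section Slicing

variable {E : Type*} [NormedAddCommGroup E] [NormedSpace ℝ E] [FiniteDimensional ℝ E]
  [MeasurableSpace E] [BorelSpace E]

/-- Slicing a Haar measure by the level sets of a linear functional. -/
theorem exists_measure_eq_mul_lintegral_slice (u : E →L[ℝ] ℝ) {w : E} (hw : u w = 1)
    (μ : Measure E) [μ.IsAddHaarMeasure] (ν : Measure u.ker) [ν.IsAddHaarMeasure] :
    ∃ c : ENNReal, c ≠ 0 ∧ c ≠ ⊤ ∧ ∀ s : Set E, MeasurableSet s →
      Measurable (fun t : ℝ => ν {x : u.ker | (x : E) + t • w ∈ s}) ∧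
      μ s = c * ∫⁻ t : ℝ, ν {x : u.ker | (x : E) + t • w ∈ s} := by
  let g : ℝ →L[ℝ] E := (ContinuousLinearMap.id ℝ ℝ).smulRight w
  have hg : Function.RightInverse g u := fun t => by simp [g, hw]
  let e := ContinuousLinearEquiv.equivOfRightInverse u g hg
  let μ' : Measure E := ((volume : Measure ℝ).prod ν).map e.symm
  have : μ'.IsAddHaarMeasure := e.symm.isAddHaarMeasure_map _
  have he : ∀ (t : ℝ) (x : u.ker), e.symm (t, x) = (x : E) + t • w := fun t x => by
    simp only [e, ContinuousLinearEquiv.equivOfRightInverse_symm_apply]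
    simp [g, add_comm]
  refine ⟨Measure.addHaarScalarFactor μ μ', ?_, ENNReal.coe_ne_top, fun s hs => ?_⟩
  · have := Measure.addHaarScalarFactor_pos_of_isAddHaarMeasure μ μ'
    exact_mod_cast this.ne'
  · have hs' : MeasurableSet (e.symm ⁻¹' s) := e.symm.continuous.measurable hs
    have hpre : ∀ t : ℝ, Prod.mk t ⁻¹' (e.symm ⁻¹' s) = {x : u.ker | (x : E) + t • w ∈ s} :=
      fun t => by ext x; simp [he]
    constructor
    · simpa only [hpre] using measurable_measure_prodMk_left (ν := ν) hs'
    · conv_lhs => rw [Measure.isAddLeftInvariant_eq_smul μ μ']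
      rw [Measure.smul_apply, Measure.map_apply e.symm.continuous.measurable hs,
        Measure.prod_apply hs']
      simp only [hpre]
      rfl

end Slicing

section PrekopaLeindler

/-- The one-dimensional Brunn–Minkowski inequality for midpoints. -/
theorem Real.volume_add_volume_le_of_midpoint {A B M : Set ℝ} (hA : IsCompact A) (hB : IsCompact B)
    (hAn : A.Nonempty) (hBn : B.Nonempty) (hM : ∀ x ∈ A, ∀ y ∈ B, (x + y) / 2 ∈ M) :
    volume A + volume B ≤ 2 * volume M := by
  obtain ⟨b, hb, hbmin⟩ := hB.exists_isLeast hBn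
  obtain ⟨a, ha, hamax⟩ := hA.exists_isGreatest hAn
  have h1 : (fun x => (x + b)) '' A ∪ (fun y => (a + y)) '' B ⊆ (2 : ℝ) • M := by
    rintro _ (⟨x, hx, rfl⟩ | ⟨y, hy, rfl⟩)
    · exact ⟨_, hM x hx b hb, by simp; ring⟩
    · exact ⟨_, hM a ha y hy, by simp; ring⟩
  have h2 : AEDisjoint volume ((fun x => (x + b)) '' A) ((fun y => (a + y)) '' B) := by
    refine measure_mono_null (t := {a + b}) ?_ (by simp)
    rintro _ ⟨⟨x, hx, rfl⟩, ⟨y, hy, hxy⟩⟩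
    have := hamax hx
    have := hbmin hy
    simp only at hxy
    simp only [Set.mem_singleton_iff]
    linarith
  have h3 := measure_union₀ (μ := volume) (hB.image (f := fun y : ℝ => a + y)
    (by fun_prop)).measurableSet.nullMeasurableSet h2
  have h4 := measure_mono (μ := volume) h1
  rw [h3, Measure.addHaar_smul] at h4
  simpa using h4

theorem Real.volume_add_volume_le_of_midpoint' {A B M : Set ℝ} (hA : MeasurableSet A)
    (hB : MeasurableSet B) (hAn : A.Nonempty) (hBn : B.Nonempty)
    (hM : ∀ x ∈ A, ∀ y ∈ B, (x + y) / 2 ∈ M) :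
    volume A + volume B ≤ 2 * volume M := by
  obtain ⟨a, ha⟩ := hAn
  obtain ⟨b, hb⟩ := hBn
  rw [hA.measure_eq_iSup_isCompact, hB.measure_eq_iSup_isCompact]
  simp only [iSup_and']
  refine ENNReal.biSup_add_biSup_le' ⟨∅, by simp⟩ ⟨∅, by simp⟩ ?_
  rintro K ⟨hKA, hK⟩ L ⟨hLB, hL⟩
  calc volume K + volume L ≤ volume (insert a K) + volume (insert b L) := by
        gcongr <;> exact Set.subset_insert _ _
    _ ≤ 2 * volume M := Real.volume_add_volume_le_of_midpoint (hK.insert a) (hL.insert b)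
        (Set.insert_nonempty _ _) (Set.insert_nonempty _ _) fun x hx y hy =>
          hM x (Set.insert_subset ha hKA hx) y (Set.insert_subset hb hLB hy)

theorem ENNReal.mul_le_sq_of_add_le {x y z : ENNReal} (h : x + y ≤ 2 * z) : x * y ≤ z ^ 2 := by
  by_cases hz : z = ⊤
  · simp [hz]
  have h2 : 2 * z ≠ ⊤ := ENNReal.mul_ne_top (by simp) hz
  have hx : x ≠ ⊤ := ne_top_of_le_ne_top h2 (le_self_add.trans h)
  have hy : y ≠ ⊤ := ne_top_of_le_ne_top h2 (le_add_self.trans h)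
  lift x to NNReal using hx
  lift y to NNReal using hy
  lift z to NNReal using hz
  norm_cast at h ⊢
  rw [← NNReal.coe_le_coe] at h ⊢
  push_cast at h ⊢
  nlinarith [sq_nonneg ((x : ℝ) - y), x.coe_nonneg, y.coe_nonneg, z.coe_nonneg]

theorem Real.lintegral_add_lintegral_le_of_midpoint {f g m : ℝ → ℝ} (hf : Measurable f)
    (hg : Measurable g) (hm : Measurable m) (hf0 : 0 ≤ f) (hg0 : 0 ≤ g) (hm0 : 0 ≤ m)
    (hf1 : IsLUB (Set.range f) 1) (hg1 : IsLUB (Set.range g) 1)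
    (h : ∀ x y, f x * g y ≤ m ((x + y) / 2) ^ 2) :
    (∫⁻ t, ENNReal.ofReal (f t)) + (∫⁻ t, ENNReal.ofReal (g t)) ≤
      2 * (∫⁻ t, ENNReal.ofReal (m t)) := by
  rw [lintegral_eq_lintegral_meas_lt _ (.of_forall hf0) hf.aemeasurable,
    lintegral_eq_lintegral_meas_lt _ (.of_forall hg0) hg.aemeasurable,
    lintegral_eq_lintegral_meas_lt _ (.of_forall hm0) hm.aemeasurable,
    ← lintegral_const_mul' _ _ (by simp), ← lintegral_add_left]
  · refine setLIntegral_mono_ae' measurableSet_Ioi (.of_forall fun s hs => ?_)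
    have hs : 0 < s := hs
    rcases lt_or_ge s 1 with hs1 | hs1
    · obtain ⟨_, ⟨a, rfl⟩, ha⟩ := (lt_isLUB_iff hf1).1 hs1
      obtain ⟨_, ⟨b, rfl⟩, hb⟩ := (lt_isLUB_iff hg1).1 hs1
      refine Real.volume_add_volume_le_of_midpoint' (measurableSet_lt measurable_const hf)
        (measurableSet_lt measurable_const hg) ⟨a, ha⟩ ⟨b, hb⟩ fun x hx y hy => ?_
      have hx : s < f x := hx
      have hy : s < g y := hy
      refine lt_of_pow_lt_pow_left₀ 2 (hm0 _) (lt_of_lt_of_le ?_ (h x y))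
      rw [sq]
      exact mul_lt_mul'' hx hy hs.le hs.le
    · have h1 : {a | s < f a} = ∅ := Set.eq_empty_of_forall_notMem fun a ha =>
        absurd (hs1.trans_lt ha) (not_lt.2 (hf1.1 ⟨a, rfl⟩))
      have h2 : {a | s < g a} = ∅ := Set.eq_empty_of_forall_notMem fun a ha =>
        absurd (hs1.trans_lt ha) (not_lt.2 (hg1.1 ⟨a, rfl⟩))
      rw [h1, h2]; simp
  · exact Antitone.measurable fun s s' hss' => measure_mono fun a ha => lt_of_le_of_lt hss' ha

/-- The one-dimensional Prékopa–Leindler inequality for midpoints. -/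
theorem Real.lintegral_mul_lintegral_le_of_midpoint {f g m : ℝ → ℝ} (hf : Measurable f)
    (hg : Measurable g) (hm : Measurable m) (hf0 : 0 ≤ f) (hg0 : 0 ≤ g) (hm0 : 0 ≤ m)
    (hfb : BddAbove (Set.range f)) (hgb : BddAbove (Set.range g))
    (h : ∀ x y, f x * g y ≤ m ((x + y) / 2) ^ 2) :
    (∫⁻ t, ENNReal.ofReal (f t)) * (∫⁻ t, ENNReal.ofReal (g t)) ≤
      (∫⁻ t, ENNReal.ofReal (m t)) ^ 2 := by
  have key : ∀ {f : ℝ → ℝ}, 0 ≤ f → BddAbove (Set.range f) → f = 0 ∨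
      ∃ a, 0 < a ∧ IsLUB (Set.range fun x => f x / a) 1 := by
    intro f hf hfb
    have hlub : IsLUB (Set.range f) (sSup (Set.range f)) := isLUB_csSup (Set.range_nonempty f) hfb
    set a := sSup (Set.range f)
    have ha : 0 ≤ a := (hf 0).trans (hlub.1 ⟨0, rfl⟩)
    rcases ha.eq_or_lt with ha | ha
    · exact Or.inl (funext fun x => le_antisymm ((hlub.1 ⟨x, rfl⟩).trans_eq ha.symm) (hf x))
    · refine Or.inr ⟨a, ha, ?_, fun b hb => ?_⟩
      · rintro _ ⟨x, rfl⟩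
        exact (div_le_one ha).2 (hlub.1 ⟨x, rfl⟩)
      · have : a ≤ b * a := hlub.2 (by
          rintro _ ⟨x, rfl⟩
          exact (div_le_iff₀ ha).1 (hb ⟨x, rfl⟩))
        exact (le_mul_iff_one_le_left ha).1 this
  rcases key hf0 hfb with rfl | ⟨a, ha, hfa⟩
  · simp
  rcases key hg0 hgb with rfl | ⟨b, hb, hgb⟩
  · simp
  have hab : 0 < a * b := mul_pos ha hb
  have hc : 0 < √(a * b) := Real.sqrt_pos.2 hab
  have h1 := Real.lintegral_add_lintegral_le_of_midpoint (hf.div_const a) (hg.div_const b)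
    (hm.div_const √(a * b)) (fun x => div_nonneg (hf0 x) ha.le) (fun x => div_nonneg (hg0 x) hb.le)
    (fun x => div_nonneg (hm0 x) hc.le) hfa hgb (fun x y => by
      rw [div_pow, Real.sq_sqrt hab.le, div_mul_div_comm]
      exact div_le_div_of_nonneg_right (h x y) hab.le)
  have h2 := ENNReal.mul_le_sq_of_add_le h1
  have hscale : ∀ (f : ℝ → ℝ) (a : ℝ), 0 < a → ∫⁻ t, ENNReal.ofReal (f t) =
      ENNReal.ofReal a * ∫⁻ t, ENNReal.ofReal (f t / a) := by
    intro f a ha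
    rw [← lintegral_const_mul' _ _ ENNReal.ofReal_ne_top]
    refine lintegral_congr fun t => ?_
    rw [← ENNReal.ofReal_mul ha.le, mul_div_cancel₀ _ ha.ne']
  rw [hscale f a ha, hscale g b hb, hscale m _ hc, mul_pow, ← ENNReal.ofReal_pow hc.le,
    Real.sq_sqrt hab.le, mul_mul_mul_comm, ← ENNReal.ofReal_mul ha.le]
  gcongr

end PrekopaLeindler

section BrunnMinkowski

universe v

variable {E : Type v} [NormedAddCommGroup E] [NormedSpace ℝ E]

theorem isCompact_slice {u : E →L[ℝ] ℝ} {K : Set E} (hK : IsCompact K) (w : E) (t : ℝ) :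
    IsCompact {x : u.ker | (x : E) + t • w ∈ K} := by
  have : Topology.IsClosedEmbedding fun x : u.ker => (x : E) + t • w :=
    (Homeomorph.addRight (t • w)).isClosedEmbedding.comp
      u.isClosed_ker.isClosedEmbedding_subtypeVal
  exact this.isCompact_preimage hK

theorem bddAbove_measure_slice [FiniteDimensional ℝ E] [MeasurableSpace E]
    {u : E →L[ℝ] ℝ} {w : E} (hw : u w = 1) (ν : Measure u.ker)
    [ν.IsAddHaarMeasure] {K : Set E} (hK : IsCompact K) :
    ∃ C : ENNReal, C ≠ ⊤ ∧ ∀ t : ℝ, ν {x : u.ker | (x : E) + t • w ∈ K} ≤ C := by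
  obtain ⟨R, hR⟩ := hK.isBounded.exists_norm_le
  refine ⟨ν (Metric.closedBall 0 (R + ‖u‖ * R * ‖w‖)), (isCompact_closedBall _ _).measure_lt_top.ne,
    fun t => measure_mono fun x hx => ?_⟩
  have hx : (x : E) + t • w ∈ K := hx
  have hut : u ((x : E) + t • w) = t := by
    have : u (x : E) = 0 := x.2
    simp [this, hw]
  have h1 : ‖t‖ ≤ ‖u‖ * R := by
    rw [← hut]
    exact (u.le_opNorm _).trans (by gcongr; exact hR _ hx)
  rw [mem_closedBall_zero_iff, Submodule.coe_norm]
  calc ‖(x : E)‖ = ‖((x : E) + t • w) - t • w‖ := by rw [add_sub_cancel_right]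
    _ ≤ ‖(x : E) + t • w‖ + ‖t‖ * ‖w‖ := (norm_sub_le _ _).trans (by rw [norm_smul])
    _ ≤ R + ‖u‖ * R * ‖w‖ := by
      gcongr
      exact hR _ hx

theorem finrank_ker_of_ne_zero [FiniteDimensional ℝ E] {u : E →L[ℝ] ℝ} {w : E} (hw : u w = 1)
    {n : ℕ}
    (hn : Module.finrank ℝ E = n + 1) : Module.finrank ℝ u.ker = n := by
  have h := LinearMap.finrank_range_add_finrank_ker (u : E →ₗ[ℝ] ℝ)
  have hr : LinearMap.range (u : E →ₗ[ℝ] ℝ) = ⊤ :=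
    LinearMap.range_eq_top.2 fun t => ⟨t • w, by simp [hw]⟩
  rw [hr, finrank_top, Module.finrank_self] at h
  omega

variable [FiniteDimensional ℝ E] [MeasurableSpace E] [BorelSpace E]

/-- The multiplicative Brunn–Minkowski inequality for midpoints of compact sets. -/
theorem MeasureTheory.Measure.mul_le_sq_of_midpoint (μ : Measure E) [μ.IsAddHaarMeasure]
    {K L M : Set E} (hK : IsCompact K) (hL : IsCompact L) (hM : IsCompact M)
    (h : ∀ x ∈ K, ∀ y ∈ L, (2⁻¹ : ℝ) • (x + y) ∈ M) : μ K * μ L ≤ μ M ^ 2 := by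
  obtain ⟨n, hn⟩ : ∃ n, Module.finrank ℝ E = n := ⟨_, rfl⟩
  induction n generalizing E with
  | zero =>
    have : Subsingleton E := Module.finrank_zero_iff.1 hn
    rcases K.eq_empty_or_nonempty with rfl | ⟨x, hx⟩
    · simp
    rcases L.eq_empty_or_nonempty with rfl | ⟨y, hy⟩
    · simp
    have hMu : M = Set.univ := Set.eq_univ_of_forall fun z => by
      rw [Subsingleton.elim z]; exact h x hx y hy
    rw [sq]
    gcongr <;> simp [hMu]
  | succ n ih =>
    have : Nontrivial E := Module.nontrivial_of_finrank_pos (R := ℝ) (by omega)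
    obtain ⟨w₀, hw₀⟩ := exists_ne (0 : E)
    obtain ⟨u, hu⟩ := SeparatingDual.exists_eq_one (R := ℝ) hw₀
    obtain ⟨c, -, -, hc⟩ := exists_measure_eq_mul_lintegral_slice u hu μ Measure.addHaar
    set ν : Measure u.ker := Measure.addHaar
    have hreal : ∀ {K : Set E}, IsCompact K →
        Measurable (fun t : ℝ => (ν {x : u.ker | (x : E) + t • w₀ ∈ K}).toReal) ∧
        BddAbove (Set.range fun t : ℝ => (ν {x : u.ker | (x : E) + t • w₀ ∈ K}).toReal) ∧
        μ K = c * ∫⁻ t : ℝ, ENNReal.ofReal (ν {x : u.ker | (x : E) + t • w₀ ∈ K}).toReal := by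
      intro K hK
      obtain ⟨h1, h2⟩ := hc K hK.measurableSet
      refine ⟨h1.ennreal_toReal, ?_, ?_⟩
      · obtain ⟨C, hC, hle⟩ := bddAbove_measure_slice hu ν hK
        refine ⟨C.toReal, ?_⟩
        rintro _ ⟨t, rfl⟩
        exact ENNReal.toReal_mono hC (hle t)
      · rw [h2]
        congr 1
        exact lintegral_congr fun t =>
          (ENNReal.ofReal_toReal (isCompact_slice hK w₀ t).measure_lt_top.ne).symm
    obtain ⟨hK1, hK2, hK3⟩ := hreal hK
    obtain ⟨hL1, hL2, hL3⟩ := hreal hL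
    obtain ⟨hM1, -, hM3⟩ := hreal hM
    have := Real.lintegral_mul_lintegral_le_of_midpoint hK1 hL1 hM1 (fun _ => ENNReal.toReal_nonneg)
      (fun _ => ENNReal.toReal_nonneg) (fun _ => ENNReal.toReal_nonneg) hK2 hL2 fun s t => by
        rw [← ENNReal.toReal_mul, ← ENNReal.toReal_pow]
        refine ENNReal.toReal_mono
          (ENNReal.pow_ne_top (isCompact_slice hM w₀ _).measure_lt_top.ne) ?_
        refine ih ν (isCompact_slice hK w₀ s) (isCompact_slice hL w₀ t) (isCompact_slice hM w₀ _)
          (fun x hx y hy => ?_) (finrank_ker_of_ne_zero hu hn)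
        have := h _ hx _ hy
        have hxy : (2⁻¹ : ℝ) • (((x : E) + s • w₀) + ((y : E) + t • w₀)) =
            (2⁻¹ : ℝ) • ((x : E) + y) + ((s + t) / 2) • w₀ := by module
        rwa [hxy] at this
    rw [hK3, hL3, hM3, mul_pow, mul_mul_mul_comm, ← sq]
    gcongr

end BrunnMinkowski

/-- A function with continuous partial derivatives is differentiable along lines. -/
theorem hasDerivAt_add_smul_of_partial {ι : Type*} [Fintype ι] [DecidableEq ι] {T : Set (ι → ℝ)}
    (hT : IsOpen T) {v : (ι → ℝ) → ℝ} {F : ι → (ι → ℝ) → ℝ} (hF : ∀ i, Continuous (F i))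
    (hv : ∀ i, ∀ p ∈ T, HasDerivAt (fun s => v (Function.update p i s)) (F i p) (p i))
    {p : ι → ℝ} (hp : p ∈ T) (x : ι → ℝ) :
    HasDerivAt (fun t : ℝ => v (p + t • x)) (∑ i, x i * F i p) 0 := by
  have key : ∀ s : Finset ι, HasDerivAt (fun t : ℝ => v (p + t • s.piecewise x 0))
      (∑ i ∈ s, x i * F i p) 0 := by
    intro s
    induction s using Finset.induction_on with
    | empty => simpa using hasDerivAt_const (0 : ℝ) (v p)
    | insert a s ha ih =>
      rw [Finset.sum_insert ha]
      have hD : HasDerivAt (fun t : ℝ => v (p + t • (insert a s).piecewise x 0) -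
          v (p + t • s.piecewise x 0)) (x a * F a p) 0 := by
        rw [hasDerivAt_iff_isLittleO, Asymptotics.isLittleO_iff]
        intro ε hε
        set ε' := ε / (|x a| + 1) with hε'
        have hε'0 : 0 < ε' := by positivity
        obtain ⟨δ, hδ, hball⟩ : ∃ δ > 0, ∀ q, dist q p < δ → q ∈ T ∧ |F a q - F a p| ≤ ε' := by
          have h1 : ∀ᶠ q in nhds p, q ∈ T ∧ |F a q - F a p| ≤ ε' := by
            refine (hT.eventually_mem hp).and ?_
            have := (hF a).continuousAt (x := p)
            filter_upwards [Metric.tendsto_nhds.1 this ε' hε'0] with q hq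
            rw [Real.dist_eq] at hq
            exact hq.le
          exact Metric.eventually_nhds_iff.1 h1
        have hsmall : ∀ᶠ t : ℝ in nhds 0, |t| * (‖x‖ + 1) < δ := by
          have : Filter.Tendsto (fun t : ℝ => |t| * (‖x‖ + 1)) (nhds 0) (nhds 0) := by
            have h : Continuous fun t : ℝ => |t| * (‖x‖ + 1) := by fun_prop
            simpa using h.tendsto 0
          exact this.eventually (gt_mem_nhds hδ)
        filter_upwards [hsmall] with t ht
        set q : ι → ℝ := p + t • s.piecewise x 0 with hq
        have hqa : q a = p a := by simp [hq, ha]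
        have hins : p + t • (insert a s).piecewise x 0 = Function.update q a (p a + t * x a) := by
          ext i
          by_cases hi : i = a
          · subst hi; simp
          · rw [Function.update_of_ne hi]
            simp [hq, Finset.piecewise_insert, hi]
        have hmem : ∀ σ ∈ Set.uIcc (p a) (p a + t * x a), dist (Function.update q a σ) p < δ := by
          intro σ hσ
          refine lt_of_le_of_lt ((dist_pi_le_iff (by positivity)).2 fun i => ?_) ht
          have hxi : ∀ i, |x i| ≤ ‖x‖ + 1 := fun i => (norm_le_pi_norm x i).trans (by linarith)
          by_cases hi : i = a
          · subst hi
            rw [Function.update_self, Real.dist_eq]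
            have := Set.abs_sub_left_of_mem_uIcc hσ
            rw [add_sub_cancel_left, abs_mul] at this
            exact this.trans (by gcongr; exact hxi i)
          · rw [Function.update_of_ne hi, Real.dist_eq, hq]
            by_cases his : i ∈ s
            · simp only [Pi.add_apply, Pi.smul_apply, smul_eq_mul, add_sub_cancel_left, abs_mul,
                Finset.piecewise_eq_of_mem _ _ _ his]
              gcongr; exact hxi i
            · simp only [Pi.add_apply, Pi.smul_apply, smul_eq_mul, add_sub_cancel_left, abs_mul,
                Finset.piecewise_eq_of_notMem _ _ _ his]
              simp; positivity
        have hmv := Convex.norm_image_sub_le_of_norm_hasDerivWithin_le (C := ε')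
          (f := fun σ => v (Function.update q a σ) - σ * F a p)
          (f' := fun σ => F a (Function.update q a σ) - 1 * F a p)
          (s := Set.uIcc (p a) (p a + t * x a)) (x := p a) (y := p a + t * x a)
          (fun σ hσ => ?_) (fun σ hσ => ?_) (convex_uIcc _ _) Set.left_mem_uIcc Set.right_mem_uIcc
        · rw [hins]
          rw [← hqa, Function.update_eq_self, hqa] at hmv
          simp only [zero_smul, add_zero, sub_self, sub_zero, smul_eq_mul]
          have h2 : v (Function.update q a (p a + t * x a)) - v q - t * (x a * F a p) =
              v (Function.update q a (p a + t * x a)) - (p a + t * x a) * F a p -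
                (v q - p a * F a p) := by ring
          rw [h2]
          refine hmv.trans ?_
          rw [add_sub_cancel_left, norm_mul, Real.norm_eq_abs (x a), hε']
          have h3 : ε / (|x a| + 1) * |x a| ≤ ε := by
            rw [div_mul_eq_mul_div, div_le_iff₀ (by positivity)]
            nlinarith [abs_nonneg (x a)]
          calc ε / (|x a| + 1) * (‖t‖ * |x a|) = ε / (|x a| + 1) * |x a| * ‖t‖ := by ring
            _ ≤ ε * ‖t‖ := by gcongr
        · have h3 := hv a (Function.update q a σ) (hball _ (hmem σ hσ)).1
          simp only [Function.update_idem, Function.update_self] at h3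
          exact (h3.sub ((hasDerivAt_id σ).mul_const _)).hasDerivWithinAt
        · rw [one_mul]
          exact (hball _ (hmem σ hσ)).2
      simpa using hD.fun_add ih
  simpa using key Finset.univ

theorem mul_deriv_deriv_le_sq_of_mul_le_sq {φ φ' : ℝ → ℝ} {φ'' : ℝ}
    (h1 : ∀ t, HasDerivAt φ (φ' t) t) (h2 : HasDerivAt φ' φ'' 0)
    (h : ∀ᶠ t in nhds 0, φ t * φ (-t) ≤ φ 0 ^ 2) : φ 0 * φ'' ≤ φ' 0 ^ 2 := by
  by_contra! hlt
  set g : ℝ → ℝ := fun t => φ t * φ (-t) with hg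
  have hneg : ∀ t : ℝ, HasDerivAt (fun t => φ (-t)) (-φ' (-t)) t := fun t => by
    simpa [Function.comp_def] using (h1 (-t)).comp t (hasDerivAt_neg t)
  have hd : ∀ t, HasDerivAt g (φ' t * φ (-t) + φ t * -φ' (-t)) t := fun t => (h1 t).mul (hneg t)
  have hd' : deriv g = fun t => φ' t * φ (-t) + φ t * -φ' (-t) := funext fun t => (hd t).deriv
  have h2' : HasDerivAt (fun t => -φ' (-t)) φ'' 0 := by
    have : HasDerivAt φ' φ'' (-0) := by simpa using h2
    simpa [Function.comp_def] using (this.comp (0 : ℝ) (hasDerivAt_neg 0)).fun_neg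
  have hdd : HasDerivAt (deriv g) (2 * (φ 0 * φ'' - φ' 0 ^ 2)) 0 := by
    rw [hd']
    have h3 := (h2.fun_mul (hneg 0)).fun_add ((h1 0).fun_mul h2')
    simp only [neg_zero] at h3
    exact h3.congr_deriv (by ring)
  have hmin := isLocalMin_of_deriv_deriv_pos (f := g) (x₀ := 0) (by rw [hdd.deriv]; linarith)
    (by rw [hd']; simp; ring) (hd 0).continuousAt
  have hconst : g =ᶠ[nhds 0] fun _ => φ 0 ^ 2 := by
    filter_upwards [h, hmin] with t ht ht'
    simp only [hg, neg_zero] at ht' ⊢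
    exact le_antisymm ht (by rw [sq]; exact ht')
  have h3 : deriv g =ᶠ[nhds 0] fun _ => 0 := by
    simpa using hconst.deriv
  have := h3.deriv_eq
  rw [hdd.deriv, deriv_const] at this
  linarith

namespace MvPolynomial

variable {ι : Type*}

theorem hasDerivAt_eval_add_smul (f : MvPolynomial ι ℝ) (p x : ι → ℝ) (t : ℝ) :
    HasDerivAt (fun t : ℝ => eval (p + t • x) f) (eval (p + t • x) (dirDeriv x f)) t := by
  induction f using MvPolynomial.induction_on with
  | C a => simpa [dirDeriv] using hasDerivAt_const t a
  | add f g hf hg => simpa using hf.fun_add hg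
  | mul_X f i hf =>
    have hX : HasDerivAt (fun t : ℝ => p i + t * x i) (x i) t := by
      simpa using ((hasDerivAt_id t).mul_const (x i)).const_add (p i)
    have e : (fun t : ℝ => eval (p + t • x) (f * X i)) =
        fun t => eval (p + t • x) f * (p i + t * x i) := by
      funext t
      simp
    rw [e]
    refine (hf.fun_mul hX).congr_deriv ?_
    simp [Derivation.leibniz]
    ring

theorem hasDerivAt_eval_update [DecidableEq ι] (f : MvPolynomial ι ℝ) (p : ι → ℝ) (i : ι) :
    HasDerivAt (fun s : ℝ => eval (Function.update p i s) f) (eval p (pderiv i f)) (p i) := by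
  have h := hasDerivAt_eval_add_smul f p (Pi.single i 1) (p i - p i)
  have h2 := h.comp_sub_const (p i) (p i)
  rw [dirDeriv_single, sub_self] at h2
  have e : (fun s : ℝ => eval (Function.update p i s) f) =
      fun s => eval (p + (s - p i) • Pi.single i 1) f := by
    funext s
    congr 2
    ext j
    by_cases hj : j = i
    · subst hj; simp
    · simp [hj]
  rw [e]
  exact h2.congr_deriv (by simp)

theorem eq_of_eval_eq_of_isOpen [Fintype ι] {T : Set (ι → ℝ)} (hT : IsOpen T) (hTn : T.Nonempty)
    {f g : MvPolynomial ι ℝ} (h : ∀ x ∈ T, eval x f = eval x g) : f = g := by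
  obtain ⟨a, ha⟩ := hTn
  obtain ⟨ε, hε, hball⟩ := Metric.isOpen_iff.1 hT a ha
  refine funext_set (fun i => Metric.ball (a i) ε) (fun i => ?_) fun x hx => h x (hball ?_)
  · rw [Real.ball_eq_Ioo]
    exact Set.Ioo_infinite (by linarith)
  · rw [Metric.mem_ball, dist_pi_lt_iff hε]
    exact fun i => hx i trivial

/-- The linear shear `x ↦ x - x_i • a`. -/
def shear (i : ι) (a x : ι → ℝ) : ι → ℝ := x - x i • a

/-- Composition of a polynomial with a shear. -/
noncomputable def compShear (i : ι) (a : ι → ℝ) : MvPolynomial ι ℝ →ₐ[ℝ] MvPolynomial ι ℝ :=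
  aeval fun k => X k - C (a k) * X i

theorem eval_compShear (i : ι) (a x : ι → ℝ) (f : MvPolynomial ι ℝ) :
    eval x (compShear i a f) = eval (shear i a x) f := by
  induction f using MvPolynomial.induction_on with
  | C r => simp [compShear]
  | add f g hf hg => simp [hf, hg]
  | mul_X f k hf =>
    rw [map_mul, map_mul, hf, map_mul]
    congr 1
    simp [compShear, shear, mul_comm]

theorem dirDeriv_compShear (i : ι) (a x : ι → ℝ) (f : MvPolynomial ι ℝ) :
    dirDeriv x (compShear i a f) = compShear i a (dirDeriv (shear i a x) f) := by
  induction f using MvPolynomial.induction_on with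
  | C r => simp [compShear, dirDeriv]
  | add f g hf hg => simp [hf, hg]
  | mul_X f k hf =>
    have h1 : compShear i a (X k) = X k - C (a k) * X i := by simp [compShear]
    have h2 : dirDeriv x (X k - C (a k) * X i) = C (x k) - C (a k) * C (x i) := by
      rw [map_sub, ← smul_eq_C_mul, Derivation.map_smul]; simp [smul_eq_C_mul]
    have h3 : compShear i a (C (shear i a x k)) = C (x k) - C (a k) * C (x i) := by
      simp [compShear, shear, mul_comm]
    rw [map_mul, Derivation.leibniz, Derivation.leibniz, h1, h2, dirDeriv_X, map_add, smul_eq_mul,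
      smul_eq_mul, smul_eq_mul, smul_eq_mul, map_mul, map_mul, h1, h3, hf]

theorem IsHomogeneous.compShear {n : ℕ} {f : MvPolynomial ι ℝ} (hf : f.IsHomogeneous n) (i : ι)
    (a : ι → ℝ) : (compShear i a f).IsHomogeneous n := by
  have := hf.aeval (fun k => (X k - C (a k) * X i : MvPolynomial ι ℝ)) (n := 1) fun k => by
    refine (isHomogeneous_X ℝ k).sub ?_
    simpa using (isHomogeneous_C ι (a k)).mul (isHomogeneous_X ℝ i)
  rwa [one_mul] at this

theorem shear_of_eq_zero {i : ι} {x : ι → ℝ} (a : ι → ℝ) (hx : x i = 0) : shear i a x = x := by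
  simp [shear, hx]

theorem pderiv_compShear [DecidableEq ι] {i j : ι} (hij : j ≠ i) (a : ι → ℝ)
    (f : MvPolynomial ι ℝ) : pderiv j (compShear i a f) = compShear i a (pderiv j f) := by
  rw [← dirDeriv_single, dirDeriv_compShear, shear_of_eq_zero _ (by simp [hij.symm]),
    dirDeriv_single]

variable [Fintype ι] {T : Set (ι → ℝ)} {n : ℕ} {S : Finset ι} {f : MvPolynomial ι ℝ}

theorem FaceCond.compShear {i : ι} (hi : i ∈ S) (a : ι → ℝ)
    (hf : FaceCond (shear i a '' T) n S f) : FaceCond T n S (compShear i a f) where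
  homogeneous := hf.homogeneous.compShear i a
  pos c hc := by rw [eval_compShear]; exact hf.pos _ ⟨c, hc, rfl⟩
  logConcave c hc x := by
    simp only [dirDeriv_compShear, eval_compShear]
    exact hf.logConcave _ ⟨c, hc, rfl⟩ _
  slack c hc := by
    obtain ⟨e, he, hpos, hef⟩ := hf.slack _ ⟨c, hc, rfl⟩
    refine ⟨e, he, hpos, ?_⟩
    rw [dirDeriv_compShear, dirDeriv_compShear, shear_of_eq_zero _ (he i hi), hef]
  shift x := by
    obtain ⟨y, hy, hyf⟩ := hf.shift (shear i a x)
    refine ⟨y, hy, ?_⟩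
    rw [dirDeriv_compShear, dirDeriv_compShear, shear_of_eq_zero _ (hy i hi), hyf]

theorem Hereditary.compShear [DecidableEq ι] {i : ι} (hi : i ∈ S) (a : ι → ℝ)
    (hf : Hereditary (shear i a '' T) n S f) : Hereditary T n S (compShear i a f) := by
  induction n generalizing S f with
  | zero =>
    rcases hf with rfl | hf
    · exact Or.inl (map_zero _)
    · exact Or.inr (hf.compShear hi a)
  | succ n ih =>
    rcases hf with rfl | ⟨hf, hf'⟩
    · exact Or.inl (map_zero _)
    · refine Or.inr ⟨hf.compShear hi a, fun j hj => ?_⟩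
      rw [pderiv_compShear (ne_of_mem_of_not_mem hi hj).symm]
      exact ih (Finset.mem_insert_of_mem hi) (hf' j hj)

theorem FaceCond.const_smul {r : ℝ} (hr : 0 < r) (hf : FaceCond T n S f) :
    FaceCond T n S (r • f) where
  homogeneous := by
    rw [smul_eq_C_mul]
    simpa using (isHomogeneous_C ι r).mul hf.homogeneous
  pos c hc := by rw [smul_eval]; exact mul_pos hr (hf.pos c hc)
  logConcave c hc x := by
    simp only [Derivation.map_smul, smul_eval]
    nlinarith [mul_le_mul_of_nonneg_left (hf.logConcave c hc x) (sq_nonneg r)]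
  slack c hc := by
    obtain ⟨e, he, hpos, hef⟩ := hf.slack c hc
    exact ⟨e, he, hpos, by rw [Derivation.map_smul, Derivation.map_smul, hef]⟩
  shift x := by
    obtain ⟨y, hy, hyf⟩ := hf.shift x
    exact ⟨y, hy, by rw [Derivation.map_smul, Derivation.map_smul, hyf]⟩

theorem Hereditary.const_smul [DecidableEq ι] {r : ℝ} (hr : 0 < r) (hf : Hereditary T n S f) :
    Hereditary T n S (r • f) := by
  induction n generalizing S f with
  | zero =>
    rcases hf with rfl | hf
    · exact Or.inl (smul_zero _)
    · exact Or.inr (hf.const_smul hr)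
  | succ n ih =>
    rcases hf with rfl | ⟨hf, hf'⟩
    · exact Or.inl (smul_zero _)
    · refine Or.inr ⟨hf.const_smul hr, fun j hj => ?_⟩
      rw [Derivation.map_smul]
      exact ih (hf' j hj)

end MvPolynomial

section Polyhedron

variable {ι E : Type*} [NormedAddCommGroup E] [NormedSpace ℝ E]

/-- The polyhedron cut out by the inequalities `u k x ≤ h k` for `k ∈ A`. -/
def polyhedron (u : ι → E →L[ℝ] ℝ) (A : Finset ι) (h : ι → ℝ) : Set E :=
  {x | ∀ k ∈ A, u k x ≤ h k}

/-- At every point of the polyhedron the tight inequalities are linearly independent. -/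
def IsSimplePolyhedron (u : ι → E →L[ℝ] ℝ) (A : Finset ι) (h : ι → ℝ) : Prop :=
  ∀ x ∈ polyhedron u A h, ∀ r : ι → ℝ, ∃ y, ∀ k ∈ A, u k x = h k → u k y = r k

/-- The functionals indexed by `A` positively span the dual space. -/
def PositivelySpans (u : ι → E →L[ℝ] ℝ) (A : Finset ι) : Prop :=
  ∀ y, (∀ k ∈ A, u k y ≤ 0) → y = 0

variable {u : ι → E →L[ℝ] ℝ} {A : Finset ι} {h h' : ι → ℝ}

theorem isClosed_polyhedron (u : ι → E →L[ℝ] ℝ) (A : Finset ι) (h : ι → ℝ) :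
    IsClosed (polyhedron u A h) := by
  simp only [polyhedron, Set.ofPred_forall]
  exact isClosed_biInter fun k _ => isClosed_le (u k).continuous continuous_const

theorem add_smul_mem_polyhedron {a b : ℝ} (ha : 0 ≤ a) (hb : 0 ≤ b) {x y : E}
    (hx : x ∈ polyhedron u A h) (hy : y ∈ polyhedron u A h') :
    a • x + b • y ∈ polyhedron u A (a • h + b • h') := fun k hk => by
  simp only [map_add, map_smul, smul_eq_mul, Pi.add_apply, Pi.smul_apply]
  exact add_le_add (mul_le_mul_of_nonneg_left (hx k hk) ha)
    (mul_le_mul_of_nonneg_left (hy k hk) hb)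

theorem convex_polyhedron (u : ι → E →L[ℝ] ℝ) (A : Finset ι) (h : ι → ℝ) :
    Convex ℝ (polyhedron u A h) := fun x hx y hy a b ha hb hab => by
  have := add_smul_mem_polyhedron ha hb hx hy
  rwa [← add_smul, hab, one_smul] at this

theorem PositivelySpans.exists_norm_le [FiniteDimensional ℝ E] (hA : PositivelySpans u A) :
    ∃ C, 0 ≤ C ∧ ∀ x : E, ∀ t, 0 ≤ t → (∀ k ∈ A, u k x ≤ t) → ‖x‖ ≤ C * t := by
  set g : E → ℝ := fun x => ∑ k ∈ A, max (u k x) 0 with hg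
  have hgc : Continuous g := by fun_prop
  have hg0 : ∀ x, g x ≤ 0 → x = 0 := fun x hx => hA x fun k hk => by
    have h1 := Finset.single_le_sum (f := fun k => max (u k x) 0) (fun i _ => le_max_right _ _) hk
    exact (le_max_left _ _).trans (h1.trans hx)
  rcases (Metric.sphere (0 : E) 1).eq_empty_or_nonempty with hS | hS
  · refine ⟨0, le_rfl, fun x t _ _ => ?_⟩
    by_contra! hx
    rw [zero_mul] at hx
    have : ‖x‖⁻¹ • x ∈ Metric.sphere (0 : E) 1 := by
      simp [norm_smul, hx.ne']
    rw [hS] at this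
    exact this
  · have : ProperSpace E := FiniteDimensional.proper ℝ E
    obtain ⟨z, hz, hmin⟩ := (isCompact_sphere (0 : E) 1).exists_isMinOn hS hgc.continuousOn
    have hgz : 0 < g z := by
      by_contra! hle
      have := hg0 z hle
      simp [this] at hz
    refine ⟨A.card / g z, by positivity, fun x t ht hx => ?_⟩
    rcases eq_or_ne x 0 with rfl | hx0
    · simpa using by positivity
    have hxp : 0 < ‖x‖ := norm_pos_iff.2 hx0
    have h1 : g z ≤ g (‖x‖⁻¹ • x) := hmin (by simp [norm_smul, hxp.ne'])
    have h2 : g (‖x‖⁻¹ • x) = ‖x‖⁻¹ * g x := by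
      simp only [hg, map_smul, smul_eq_mul, Finset.mul_sum]
      refine Finset.sum_congr rfl fun k _ => ?_
      rw [mul_max_of_nonneg _ _ (by positivity), mul_zero]
    have h3 : g x ≤ A.card * t := by
      rw [← nsmul_eq_mul]
      exact Finset.sum_le_card_nsmul _ _ _ fun k hk => max_le (hx k hk) ht
    rw [h2, ← div_eq_inv_mul, le_div_iff₀ hxp] at h1
    rw [div_mul_eq_mul_div, le_div_iff₀ hgz]
    linarith

theorem PositivelySpans.isCompact_polyhedron [FiniteDimensional ℝ E] (hA : PositivelySpans u A)
    (h : ι → ℝ) : IsCompact (polyhedron u A h) := by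
  have : ProperSpace E := FiniteDimensional.proper ℝ E
  obtain ⟨C, -, hC⟩ := hA.exists_norm_le
  refine Metric.isCompact_of_isClosed_isBounded (isClosed_polyhedron u A h) ?_
  refine (Metric.isBounded_closedBall (x := (0 : E)) (r := C * ∑ k ∈ A, |h k|)).subset
    fun x hx => ?_
  rw [mem_closedBall_zero_iff]
  refine hC x _ (Finset.sum_nonneg fun k _ => abs_nonneg _) fun k hk => (hx k hk).trans ?_
  exact (le_abs_self _).trans
    (Finset.single_le_sum (f := fun k => |h k|) (fun i _ => abs_nonneg _) hk)

theorem IsSimplePolyhedron.exists_lt (hs : IsSimplePolyhedron u A h)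
    (hne : (polyhedron u A h).Nonempty) : ∃ x, ∀ k ∈ A, u k x < h k := by
  obtain ⟨x, hx⟩ := hne
  obtain ⟨y, hy⟩ := hs x hx fun _ => -1
  have h1 : ∀ᶠ t in nhdsWithin (0 : ℝ) (Set.Ioi 0), ∀ k ∈ A, u k (x + t • y) < h k := by
    rw [Filter.eventually_all_finset]
    intro k hk
    rcases (hx k hk).lt_or_eq with hlt | heq
    · have hc : Continuous fun t : ℝ => u k (x + t • y) := by fun_prop
      have := hc.tendsto 0
      simp only [zero_smul, add_zero] at this
      exact (this.mono_left nhdsWithin_le_nhds).eventually (gt_mem_nhds hlt)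
    · filter_upwards [self_mem_nhdsWithin] with t ht
      rw [map_add, map_smul, hy k hk heq, heq, smul_eq_mul]
      linarith [show (0 : ℝ) < t from ht]
  obtain ⟨t, ht⟩ := h1.exists
  exact ⟨_, ht⟩

theorem polyhedron_add_eq_vadd (u : ι → E →L[ℝ] ℝ) (A : Finset ι) (h : ι → ℝ) (a : E) :
    polyhedron u A (h + fun k => u k a) = a +ᵥ polyhedron u A h := by
  ext x
  rw [Set.mem_vadd_set_iff_neg_vadd_mem]
  simp only [polyhedron, Set.mem_ofPred_eq, Pi.add_apply, vadd_eq_add, map_add, map_neg]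
  exact forall₂_congr fun k _ => by constructor <;> intro <;> linarith

theorem polyhedron_smul (u : ι → E →L[ℝ] ℝ) (A : Finset ι) (h : ι → ℝ) {t : ℝ} (ht : 0 < t) :
    polyhedron u A (t • h) = t • polyhedron u A h := by
  ext x
  rw [Set.mem_smul_set_iff_inv_smul_mem₀ ht.ne']
  simp only [polyhedron, Set.mem_ofPred_eq, Pi.smul_apply, smul_eq_mul, map_smul]
  exact forall₂_congr fun k _ => (inv_mul_le_iff₀ ht).symm

theorem PositivelySpans.isClosed_exists_tight [Finite ι] [FiniteDimensional ℝ E]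
    (hA : PositivelySpans u A) (J : Set ι) :
    IsClosed {h : ι → ℝ | ∃ x ∈ polyhedron u A h, ∀ k ∈ J, u k x = h k} := by
  have : Fintype ι := Fintype.ofFinite ι
  obtain ⟨C, hC0, hC⟩ := hA.exists_norm_le
  have : ProperSpace E := FiniteDimensional.proper ℝ E
  refine isClosed_of_closure_subset fun h hh => ?_
  obtain ⟨s, hsN, hsh⟩ := mem_closure_iff_seq_limit.1 hh
  choose x hx hxJ using hsN
  obtain ⟨R, hR⟩ := hsh.norm.bddAbove_range
  have hxb : ∀ n, x n ∈ Metric.closedBall (0 : E) (C * |R|) := fun n => by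
    rw [mem_closedBall_zero_iff]
    refine hC _ _ (abs_nonneg R) fun k hk => (hx n k hk).trans ?_
    exact (le_abs_self _).trans ((norm_le_pi_norm (s n) k).trans
      ((hR ⟨n, rfl⟩).trans (le_abs_self R)))
  obtain ⟨y, -, φ, hφ, hy⟩ := (isCompact_closedBall (0 : E) (C * |R|)).tendsto_subseq hxb
  have hu : ∀ k, Filter.Tendsto (fun n => u k (x (φ n))) Filter.atTop (nhds (u k y)) := fun k =>
    ((u k).continuous.tendsto y).comp hy
  have hh : ∀ k, Filter.Tendsto (fun n => s (φ n) k) Filter.atTop (nhds (h k)) := fun k =>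
    ((tendsto_pi_nhds.1 hsh) k).comp hφ.tendsto_atTop
  refine ⟨y, fun k hk => le_of_tendsto_of_tendsto' (hu k) (hh k) fun n => hx (φ n) k hk,
    fun k hk => tendsto_nhds_unique (hu k) ?_⟩
  simpa only [hxJ _ k hk] using hh k

theorem isOpen_exists_lt (u : ι → E →L[ℝ] ℝ) (A : Finset ι) :
    IsOpen {h : ι → ℝ | ∃ x, ∀ k ∈ A, u k x < h k} := by
  simp only [Set.ofPred_exists, Set.ofPred_forall]
  refine isOpen_iUnion fun x => A.finite_toSet.isOpen_biInter fun k _ => ?_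
  exact isOpen_lt continuous_const (continuous_apply k)

theorem polyhedron_nonempty_of_mem [Finite ι] [FiniteDimensional ℝ E] {T : Set (ι → ℝ)}
    (hTc : Convex ℝ T) (hs : ∀ h ∈ T, IsSimplePolyhedron u A h)
    (hA : PositivelySpans u A) {c : ι → ℝ}
    (hc : c ∈ T) (hne : (polyhedron u A c).Nonempty) :
    ∀ h ∈ T, (polyhedron u A h).Nonempty := by
  set U : Set (ι → ℝ) := {h | ∃ x, ∀ k ∈ A, u k x < h k} with hU
  set N : Set (ι → ℝ) := {h | (polyhedron u A h).Nonempty} with hN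
  have hUo : IsOpen U := isOpen_exists_lt u A
  have hNc : IsClosed N := by
    simpa [hN, Set.Nonempty] using hA.isClosed_exists_tight ∅
  have hUN : U ⊆ N := fun h ⟨x, hx⟩ => ⟨x, fun k hk => (hx k hk).le⟩
  have hTU : T ⊆ U := by
    refine hTc.isPreconnected.subset_of_closure_inter_subset hUo
      ⟨c, hc, (hs c hc).exists_lt hne⟩ ?_
    rintro h ⟨hhU, hhT⟩
    exact (hs h hhT).exists_lt (hNc.closure_subset_iff.2 hUN hhU)
  exact fun h hh => hUN (hTU hh)

end Polyhedron

section PolyhedronVolume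

variable {ι E : Type*} [NormedAddCommGroup E] [NormedSpace ℝ E] [FiniteDimensional ℝ E]
  [MeasurableSpace E] [BorelSpace E] {u : ι → E →L[ℝ] ℝ} {A : Finset ι} {T : Set (ι → ℝ)}

theorem measureReal_polyhedron_smul (μ : Measure E) [μ.IsAddHaarMeasure] (u : ι → E →L[ℝ] ℝ)
    (A : Finset ι) (h : ι → ℝ) {t : ℝ} (ht : 0 < t) :
    μ.real (polyhedron u A (t • h)) = t ^ Module.finrank ℝ E * μ.real (polyhedron u A h) := by
  rw [polyhedron_smul u A h ht, measureReal_def, Measure.addHaar_smul, ENNReal.toReal_mul,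
    ENNReal.toReal_ofReal (abs_nonneg _), abs_of_pos (pow_pos ht _), measureReal_def]

variable [Fintype ι] [DecidableEq ι]

open MvPolynomial in
/-- The volume polynomial of a nonempty polyhedron satisfies the face conditions. -/
theorem faceCond_of_eval_eq_measureReal {μ : Measure E} [μ.IsAddHaarMeasure]
    (hTo : IsOpen T) (hs : ∀ h ∈ T, IsSimplePolyhedron u A h)
    (hA : PositivelySpans u A) (hne : ∀ h ∈ T, (polyhedron u A h).Nonempty) {n : ℕ}
    {f : MvPolynomial ι ℝ} (hf : f.IsHomogeneous n)
    (hfT : ∀ h ∈ T, eval h f = μ.real (polyhedron u A h)) (hfA : ∀ i ∉ A, pderiv i f = 0) :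
    FaceCond T n Aᶜ f where
  homogeneous := hf
  pos c hc := by
    obtain ⟨x, hx⟩ := (hs c hc).exists_lt (hne c hc)
    rw [hfT c hc]
    refine ENNReal.toReal_pos (Measure.measure_pos_of_nonempty_interior μ ⟨x, ?_⟩).ne'
      (hA.isCompact_polyhedron c).measure_lt_top.ne
    refine mem_interior.2 ⟨{x | ∀ k ∈ A, u k x < c k}, fun y hy k hk => (hy k hk).le, ?_, hx⟩
    simp only [Set.ofPred_forall]
    exact A.finite_toSet.isOpen_biInter fun k _ => isOpen_lt (u k).continuous continuous_const
  logConcave c hc x := by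
    have key := mul_deriv_deriv_le_sq_of_mul_le_sq (hasDerivAt_eval_add_smul f c x)
      (hasDerivAt_eval_add_smul (dirDeriv x f) c x 0) ?_
    · simpa using key
    have hcont : Continuous fun t : ℝ => c + t • x := by fun_prop
    have h1 : ∀ᶠ t : ℝ in nhds 0, c + t • x ∈ T :=
      hcont.continuousAt.eventually_mem (hTo.mem_nhds (by simpa using hc))
    have h2 : ∀ᶠ t : ℝ in nhds 0, c + (-t) • x ∈ T :=
      (hcont.comp continuous_neg).continuousAt.eventually_mem
        (hTo.mem_nhds (by simpa using hc))
    filter_upwards [h1, h2] with t ht1 ht2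
    rw [zero_smul, add_zero, hfT _ ht1, hfT _ ht2, hfT _ hc]
    have := Measure.mul_le_sq_of_midpoint μ (hA.isCompact_polyhedron (c + t • x))
      (hA.isCompact_polyhedron (c + (-t) • x)) (hA.isCompact_polyhedron c) fun y hy z hz => by
        have h3 := add_smul_mem_polyhedron (by norm_num : (0 : ℝ) ≤ 2⁻¹)
          (by norm_num : (0 : ℝ) ≤ 2⁻¹) hy hz
        rw [smul_add]
        convert h3 using 2
        module
    have h3 := ENNReal.toReal_mono
      (ENNReal.pow_ne_top (hA.isCompact_polyhedron c).measure_lt_top.ne) this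
    rwa [ENNReal.toReal_mul, ENNReal.toReal_pow] at h3
  slack c hc := by
    obtain ⟨x, hx⟩ := (hs c hc).exists_lt (hne c hc)
    have h0 : dirDeriv (fun k => u k x) f = 0 := by
      refine eq_of_eval_eq_of_isOpen hTo ⟨c, hc⟩ fun p hp => ?_
      have hd := hasDerivAt_eval_add_smul f p (fun k => u k x) 0
      rw [zero_smul, add_zero] at hd
      rw [map_zero]
      refine hd.unique ?_
      refine (hasDerivAt_const (0 : ℝ) (eval p f)).congr_of_eventuallyEq ?_
      have hcont : Continuous fun t : ℝ => p + t • fun k => u k x := by fun_prop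
      have h1 : ∀ᶠ t : ℝ in nhds 0, (p + t • fun k => u k x) ∈ T :=
        hcont.continuousAt.eventually_mem (hTo.mem_nhds (by simpa using hp))
      filter_upwards [h1] with t ht
      have h2 : (p + t • fun k => u k x) = p + fun k => u k (t • x) := by
        ext k
        simp
      rw [hfT _ ht, hfT _ hp, h2, polyhedron_add_eq_vadd, measureReal_def, measureReal_def,
        measure_vadd]
    refine ⟨fun k => if k ∈ A then c k - u k x else 0, fun k hk => ?_, fun k hk => ?_, ?_⟩
    · simp [Finset.mem_compl.1 hk]
    · have : k ∈ A := by simpa using hk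
      simp [this, hx k this]
    · rw [← sub_zero (dirDeriv c f), ← h0, dirDeriv_eq_sum, dirDeriv_eq_sum, dirDeriv_eq_sum,
        ← Finset.sum_sub_distrib]
      refine Finset.sum_congr rfl fun i _ => ?_
      by_cases hi : i ∈ A
      · simp [hi, sub_smul]
      · simp [hi, hfA i hi]
  shift x := by
    refine ⟨fun k => if k ∈ A then x k else 0, fun k hk => by simp [Finset.mem_compl.1 hk], ?_⟩
    rw [dirDeriv_eq_sum, dirDeriv_eq_sum]
    refine Finset.sum_congr rfl fun i _ => ?_
    by_cases hi : i ∈ A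
    · simp [hi]
    · simp [hi, hfA i hi]

end PolyhedronVolume

section Facet

variable {ι E : Type*} [NormedAddCommGroup E] [NormedSpace ℝ E] {u : ι → E →L[ℝ] ℝ} {A : Finset ι}
  [DecidableEq ι]

/-- The restriction of the functionals `u k` to the kernel of `u i`. -/
noncomputable def facetFunctional (u : ι → E →L[ℝ] ℝ) (i : ι) (k : ι) : (u i).ker →L[ℝ] ℝ :=
  (u k).comp (u i).ker.subtypeL

/-- The values of the functionals `u k`, `k ≠ i`, at `w`, and zero at `i`. -/
noncomputable def facetShift (u : ι → E →L[ℝ] ℝ) (i : ι) (w : E) : ι → ℝ :=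
  Function.update (fun k => u k w) i 0

theorem PositivelySpans.facet (hA : PositivelySpans u A) (i : ι) :
    PositivelySpans (facetFunctional u i) (A.erase i) := fun y hy => by
  refine Subtype.ext (hA y fun k hk => ?_)
  by_cases hki : k = i
  · subst hki
    exact le_of_eq y.2
  · exact hy k (Finset.mem_erase.2 ⟨hki, hk⟩)

theorem mem_polyhedron_facet {i : ι} {w : E} {p : ι → ℝ} {t : ℝ} (x : (u i).ker) :
    x ∈ polyhedron (facetFunctional u i) (A.erase i)
      (MvPolynomial.shear i (facetShift u i w) (Function.update p i t)) ↔
    (x : E) + t • w ∈ polyhedron u (A.erase i) p := by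
  refine forall₂_congr fun k hk => ?_
  have hki := Finset.ne_of_mem_erase hk
  simp only [facetFunctional, MvPolynomial.shear, facetShift, Pi.sub_apply, Pi.smul_apply,
    Function.update_self, Function.update_of_ne hki, smul_eq_mul, map_add, map_smul,
    ContinuousLinearMap.comp_apply, Submodule.subtypeL_apply]
  exact le_sub_iff_add_le

theorem mem_polyhedron_iff_erase {i : ι} (hi : i ∈ A) {w : E} (hw : u i w = 1) {p : ι → ℝ}
    {s t : ℝ} (x : (u i).ker) :
    (x : E) + t • w ∈ polyhedron u A (Function.update p i s) ↔
      t ≤ s ∧ (x : E) + t • w ∈ polyhedron u (A.erase i) p := by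
  have hx : u i x = 0 := x.2
  constructor
  · intro h
    refine ⟨by simpa [hx, hw] using h i hi, fun k hk => ?_⟩
    have := h k (Finset.mem_of_mem_erase hk)
    rwa [Function.update_of_ne (Finset.ne_of_mem_erase hk)] at this
  · rintro ⟨hts, h⟩ k hk
    by_cases hki : k = i
    · subst hki
      simpa [hx, hw] using hts
    · rw [Function.update_of_ne hki]
      exact h k (Finset.mem_erase.2 ⟨hki, hk⟩)

theorem IsSimplePolyhedron.facet {i : ι} (hi : i ∈ A) {w : E} (hw : u i w = 1) {p : ι → ℝ}
    (hs : IsSimplePolyhedron u A p) :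
    IsSimplePolyhedron (facetFunctional u i) (A.erase i)
      (MvPolynomial.shear i (facetShift u i w) p) := by
  intro x hx r
  have hp : Function.update p i (p i) = p := Function.update_eq_self i p
  rw [← hp, mem_polyhedron_facet] at hx
  have hx' := (mem_polyhedron_iff_erase hi hw (s := p i) x).2 ⟨le_rfl, hx⟩
  rw [hp] at hx'
  have hxi : u i x = 0 := x.2
  obtain ⟨y, hy⟩ := hs _ hx' (Function.update r i 0)
  have hyi : u i y = 0 := by simpa using hy i hi (by simp [hxi, hw])
  refine ⟨⟨y, hyi⟩, fun k hk hkx => ?_⟩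
  have hki := Finset.ne_of_mem_erase hk
  have := hy k (Finset.mem_of_mem_erase hk) ?_
  · rwa [Function.update_of_ne hki] at this
  · simp only [facetFunctional, MvPolynomial.shear, facetShift, Pi.sub_apply, Pi.smul_apply,
      Function.update_of_ne hki, smul_eq_mul, ContinuousLinearMap.comp_apply,
      Submodule.subtypeL_apply] at hkx
    rw [map_add, map_smul, smul_eq_mul, hkx]
    ring

variable [FiniteDimensional ℝ E] [MeasurableSpace E] [BorelSpace E]

theorem exists_hasDerivAt_measureReal_polyhedron (hA : PositivelySpans u A) {i : ι} (hi : i ∈ A)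
    {w : E} (hw : u i w = 1) (μ : Measure E) [μ.IsAddHaarMeasure] (ν : Measure (u i).ker)
    [ν.IsAddHaarMeasure] : ∃ κ : ℝ, 0 < κ ∧ ∀ T : Set (ι → ℝ), IsOpen T →
      ∀ g : MvPolynomial ι ℝ, (∀ p ∈ T, MvPolynomial.eval
        (MvPolynomial.shear i (facetShift u i w) p) g = ν.real (polyhedron (facetFunctional u i)
          (A.erase i) (MvPolynomial.shear i (facetShift u i w) p))) →
      ∀ p ∈ T, HasDerivAt (fun s => μ.real (polyhedron u A (Function.update p i s)))
        (κ * MvPolynomial.eval (MvPolynomial.shear i (facetShift u i w) p) g) (p i) := by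
  obtain ⟨c, hc0, hct, hc⟩ := exists_measure_eq_mul_lintegral_slice (u i) hw μ ν
  refine ⟨c.toReal, ENNReal.toReal_pos hc0 hct, fun T hT g hg p hp => ?_⟩
  set H : ℝ → ENNReal := fun t => ν {x : (u i).ker | (x : E) + t • w ∈ polyhedron u (A.erase i) p}
    with hH
  have hHm : Measurable H := (hc _ (isClosed_polyhedron u _ p).measurableSet).1
  have hHeq : ∀ t, H t = ν (polyhedron (facetFunctional u i) (A.erase i)
      (MvPolynomial.shear i (facetShift u i w) (Function.update p i t))) := fun t => by
    refine congrArg ν ?_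
    ext x
    exact (mem_polyhedron_facet x).symm
  have hHfin : ∀ t, H t ≠ ⊤ := fun t => by
    rw [hHeq]
    exact ((hA.facet i).isCompact_polyhedron _).measure_lt_top.ne
  have hvol : ∀ s, μ (polyhedron u A (Function.update p i s)) = c * ∫⁻ t in Set.Iic s, H t := by
    intro s
    rw [(hc _ (isClosed_polyhedron u A _).measurableSet).2,
      ← lintegral_indicator measurableSet_Iic]
    congr 2 with t
    by_cases hts : t ≤ s
    · rw [Set.indicator_of_mem (show t ∈ Set.Iic s from hts)]
      congr 1
      ext x
      exact (mem_polyhedron_iff_erase hi hw x).trans (and_iff_right hts)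
    · rw [Set.indicator_of_notMem (show t ∉ Set.Iic s from hts)]
      convert measure_empty (μ := ν)
      exact Set.eq_empty_of_forall_notMem fun x hx =>
        hts ((mem_polyhedron_iff_erase hi hw x).1 hx).1
  have hfin : ∀ s, ∫⁻ t in Set.Iic s, H t ≠ ⊤ := fun s hs => by
    have h1 := (hA.isCompact_polyhedron (Function.update p i s)).measure_lt_top (μ := μ)
    rw [hvol, hs, ENNReal.mul_top hc0] at h1
    exact lt_irrefl _ h1
  have h_integrable : ∀ s, IntegrableOn (fun t => (H t).toReal) (Set.Iic s) := fun s =>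
    integrable_toReal_of_lintegral_ne_top hHm.aemeasurable (hfin s)
  have hreal : ∀ s, μ.real (polyhedron u A (Function.update p i s)) =
      c.toReal * ∫ t in Set.Iic s, (H t).toReal := fun s => by
    rw [measureReal_def, hvol, ENNReal.toReal_mul, integral_toReal hHm.aemeasurable
      (Filter.Eventually.of_forall fun t => (hHfin t).lt_top)]
  have hupd : Continuous fun t : ℝ => Function.update p i t :=
    continuous_const.update i continuous_id
  have hpi : Function.update p i (p i) = p := Function.update_eq_self i p
  have hev : (fun t => (H t).toReal) =ᶠ[nhds (p i)] fun t => MvPolynomial.eval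
      (MvPolynomial.shear i (facetShift u i w) (Function.update p i t)) g := by
    have : ∀ᶠ t in nhds (p i), Function.update p i t ∈ T :=
      hupd.continuousAt.eventually_mem (hT.mem_nhds (by rwa [hpi]))
    filter_upwards [this] with t ht
    rw [hg _ ht, measureReal_def, hHeq]
  have hgc : Continuous fun t => MvPolynomial.eval
      (MvPolynomial.shear i (facetShift u i w) (Function.update p i t)) g := by
    refine (MvPolynomial.continuous_eval g).comp ?_
    unfold MvPolynomial.shear
    fun_prop
  have hder : HasDerivAt (fun s => ∫ t in (p i)..s, (H t).toReal)
      (H (p i)).toReal (p i) := by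
    refine intervalIntegral.integral_hasDerivAt_right ?_ ?_ ?_
    · simp
    · exact hHm.ennreal_toReal.stronglyMeasurable.stronglyMeasurableAtFilter
    · exact hgc.continuousAt.congr hev.symm
  have h1 : ∀ s, μ.real (polyhedron u A (Function.update p i s)) = c.toReal *
      ((∫ t in Set.Iic (p i), (H t).toReal) + ∫ t in (p i)..s, (H t).toReal) := fun s => by
    rw [hreal, ← intervalIntegral.integral_Iic_sub_Iic (h_integrable (p i)) (h_integrable s)]
    ring
  simp only [h1]
  have h2 := hev.eq_of_nhds
  simp only [hpi] at h2
  rw [← h2]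
  exact (hder.const_add _).const_mul _

end Facet

theorem exists_facet_polynomial {ι E : Type*} [NormedAddCommGroup E] [NormedSpace ℝ E]
    {u : ι → E →L[ℝ] ℝ} {A : Finset ι} [DecidableEq ι] [FiniteDimensional ℝ E]
    [MeasurableSpace E] [BorelSpace E] [Fintype ι] {T : Set (ι → ℝ)} {n : ℕ}
    (hn : Module.finrank ℝ E = n + 1)
    (IH : ∀ {i : ι} (ν : Measure (u i).ker) [ν.IsAddHaarMeasure]
      (u' : ι → (u i).ker →L[ℝ] ℝ) (A' : Finset ι) (T' : Set (ι → ℝ)), IsOpen T' → Convex ℝ T' →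
      T'.Nonempty → (∀ h ∈ T', IsSimplePolyhedron u' A' h) → PositivelySpans u' A' →
      Module.finrank ℝ (u i).ker = n →
      ∃ f : MvPolynomial ι ℝ, f.IsHomogeneous n ∧
        (∀ h ∈ T', MvPolynomial.eval h f = ν.real (polyhedron u' A' h)) ∧
        (∀ i ∉ A', MvPolynomial.pderiv i f = 0) ∧ MvPolynomial.Hereditary T' n A'ᶜ f)
    (μ : Measure E) [μ.IsAddHaarMeasure] (hTo : IsOpen T) (hTc : Convex ℝ T) (hTn : T.Nonempty)
    (hs : ∀ h ∈ T, IsSimplePolyhedron u A h) (hA : PositivelySpans u A)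
    (hne : ∀ h ∈ T, (polyhedron u A h).Nonempty) (i : ι) :
    ∃ F : MvPolynomial ι ℝ, F.IsHomogeneous n ∧
      (∀ p ∈ T, HasDerivAt (fun s => μ.real (polyhedron u A (Function.update p i s)))
        (MvPolynomial.eval p F) (p i)) ∧
      (∀ j ∉ A, MvPolynomial.pderiv j F = 0) ∧ (i ∉ A → F = 0) ∧
      (i ∈ A → MvPolynomial.Hereditary T n (insert i Aᶜ) F) := by
  have hzero : (∀ p ∈ T, HasDerivAt (fun s => μ.real (polyhedron u A (Function.update p i s)))
      0 (p i)) → ∃ F : MvPolynomial ι ℝ, F.IsHomogeneous n ∧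
      (∀ p ∈ T, HasDerivAt (fun s => μ.real (polyhedron u A (Function.update p i s)))
        (MvPolynomial.eval p F) (p i)) ∧
      (∀ j ∉ A, MvPolynomial.pderiv j F = 0) ∧ (i ∉ A → F = 0) ∧
      (i ∈ A → MvPolynomial.Hereditary T n (insert i Aᶜ) F) := fun h0 => by
    refine ⟨0, MvPolynomial.isHomogeneous_zero _ _ _, by simpa using h0, by simp, fun _ => rfl,
      fun _ => ?_⟩
    cases n <;> exact Or.inl rfl
  by_cases hi : i ∈ A
  swap
  · refine hzero fun p _ => ?_
    have : ∀ s, polyhedron u A (Function.update p i s) = polyhedron u A p := fun s => by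
      ext x
      refine forall₂_congr fun k hk => ?_
      rw [Function.update_of_ne (ne_of_mem_of_not_mem hk hi)]
    simp only [this]
    exact hasDerivAt_const _ _
  by_cases hui : u i = 0
  · refine hzero fun p hp => ?_
    have hpi : 0 < p i := by
      obtain ⟨x, hx⟩ := (hs p hp).exists_lt (hne p hp)
      simpa [hui] using hx i hi
    have : ∀ s, 0 < s → polyhedron u A (Function.update p i s) = polyhedron u A p := fun s hsp => by
      ext x
      refine forall₂_congr fun k hk => ?_
      by_cases hki : k = i
      · subst hki
        simp [hui, hsp.le, hpi.le]
      · rw [Function.update_of_ne hki]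
    refine (hasDerivAt_const (p i) (μ.real (polyhedron u A p))).congr_of_eventuallyEq ?_
    filter_upwards [lt_mem_nhds hpi] with s hsp
    rw [this s hsp]
  · obtain ⟨w, hw⟩ : ∃ w, u i w = 1 := by
      obtain ⟨v, hv⟩ : ∃ v, u i v ≠ 0 := by
        by_contra! hall
        exact hui (ContinuousLinearMap.ext hall)
      exact ⟨(u i v)⁻¹ • v, by simp [hv]⟩
    set ν : Measure (u i).ker := Measure.addHaar with hν
    set a := facetShift u i w with ha
    have hai : a i = 0 := by simp [ha, facetShift]
    obtain ⟨κ, hκ, hder⟩ := exists_hasDerivAt_measureReal_polyhedron hA hi hw μ ν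
    have hc : ∀ b : ι → ℝ, Continuous (MvPolynomial.shear i b) := fun b => by
      unfold MvPolynomial.shear
      fun_prop
    have hinv : ∀ x, MvPolynomial.shear i (-a) (MvPolynomial.shear i a x) = x := fun x => by
      simp [MvPolynomial.shear, hai]
    have hinv' : ∀ x, MvPolynomial.shear i a (MvPolynomial.shear i (-a) x) = x := fun x => by
      simp [MvPolynomial.shear, hai]
    have himg : MvPolynomial.shear i a '' T = MvPolynomial.shear i (-a) ⁻¹' T :=
      congrFun (Set.image_eq_preimage_of_inverse hinv hinv') T
    have hopen : IsOpen (MvPolynomial.shear i a '' T) := by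
      rw [himg]
      exact hTo.preimage (hc _)
    have hconv : Convex ℝ (MvPolynomial.shear i a '' T) :=
      hTc.is_linear_image (f := MvPolynomial.shear i a)
        ⟨fun x y => by simp [MvPolynomial.shear, add_smul]; abel,
          fun r x => by simp [MvPolynomial.shear, smul_sub, mul_smul]⟩
    obtain ⟨g, hgh, hgT, hgA, hgH⟩ := IH ν (facetFunctional u i) (A.erase i)
      (MvPolynomial.shear i a '' T) hopen hconv (hTn.image _)
      (by rintro _ ⟨p, hp, rfl⟩; exact (hs p hp).facet hi hw) (hA.facet i)
      (finrank_ker_of_ne_zero hw hn)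
    have hcompl : insert i Aᶜ = (A.erase i)ᶜ := by
      ext j
      simp [or_iff_not_imp_left]
    refine ⟨κ • MvPolynomial.compShear i a g, ?_, fun p hp => ?_, fun j hj => ?_, fun h => ?_,
      fun _ => ?_⟩
    · rw [MvPolynomial.smul_eq_C_mul]
      simpa using (MvPolynomial.isHomogeneous_C ι κ).mul (hgh.compShear i a)
    · rw [MvPolynomial.smul_eval, MvPolynomial.eval_compShear]
      exact hder T hTo g (fun q hq => hgT _ ⟨q, hq, rfl⟩) p hp
    · have hji : j ≠ i := (ne_of_mem_of_not_mem hi hj).symm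
      rw [Derivation.map_smul, MvPolynomial.pderiv_compShear hji, hgA j (by simp [hj]), map_zero,
        smul_zero]
    · exact absurd hi h
    · rw [hcompl]
      exact (MvPolynomial.Hereditary.compShear (by simp) a hgH).const_smul hκ

universe v

open MvPolynomial in
/-- The volume of a simple polyhedron is a polynomial in its support numbers. -/
theorem exists_volume_polynomial {ι : Type*} [Fintype ι] [DecidableEq ι] (n : ℕ) :
    ∀ {E : Type v} [NormedAddCommGroup E] [NormedSpace ℝ E] [FiniteDimensional ℝ E]
      [MeasurableSpace E] [BorelSpace E] (μ : Measure E) [μ.IsAddHaarMeasure]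
      (u : ι → E →L[ℝ] ℝ) (A : Finset ι) (T : Set (ι → ℝ)), IsOpen T → Convex ℝ T →
      T.Nonempty → (∀ h ∈ T, IsSimplePolyhedron u A h) → PositivelySpans u A →
      Module.finrank ℝ E = n →
      ∃ f : MvPolynomial ι ℝ, f.IsHomogeneous n ∧
        (∀ h ∈ T, eval h f = μ.real (polyhedron u A h)) ∧
        (∀ i ∉ A, pderiv i f = 0) ∧ Hereditary T n Aᶜ f := by
  induction n with
  | zero =>
    intro E _ _ _ _ _ μ _ u A T hTo hTc hTn hs hA hn
    obtain ⟨c, hc⟩ := hTn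
    by_cases hne : (polyhedron u A c).Nonempty
    swap
    · refine ⟨0, isHomogeneous_zero _ _ _, fun h hh => ?_, by simp, Or.inl rfl⟩
      have : ¬ (polyhedron u A h).Nonempty := fun h' =>
        hne (polyhedron_nonempty_of_mem hTc hs hA hh h' c hc)
      rw [Set.not_nonempty_iff_eq_empty.1 this]
      simp
    have hall := polyhedron_nonempty_of_mem hTc hs hA hc hne
    have : Subsingleton E := Module.finrank_zero_iff.1 hn
    have hfT : ∀ h ∈ T, eval h (C (μ.real Set.univ)) = μ.real (polyhedron u A h) := fun h hh => by
      rw [eval_C, Subsingleton.eq_univ_of_nonempty (hall h hh)]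
    exact ⟨C (μ.real Set.univ), isHomogeneous_C _ _, hfT, by simp,
      Or.inr (faceCond_of_eval_eq_measureReal hTo hs hA hall (isHomogeneous_C _ _) hfT (by simp))⟩
  | succ n ih =>
    intro E _ _ _ _ _ μ _ u A T hTo hTc hTn hs hA hn
    have hTn' := hTn
    obtain ⟨c, hc⟩ := hTn
    by_cases hne : (polyhedron u A c).Nonempty
    swap
    · refine ⟨0, isHomogeneous_zero _ _ _, fun h hh => ?_, by simp, Or.inl rfl⟩
      have : ¬ (polyhedron u A h).Nonempty := fun h' =>
        hne (polyhedron_nonempty_of_mem hTc hs hA hh h' c hc)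
      rw [Set.not_nonempty_iff_eq_empty.1 this]
      simp
    have hall := polyhedron_nonempty_of_mem hTc hs hA hc hne
    choose F hFh hFd hFA hF0 hFH using exists_facet_polynomial (u := u) (A := A) (T := T) hn
      (fun ν _ u' A' T' => ih ν u' A' T') μ hTo hTc hTn' hs hA hall
    set f : MvPolynomial ι ℝ := ((n + 1 : ℝ)⁻¹) • ∑ i, X i * F i with hf
    have hfh : f.IsHomogeneous (n + 1) := by
      rw [hf, smul_eq_C_mul]
      have : (∑ i, X i * F i : MvPolynomial ι ℝ).IsHomogeneous (n + 1) :=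
        IsHomogeneous.sum _ _ _ fun i _ => by
          rw [add_comm]
          exact (isHomogeneous_X ℝ i).mul (hFh i)
      simpa using (isHomogeneous_C ι ((n + 1 : ℝ)⁻¹)).mul this
    have hfT : ∀ h ∈ T, eval h f = μ.real (polyhedron u A h) := fun h hh => by
      have h1 := hasDerivAt_add_smul_of_partial hTo (v := fun h => μ.real (polyhedron u A h))
        (F := fun i p => eval p (F i)) (fun i => continuous_eval _) (fun i p hp => hFd i p hp) hh h
      have h2 : HasDerivAt (fun t : ℝ => (1 + t) ^ (n + 1) * μ.real (polyhedron u A h))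
          ((n + 1) * μ.real (polyhedron u A h)) 0 := by
        have := (((hasDerivAt_id (0 : ℝ)).const_add 1).fun_pow (n + 1)).mul_const
          (μ.real (polyhedron u A h))
        simpa using this
      have h3 := h1.unique (h2.congr_of_eventuallyEq ?_)
      · rw [hf, smul_eval, map_sum]
        simp only [map_mul, eval_X]
        rw [h3]
        field_simp
      · filter_upwards [lt_mem_nhds (show (-1 : ℝ) < 0 by norm_num)] with t ht
        have : h + t • h = (1 + t) • h := by rw [add_smul, one_smul]
        rw [this, measureReal_polyhedron_smul μ u A h (by linarith), hn]
    have hpd : ∀ i, pderiv i f = F i := fun i =>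
      eq_of_eval_eq_of_isOpen hTo ⟨c, hc⟩ fun p hp => by
        refine (hasDerivAt_eval_update f p i).unique ((hFd i p hp).congr_of_eventuallyEq ?_)
        have hcont : Continuous fun t : ℝ => Function.update p i t :=
          continuous_const.update i continuous_id
        have : ∀ᶠ t in nhds (p i), Function.update p i t ∈ T :=
          hcont.continuousAt.eventually_mem (hTo.mem_nhds (by simpa using hp))
        filter_upwards [this] with t ht
        exact hfT _ ht
    have hfA : ∀ i ∉ A, pderiv i f = 0 := fun i hi => by rw [hpd, hF0 i hi]
    refine ⟨f, hfh, hfT, hfA, Or.inr ⟨?_, fun i hi => ?_⟩⟩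
    · exact faceCond_of_eval_eq_measureReal hTo hs hA hall hfh hfT hfA
    · rw [hpd]
      exact hFH i (by simpa using hi)

section Polyhedral

variable {E E' : Type*} [NormedAddCommGroup E] [NormedSpace ℝ E] [NormedAddCommGroup E']
  [NormedSpace ℝ E']

/-- A set is polyhedral if it is a finite intersection of closed half-spaces. -/
def IsPolyhedral (s : Set E) : Prop :=
  ∃ F : Finset ((E →L[ℝ] ℝ) × ℝ), s = {x | ∀ p ∈ F, p.1 x ≤ p.2}

theorem IsPolyhedral.inter {s t : Set E} (hs : IsPolyhedral s) (ht : IsPolyhedral t) :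
    IsPolyhedral (s ∩ t) := by
  classical
  obtain ⟨F, rfl⟩ := hs
  obtain ⟨G, rfl⟩ := ht
  refine ⟨F ∪ G, ?_⟩
  ext x
  simp only [Set.mem_inter_iff, Set.mem_ofPred_eq, Finset.mem_union]
  exact ⟨fun h p hp => hp.elim (h.1 p) (h.2 p), fun h => ⟨fun p hp => h p (Or.inl hp),
    fun p hp => h p (Or.inr hp)⟩⟩

theorem IsPolyhedral.biInter {α : Type*} {s : α → Set E} (t : Finset α)
    (hs : ∀ i ∈ t, IsPolyhedral (s i)) : IsPolyhedral (⋂ i ∈ t, s i) := by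
  classical
  induction t using Finset.induction_on with
  | empty => exact ⟨∅, by simp⟩
  | insert a t _ ih =>
    rw [Finset.set_biInter_insert]
    exact (hs a (Finset.mem_insert_self a t)).inter
      (ih fun i hi => hs i (Finset.mem_insert_of_mem hi))

theorem isPolyhedral_halfSpace (f : E →L[ℝ] ℝ) (c : ℝ) : IsPolyhedral {x | f x ≤ c} :=
  ⟨{(f, c)}, by simp⟩

theorem IsPolyhedral.preimage {s : Set E} (hs : IsPolyhedral s) (g : E' →L[ℝ] E) :
    IsPolyhedral (g ⁻¹' s) := by
  classical
  obtain ⟨F, rfl⟩ := hs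
  refine ⟨F.image fun p => (p.1.comp g, p.2), ?_⟩
  ext x
  simp only [Set.mem_preimage, Set.mem_ofPred_eq, Finset.mem_image]
  constructor
  · rintro h _ ⟨p, hp, rfl⟩
    exact h p hp
  · exact fun h p hp => h _ ⟨p, hp, rfl⟩

theorem Finset.exists_between_of_forall_le {α : Type*} [LinearOrder α] [Nonempty α]
    {s t : Finset α} (h : ∀ a ∈ s, ∀ b ∈ t, a ≤ b) :
    ∃ c, (∀ a ∈ s, a ≤ c) ∧ ∀ b ∈ t, c ≤ b := by
  rcases s.eq_empty_or_nonempty with rfl | hs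
  · rcases t.eq_empty_or_nonempty with rfl | ht
    · exact ⟨Classical.arbitrary α, by simp, by simp⟩
    · exact ⟨t.min' ht, by simp, fun b hb => t.min'_le b hb⟩
  · exact ⟨s.max' hs, fun a ha => s.le_max' a ha, fun b hb => h _ (s.max'_mem hs) b hb⟩

/-- Fourier–Motzkin elimination of one direction. -/
theorem IsPolyhedral.exists_add_smul {s : Set E} (hs : IsPolyhedral s) (v : E) :
    IsPolyhedral {x | ∃ t : ℝ, x + t • v ∈ s} := by
  classical
  obtain ⟨F, rfl⟩ := hs
  refine ⟨F.filter (fun p => p.1 v = 0) ∪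
    ((F.filter fun p => 0 < p.1 v) ×ˢ (F.filter fun p => p.1 v < 0)).image fun p =>
      ((p.1.1 v)⁻¹ • p.1.1 - (p.2.1 v)⁻¹ • p.2.1, (p.1.1 v)⁻¹ * p.1.2 - (p.2.1 v)⁻¹ * p.2.2), ?_⟩
  ext x
  have hpos : ∀ p : (E →L[ℝ] ℝ) × ℝ, 0 < p.1 v → ∀ t : ℝ,
      p.1 (x + t • v) ≤ p.2 ↔ t ≤ (p.1 v)⁻¹ * (p.2 - p.1 x) := fun p hp t => by
    rw [map_add, map_smul, smul_eq_mul, ← div_eq_inv_mul, le_div_iff₀ hp]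
    constructor <;> intro <;> linarith
  have hneg : ∀ p : (E →L[ℝ] ℝ) × ℝ, p.1 v < 0 → ∀ t : ℝ,
      p.1 (x + t • v) ≤ p.2 ↔ (p.1 v)⁻¹ * (p.2 - p.1 x) ≤ t := fun p hp t => by
    rw [map_add, map_smul, smul_eq_mul, ← div_eq_inv_mul, div_le_iff_of_neg hp]
    constructor <;> intro <;> linarith
  simp only [Set.mem_ofPred_eq, Finset.mem_union, Finset.mem_filter, Finset.mem_image,
    Finset.mem_product]
  constructor
  · rintro ⟨t, ht⟩ r (⟨hr, hr0⟩ | ⟨⟨p, q⟩, ⟨⟨hp, hp0⟩, hq, hq0⟩, rfl⟩)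
    · simpa [hr0] using ht r hr
    · have h1 := (hpos p hp0 t).1 (ht p hp)
      have h2 := (hneg q hq0 t).1 (ht q hq)
      simp only [sub_apply, smul_apply, smul_eq_mul]
      linarith
  · intro h
    obtain ⟨t, ht1, ht2⟩ := Finset.exists_between_of_forall_le
      (s := (F.filter fun p => p.1 v < 0).image fun p => (p.1 v)⁻¹ * (p.2 - p.1 x))
      (t := (F.filter fun p => 0 < p.1 v).image fun p => (p.1 v)⁻¹ * (p.2 - p.1 x)) (by
        simp only [Finset.mem_image, Finset.mem_filter]
        rintro _ ⟨q, ⟨hq, hq0⟩, rfl⟩ _ ⟨p, ⟨hp, hp0⟩, rfl⟩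
        have := h _ (Or.inr ⟨(p, q), ⟨⟨hp, hp0⟩, hq, hq0⟩, rfl⟩)
        simp only [sub_apply, smul_apply,
          smul_eq_mul] at this
        linarith)
    refine ⟨t, fun p hp => ?_⟩
    rcases lt_trichotomy (p.1 v) 0 with hp0 | hp0 | hp0
    · exact (hneg p hp0 t).2 (ht1 _ (Finset.mem_image_of_mem _ (by simp [hp, hp0])))
    · simpa [hp0] using h p (Or.inl ⟨hp, hp0⟩)
    · exact (hpos p hp0 t).2 (ht2 _ (Finset.mem_image_of_mem _ (by simp [hp, hp0])))

theorem IsPolyhedral.exists_add_mem {N : Submodule ℝ E} (hN : N.FG) :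
    ∀ {s : Set E}, IsPolyhedral s → IsPolyhedral {x | ∃ y ∈ N, x + y ∈ s} := by
  induction N, hN using Submodule.fg_induction with
  | singleton v =>
    intro s hs
    convert hs.exists_add_smul v using 1
    ext x
    simp [Submodule.mem_span_singleton]
  | sup N₁ N₂ _ _ ih₁ ih₂ =>
    intro s hs
    convert ih₁ (ih₂ hs) using 1
    ext x
    simp only [Set.mem_ofPred_eq, Submodule.mem_sup]
    constructor
    · rintro ⟨_, ⟨y, hy, z, hz, rfl⟩, h⟩
      exact ⟨y, hy, z, hz, by rwa [add_assoc]⟩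
    · rintro ⟨y, hy, z, hz, h⟩
      exact ⟨_, ⟨y, hy, z, hz, rfl⟩, by rwa [← add_assoc]⟩

variable [FiniteDimensional ℝ E]

theorem IsPolyhedral.add {s t : Set E} (hs : IsPolyhedral s) (ht : IsPolyhedral t) :
    IsPolyhedral (s + t) := by
  have hW := (hs.preimage (ContinuousLinearMap.fst ℝ E E - ContinuousLinearMap.snd ℝ E E)).inter
    (ht.preimage (ContinuousLinearMap.snd ℝ E E))
  have := (IsPolyhedral.exists_add_mem (IsNoetherian.noetherian
    (LinearMap.ker (LinearMap.fst ℝ E E))) hW).preimage (ContinuousLinearMap.inl ℝ E E)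
  convert this using 1
  ext x
  simp only [Set.mem_add, Set.mem_preimage, Set.mem_ofPred_eq, Set.mem_inter_iff]
  constructor
  · rintro ⟨a, ha, b, hb, rfl⟩
    exact ⟨(0, b), by simp, by simpa using ha, by simpa using hb⟩
  · rintro ⟨⟨y, z⟩, hy, h1, h2⟩
    have hy0 : y = 0 := by simpa using hy
    subst hy0
    exact ⟨x - z, by simpa using h1, z, by simpa using h2, by simp⟩

theorem exists_isPolyhedral_isCompact_superset {K : Set E} (hK : IsCompact K) :
    ∃ B : Set E, IsPolyhedral B ∧ IsCompact B ∧ K ⊆ B := by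
  let e := (Module.finBasis ℝ E).equivFunL
  let π (i : Fin (Module.finrank ℝ E)) : E →L[ℝ] ℝ :=
    (ContinuousLinearMap.proj (R := ℝ) (φ := fun _ => ℝ) i).comp e.toContinuousLinearMap
  have hπ : ∀ i x, π i x = e x i := fun i x => rfl
  obtain ⟨R, hR⟩ := (hK.image e.continuous).isBounded.subset_closedBall 0
  refine ⟨e ⁻¹' Metric.closedBall 0 |R|, ?_, ?_, fun x hx => ?_⟩
  · have : e ⁻¹' Metric.closedBall 0 |R| = ⋂ i ∈ Finset.univ,
        ({x | π i x ≤ |R|} ∩ {x | (-π i) x ≤ |R|}) := by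
      ext x
      simp [pi_norm_le_iff_of_nonneg, abs_le, neg_le, and_comm, hπ]
    rw [this]
    exact IsPolyhedral.biInter _ fun i _ =>
      (isPolyhedral_halfSpace _ _).inter (isPolyhedral_halfSpace _ _)
  · exact e.toHomeomorph.isCompact_preimage.2 (isCompact_closedBall _ _)
  · have := hR ⟨x, hx, rfl⟩
    exact Metric.closedBall_subset_closedBall (le_abs_self R) this

/-- A compact convex set is approximated from outside by polytopes. -/
theorem exists_isPolyhedral_between {K U : Set E} (hK : IsCompact K) (hKc : Convex ℝ K)
    (hU : IsOpen U) (hKU : K ⊆ U) :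
    ∃ Q : Set E, IsPolyhedral Q ∧ IsCompact Q ∧ K ⊆ Q ∧ Q ⊆ U := by
  obtain ⟨B, hBp, hBc, hKB⟩ := exists_isPolyhedral_isCompact_superset hK
  have hsep : ∀ x ∈ B \ U, ∃ f : E →L[ℝ] ℝ, ∃ c : ℝ, (∀ y ∈ K, f y ≤ c) ∧ c < f x := by
    intro x hx
    obtain ⟨f, c, h1, h2⟩ := geometric_hahn_banach_closed_point hKc hK.isClosed
      (fun h => hx.2 (hKU h))
    exact ⟨f, c, fun y hy => (h1 y hy).le, h2⟩
  choose! f c hfK hfx using hsep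
  obtain ⟨t, htB, ht⟩ := (hBc.diff hU).elim_nhds_subcover (fun x => {y | c x < f x y})
    fun x hx => (isOpen_lt continuous_const (f x).continuous).mem_nhds (hfx x hx)
  refine ⟨B ∩ ⋂ x ∈ t, {y | f x y ≤ c x},
    hBp.inter (IsPolyhedral.biInter t fun x _ => isPolyhedral_halfSpace _ _), ?_, ?_, ?_⟩
  · exact hBc.inter_right (isClosed_biInter fun x _ =>
      isClosed_le (f x).continuous continuous_const)
  · exact Set.subset_inter hKB (Set.subset_iInter₂ fun x hx y hy => hfK x (htB x hx) y hy)
  · rintro y ⟨hyB, hy⟩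
    by_contra hyU
    obtain ⟨x, hx, hxy⟩ := Set.mem_iUnion₂.1 (ht ⟨hyB, hyU⟩)
    have hle : f x y ≤ c x := Set.mem_iInter₂.1 hy x hx
    exact absurd hxy (not_lt.2 hle)

end Polyhedral

section TypeCone

variable {ι E : Type*} [NormedAddCommGroup E] [NormedSpace ℝ E] {u : ι → E →L[ℝ] ℝ}
  {h₀ h h' : ι → ℝ} [Fintype ι]

/-- The vectors of support numbers whose polyhedron has the same pattern of tight inequalities
as the polyhedron with support numbers `h₀`. -/
def typeCone (u : ι → E →L[ℝ] ℝ) (h₀ : ι → ℝ) : Set (ι → ℝ) :=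
  {h | ∀ b ∈ polyhedron u Finset.univ h₀, ∃ a ∈ polyhedron u Finset.univ h,
    ∀ k, u k a = h k ↔ u k b = h₀ k}

/-- The vectors of support numbers whose polyhedron has at least the tight inequalities
of the polyhedron with support numbers `h₀`. -/
def closedTypeCone (u : ι → E →L[ℝ] ℝ) (h₀ : ι → ℝ) : Set (ι → ℝ) :=
  {h | ∀ b ∈ polyhedron u Finset.univ h₀, ∃ a ∈ polyhedron u Finset.univ h,
    ∀ k, u k b = h₀ k → u k a = h k}

theorem typeCone_subset_closedTypeCone : typeCone u h₀ ⊆ closedTypeCone u h₀ := fun _ hh b hb =>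
  let ⟨a, ha, hab⟩ := hh b hb
  ⟨a, ha, fun k => (hab k).2⟩

theorem self_mem_typeCone : h₀ ∈ typeCone u h₀ := fun b hb => ⟨b, hb, fun _ => Iff.rfl⟩

theorem zero_mem_closedTypeCone : 0 ∈ closedTypeCone u h₀ := fun _ _ =>
  ⟨0, fun k _ => by simp, fun k _ => by simp⟩

theorem smul_mem_closedTypeCone {t : ℝ} (ht : 0 ≤ t) (hh : h ∈ closedTypeCone u h₀) :
    t • h ∈ closedTypeCone u h₀ := fun b hb => by
  obtain ⟨a, ha, hab⟩ := hh b hb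
  refine ⟨t • a, fun k hk => ?_, fun k hk => by simp [hab k hk]⟩
  simpa using mul_le_mul_of_nonneg_left (ha k hk) ht

theorem add_mem_closedTypeCone (hh : h ∈ closedTypeCone u h₀) (hh' : h' ∈ closedTypeCone u h₀) :
    h + h' ∈ closedTypeCone u h₀ := fun b hb => by
  obtain ⟨a, ha, hab⟩ := hh b hb
  obtain ⟨a', ha', hab'⟩ := hh' b hb
  refine ⟨a + a', fun k hk => ?_, fun k hk => by simp [hab k hk, hab' k hk]⟩
  simpa using add_le_add (ha k hk) (ha' k hk)

theorem smul_mem_typeCone {t : ℝ} (ht : 0 < t) (hh : h ∈ typeCone u h₀) :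
    t • h ∈ typeCone u h₀ := fun b hb => by
  obtain ⟨a, ha, hab⟩ := hh b hb
  refine ⟨t • a, fun k hk => ?_, fun k => by simp [ht.ne', hab k]⟩
  simpa using mul_le_mul_of_nonneg_left (ha k hk) ht.le

theorem add_mem_typeCone (hh : h ∈ typeCone u h₀) (hh' : h' ∈ closedTypeCone u h₀) :
    h + h' ∈ typeCone u h₀ := fun b hb => by
  obtain ⟨a, ha, hab⟩ := hh b hb
  obtain ⟨a', ha', hab'⟩ := hh' b hb
  refine ⟨a + a', fun k hk => ?_, fun k => ⟨fun hk => ?_, fun hk => ?_⟩⟩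
  · simpa using add_le_add (ha k hk) (ha' k hk)
  · simp only [map_add, Pi.add_apply] at hk
    exact (hab k).1 (le_antisymm (ha k (Finset.mem_univ k))
      (by linarith [ha' k (Finset.mem_univ k)]))
  · simp [(hab k).2 hk, hab' k hk]

theorem convex_typeCone (u : ι → E →L[ℝ] ℝ) (h₀ : ι → ℝ) : Convex ℝ (typeCone u h₀) := by
  intro h hh h' hh' a b ha hb hab
  rcases ha.eq_or_lt with rfl | ha
  · have : b = 1 := by linarith
    simpa [this] using hh'
  · exact add_mem_typeCone (smul_mem_typeCone ha hh)
      (smul_mem_closedTypeCone hb (typeCone_subset_closedTypeCone hh'))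

theorem IsSimplePolyhedron.exists_dual [DecidableEq ι]
    (hs : IsSimplePolyhedron u Finset.univ h₀) {b : E} (hb : b ∈ polyhedron u Finset.univ h₀) :
    ∃ y : ι → E, ∀ j k, u j b = h₀ j → u j (y k) = if j = k then 1 else 0 := by
  choose y hy using fun k => hs b hb fun j => if j = k then 1 else 0
  exact ⟨y, fun j k hj => hy k j (Finset.mem_univ j) hj⟩

theorem isOpen_typeCone (hs : IsSimplePolyhedron u Finset.univ h₀) :
    IsOpen (typeCone u h₀) := by
  classical
  have hT : typeCone u h₀ = ⋂ J : Set ι, {h | (∃ b ∈ polyhedron u Finset.univ h₀,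
      ∀ k, u k b = h₀ k ↔ k ∈ J) → ∃ a ∈ polyhedron u Finset.univ h,
        ∀ k, u k a = h k ↔ k ∈ J} := by
    ext h
    simp only [Set.mem_iInter, Set.mem_ofPred_eq]
    constructor
    · rintro hh J ⟨b, hb, hbJ⟩
      obtain ⟨a, ha, hab⟩ := hh b hb
      exact ⟨a, ha, fun k => (hab k).trans (hbJ k)⟩
    · exact fun hh b hb => hh {k | u k b = h₀ k} ⟨b, hb, fun k => Iff.rfl⟩
  rw [hT]
  refine isOpen_iInter_of_finite fun J => ?_
  by_cases hJ : ∃ b ∈ polyhedron u Finset.univ h₀, ∀ k, u k b = h₀ k ↔ k ∈ J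
  swap
  · simp only [hJ, false_imp_iff]
    exact isOpen_const
  simp only [hJ, true_imp_iff]
  obtain ⟨b, hb, hbJ⟩ := hJ
  obtain ⟨y, hy⟩ := hs.exists_dual hb
  rw [isOpen_iff_mem_nhds]
  rintro h ⟨a, ha, haJ⟩
  set R : (ι → ℝ) → E := fun g => a + ∑ k, (g k - h k) • y k with hR
  have hRh : R h = a := by simp [hR]
  have hev : ∀ᶠ g in nhds h, ∀ k, k ∉ J → u k (R g) < g k := by
    rw [Filter.eventually_all]
    intro k
    rw [Filter.eventually_imp_distrib_left]
    intro hk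
    have h1 : Continuous fun g : ι → ℝ => u k (R g) := by fun_prop
    refine (isOpen_lt h1 (continuous_apply k)).mem_nhds ?_
    rw [Set.mem_ofPred_eq, hRh]
    exact lt_of_le_of_ne (ha k (Finset.mem_univ k)) fun h => hk ((haJ k).1 h)
  filter_upwards [hev] with g hg
  have htight : ∀ k ∈ J, u k (R g) = g k := fun k hk => by
    have hbk := (hbJ k).2 hk
    simp [hR, hy k _ hbk, (haJ k).2 hk]
  refine ⟨R g, fun k _ => ?_, fun k => ⟨fun h => ?_, htight k⟩⟩
  · by_cases hk : k ∈ J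
    · exact (htight k hk).le
    · exact (hg k hk).le
  · by_contra hk
    exact (hg k hk).ne h

theorem exists_nonneg_eq_sum_of_isMaxOn (hs : IsSimplePolyhedron u Finset.univ h₀) {b : E}
    (hb : b ∈ polyhedron u Finset.univ h₀) {f : E →L[ℝ] ℝ}
    (hf : ∀ x ∈ polyhedron u Finset.univ h₀, f x ≤ f b) :
    ∃ l : ι → ℝ, (∀ k, 0 ≤ l k) ∧ (∀ k, u k b ≠ h₀ k → l k = 0) ∧
      ∀ x, f x = ∑ k, l k * u k x := by
  classical
  obtain ⟨y, hy⟩ := hs.exists_dual hb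
  have hdir : ∀ z, (∀ k, u k b = h₀ k → u k z ≤ 0) → f z ≤ 0 := fun z hz => by
    have hev : ∀ᶠ t in nhdsWithin (0 : ℝ) (Set.Ioi 0), ∀ k, u k (b + t • z) ≤ h₀ k := by
      rw [Filter.eventually_all]
      intro k
      rcases (hb k (Finset.mem_univ k)).lt_or_eq with hlt | heq
      · have hc : Continuous fun t : ℝ => u k (b + t • z) := by fun_prop
        have := hc.tendsto 0
        simp only [zero_smul, add_zero] at this
        exact ((this.mono_left nhdsWithin_le_nhds).eventually (gt_mem_nhds hlt)).mono
          fun _ h => h.le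
      · filter_upwards [self_mem_nhdsWithin] with t ht
        rw [map_add, map_smul, heq, smul_eq_mul]
        nlinarith [hz k heq, show (0 : ℝ) < t from ht]
    obtain ⟨t, ht, ht0⟩ := (hev.and self_mem_nhdsWithin).exists
    have h1 := hf _ fun k _ => ht k
    rw [map_add, map_smul, smul_eq_mul] at h1
    have ht0 : (0 : ℝ) < t := ht0
    nlinarith
  refine ⟨fun k => if u k b = h₀ k then f (y k) else 0, fun k => ?_, fun k hk => if_neg hk,
    fun x => ?_⟩
  · by_cases hk : u k b = h₀ k
    · simp only [hk, if_true]
      have := hdir (-y k) fun j hj => by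
        rw [map_neg, hy j k hj]
        split_ifs <;> simp
      simpa using this
    · simp [hk]
  · set z := x - ∑ k, (if u k b = h₀ k then u k x else 0) • y k with hz
    have hz0 : ∀ j, u j b = h₀ j → u j z = 0 := fun j hj => by
      rw [hz, map_sub, map_sum, sub_eq_zero]
      simp only [map_smul, smul_eq_mul, hy j _ hj, mul_ite, mul_one, mul_zero, Finset.sum_ite_eq,
        Finset.mem_univ, if_true, hj]
    have h1 := hdir z fun k hk => (hz0 k hk).le
    have h2 := hdir (-z) fun k hk => by simp [hz0 k hk]
    have h3 : f z = 0 := le_antisymm h1 (by simpa using h2)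
    rw [hz, map_sub, sub_eq_zero] at h3
    rw [h3, map_sum]
    refine Finset.sum_congr rfl fun k _ => ?_
    by_cases hk : u k b = h₀ k <;> simp [hk, mul_comm]

theorem exists_isSimplePolyhedron_of_isOpen (u : ι → E →L[ℝ] ℝ) {O : Set (ι → ℝ)} (hO : IsOpen O)
    (hOn : O.Nonempty) : ∃ h ∈ O, IsSimplePolyhedron u Finset.univ h := by
  classical
  let N (J : Finset ι) : Submodule ℝ (ι → ℝ) :=
    (LinearMap.range (LinearMap.pi fun k : J => (u k : E →ₗ[ℝ] ℝ))).comap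
      (LinearMap.funLeft ℝ ℝ (Subtype.val : J → ι))
  have hN : ∀ J h, h ∈ N J ↔ ∃ y, ∀ k ∈ J, u k y = h k := fun J h => by
    simp [N, funext_iff, LinearMap.funLeft_apply]
  have hnull : volume (⋃ J ∈ {J | N J ≠ ⊤}, (N J : Set (ι → ℝ))) = 0 := by
    rw [measure_biUnion_null_iff (Set.to_countable _)]
    exact fun J hJ => Measure.addHaar_submodule _ _ hJ
  obtain ⟨h, hhO, hh⟩ : ∃ h ∈ O, h ∉ ⋃ J ∈ {J | N J ≠ ⊤}, (N J : Set (ι → ℝ)) := by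
    by_contra! hall
    have : volume O = 0 := measure_mono_null hall hnull
    exact (hO.measure_pos volume hOn).ne' this
  refine ⟨h, hhO, fun x _ r => ?_⟩
  have hmem : h ∈ N (Finset.univ.filter fun k => u k x = h k) :=
    (hN _ _).2 ⟨x, fun k hk => (Finset.mem_filter.1 hk).2⟩
  have htop : N (Finset.univ.filter fun k => u k x = h k) = ⊤ := by
    by_contra hne
    exact hh (Set.mem_biUnion hne hmem)
  obtain ⟨y, hy⟩ := (hN _ r).1 (htop ▸ Submodule.mem_top)
  exact ⟨y, fun k hk hkx => hy k (by simpa using hkx)⟩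

variable [FiniteDimensional ℝ E]

theorem polyhedron_add_of_mem_closedTypeCone (hA : PositivelySpans u Finset.univ)
    (hs : IsSimplePolyhedron u Finset.univ h₀) (hne : (polyhedron u Finset.univ h₀).Nonempty)
    (hh : h ∈ closedTypeCone u h₀) (hh' : h' ∈ closedTypeCone u h₀) :
    polyhedron u Finset.univ (h + h') =
      polyhedron u Finset.univ h + polyhedron u Finset.univ h' := by
  refine Set.Subset.antisymm (fun x hx => ?_) ?_
  · by_contra hxn
    obtain ⟨f, c, hfc, hcx⟩ := geometric_hahn_banach_closed_point
      ((convex_polyhedron u Finset.univ h).add (convex_polyhedron u Finset.univ h'))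
      ((hA.isCompact_polyhedron h).add (hA.isCompact_polyhedron h')).isClosed hxn
    obtain ⟨b, hb, hbf⟩ := (hA.isCompact_polyhedron h₀).exists_isMaxOn hne f.continuous.continuousOn
    obtain ⟨l, hl, hl0, hlf⟩ := exists_nonneg_eq_sum_of_isMaxOn hs hb fun y hy => hbf hy
    obtain ⟨a, ha, hab⟩ := hh b hb
    obtain ⟨a', ha', hab'⟩ := hh' b hb
    have h1 := hfc _ (Set.add_mem_add ha ha')
    have h2 : f x ≤ f (a + a') := by
      rw [hlf, hlf]
      refine Finset.sum_le_sum fun k hk => ?_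
      by_cases hkb : u k b = h₀ k
      · rw [map_add, hab k hkb, hab' k hkb]
        exact mul_le_mul_of_nonneg_left (hx k hk) (hl k)
      · simp [hl0 k hkb]
    linarith
  · rintro _ ⟨a, ha, a', ha', rfl⟩ k hk
    simpa using add_le_add (ha k hk) (ha' k hk)

theorem isSimplePolyhedron_of_mem_typeCone (hA : PositivelySpans u Finset.univ)
    (hs : IsSimplePolyhedron u Finset.univ h₀) (hne : (polyhedron u Finset.univ h₀).Nonempty)
    (hh : h ∈ typeCone u h₀) : IsSimplePolyhedron u Finset.univ h := by
  intro x hx r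
  have hev : ∀ᶠ t in nhdsWithin (0 : ℝ) (Set.Ioi 0), h - t • h₀ ∈ typeCone u h₀ := by
    have hc : Continuous fun t : ℝ => h - t • h₀ := by fun_prop
    exact (hc.continuousAt.eventually_mem ((isOpen_typeCone hs).mem_nhds
      (by simpa using hh))).filter_mono nhdsWithin_le_nhds
  obtain ⟨t, ht, ht0⟩ := (hev.and self_mem_nhdsWithin).exists
  have ht0 : (0 : ℝ) < t := ht0
  have hx' := hx
  rw [← sub_add_cancel h (t • h₀), polyhedron_add_of_mem_closedTypeCone hA hs hne
    (typeCone_subset_closedTypeCone ht) (smul_mem_closedTypeCone ht0.le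
      (typeCone_subset_closedTypeCone self_mem_typeCone)), polyhedron_smul u _ h₀ ht0] at hx'
  obtain ⟨a, ha, _, ⟨b, hb, rfl⟩, rfl⟩ := hx'
  obtain ⟨y, hy⟩ := hs b hb r
  refine ⟨y, fun k hk hkx => hy k hk ?_⟩
  have h1 := ha k hk
  have h2 := hb k hk
  simp only [map_add, map_smul, smul_eq_mul, Pi.sub_apply, Pi.smul_apply] at hkx h1
  nlinarith

theorem polyhedron_sum_of_mem_closedTypeCone (hA : PositivelySpans u Finset.univ)
    (hs : IsSimplePolyhedron u Finset.univ h₀) (hne : (polyhedron u Finset.univ h₀).Nonempty)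
    {κ : Type*} {c : κ → ι → ℝ} (hc : ∀ j, c j ∈ closedTypeCone u h₀) (S : Finset κ) :
    ∑ j ∈ S, polyhedron u Finset.univ (c j) = polyhedron u Finset.univ (∑ j ∈ S, c j) ∧
      ∑ j ∈ S, c j ∈ closedTypeCone u h₀ := by
  classical
  induction S using Finset.induction_on with
  | empty =>
    refine ⟨?_, zero_mem_closedTypeCone⟩
    ext x
    simp only [Finset.sum_empty, Set.mem_zero]
    exact ⟨fun h k _ => by simp [h], fun h => hA x h⟩
  | insert a S ha ih =>
    rw [Finset.sum_insert ha, Finset.sum_insert ha, ih.1,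
      polyhedron_add_of_mem_closedTypeCone hA hs hne (hc a) ih.2]
    exact ⟨rfl, add_mem_closedTypeCone (hc a) ih.2⟩

end TypeCone

section Approximation

variable {E : Type*} [NormedAddCommGroup E] [NormedSpace ℝ E]

theorem polyhedron_eq_of_support {ι : Type*} [Fintype ι] {u : ι → E →L[ℝ] ℝ} {h : ι → ℝ}
    {F : Finset ((E →L[ℝ] ℝ) × ℝ)} (hF : ∀ p ∈ F, ∃ k, u k = p.1)
    (hle : ∀ k x, (∀ p ∈ F, p.1 x ≤ p.2) → u k x ≤ h k)
    (hex : ∀ k, ∃ x, (∀ p ∈ F, p.1 x ≤ p.2) ∧ u k x = h k) :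
    polyhedron u Finset.univ h = {x | ∀ p ∈ F, p.1 x ≤ p.2} := by
  refine Set.Subset.antisymm (fun x hx p hp => ?_) fun x hx k _ => hle k x hx
  obtain ⟨k, hk⟩ := hF p hp
  obtain ⟨y, hy, hyk⟩ := hex k
  rw [← hk]
  refine (hx k (Finset.mem_univ k)).trans ?_
  rw [← hyk, hk]
  exact hy p hp

theorem positivelySpans_of_isCompact {ι : Type*} [Fintype ι] {u : ι → E →L[ℝ] ℝ} {h : ι → ℝ}
    (hne : (polyhedron u Finset.univ h).Nonempty)
    (hc : IsCompact (polyhedron u Finset.univ h)) : PositivelySpans u Finset.univ := by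
  intro y hy
  by_contra hy0
  obtain ⟨a, ha⟩ := hne
  obtain ⟨C, hC⟩ := hc.isBounded.exists_norm_le
  have hpos : 0 < ‖y‖ := norm_pos_iff.2 hy0
  have hC0 : 0 ≤ C := (norm_nonneg a).trans (hC a ha)
  set t := (2 * C + 1) / ‖y‖ with ht
  have ht0 : 0 ≤ t := by positivity
  have h1 := hC (a + t • y) fun k hk => by
    rw [map_add, map_smul, smul_eq_mul]
    nlinarith [ha k hk, hy k hk]
  have h2 : ‖t • y‖ = 2 * C + 1 := by
    rw [norm_smul, Real.norm_of_nonneg ht0, ht]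
    field_simp
  have h3 : ‖t • y‖ ≤ ‖a + t • y‖ + ‖a‖ := by
    simpa using norm_sub_le (a + t • y) a
  linarith [hC a ha]

variable [FiniteDimensional ℝ E]

theorem exists_mem_closedTypeCone {ι : Type*} [Fintype ι] {u : ι → E →L[ℝ] ℝ} {h h' : ι → ℝ}
    (hA : PositivelySpans u Finset.univ) (hne : (polyhedron u Finset.univ h).Nonempty)
    (hne' : (polyhedron u Finset.univ h').Nonempty)
    (hadd : polyhedron u Finset.univ (h + h') ⊆
      polyhedron u Finset.univ h + polyhedron u Finset.univ h') :
    ∃ h₀, IsSimplePolyhedron u Finset.univ h₀ ∧ (polyhedron u Finset.univ h₀).Nonempty ∧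
      h ∈ closedTypeCone u h₀ ∧ h' ∈ closedTypeCone u h₀ := by
  set good : Set (Set ι) := {J | ∃ a ∈ polyhedron u Finset.univ h,
    ∃ a' ∈ polyhedron u Finset.univ h', ∀ k ∈ J, u k a = h k ∧ u k a' = h' k} with hgood
  set Z : Set (ι → ℝ) :=
    ⋃ J ∈ goodᶜ, {g | ∃ x ∈ polyhedron u Finset.univ g, ∀ k ∈ J, u k x = g k} with hZ
  have hZc : IsClosed Z :=
    (Set.toFinite goodᶜ).isClosed_biUnion fun J _ => hA.isClosed_exists_tight J
  have hhZ : h + h' ∈ Zᶜ := by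
    intro hmem
    simp only [hZ, Set.mem_iUnion] at hmem
    obtain ⟨J, hJ, x, hx, hxJ⟩ := hmem
    obtain ⟨a, ha, a', ha', rfl⟩ := hadd hx
    refine hJ ⟨a, ha, a', ha', fun k hk => ?_⟩
    have h1 := hxJ k hk
    have h2 := ha k (Finset.mem_univ k)
    have h3 := ha' k (Finset.mem_univ k)
    simp only [map_add, Pi.add_apply] at h1
    constructor <;> linarith
  have hOo : IsOpen (Zᶜ ∩ {g | ∃ x, ∀ k ∈ Finset.univ, u k x < g k}) :=
    hZc.isOpen_compl.inter (isOpen_exists_lt u Finset.univ)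
  have hOn : (Zᶜ ∩ {g | ∃ x, ∀ k ∈ Finset.univ, u k x < g k}).Nonempty := by
    have hc : Continuous fun t : ℝ => h + h' + t • (1 : ι → ℝ) := by fun_prop
    have h1 := hc.tendsto 0
    simp only [zero_smul, add_zero] at h1
    obtain ⟨t, ht, ht0⟩ := (((h1.mono_left nhdsWithin_le_nhds).eventually
      (hZc.isOpen_compl.mem_nhds hhZ)).and
        (self_mem_nhdsWithin (s := Set.Ioi (0 : ℝ)))).exists
    obtain ⟨a, ha⟩ := hne
    obtain ⟨a', ha'⟩ := hne'
    refine ⟨_, ht, a + a', fun k hk => ?_⟩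
    have ht0 : (0 : ℝ) < t := ht0
    simp only [map_add, Pi.add_apply, Pi.smul_apply, Pi.one_apply, smul_eq_mul, mul_one]
    linarith [ha k hk, ha' k hk]
  obtain ⟨h₀, ⟨h₀Z, x, hx⟩, hs⟩ := exists_isSimplePolyhedron_of_isOpen u hOo hOn
  have key : ∀ b ∈ polyhedron u Finset.univ h₀, {k | u k b = h₀ k} ∈ good := fun b hb => by
    by_contra hbad
    exact h₀Z (Set.mem_biUnion hbad ⟨b, hb, fun k hk => hk⟩)
  refine ⟨h₀, hs, ⟨x, fun k hk => (hx k hk).le⟩, fun b hb => ?_, fun b hb => ?_⟩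
  · obtain ⟨a, ha, a', ha', haa⟩ := key b hb
    exact ⟨a, ha, fun k hk => (haa k hk).1⟩
  · obtain ⟨a, ha, a', ha', haa⟩ := key b hb
    exact ⟨a', ha', fun k hk => (haa k hk).2⟩

theorem exists_strongly_isomorphic_between {K L Q R : Set E} (hQ : IsPolyhedral Q)
    (hR : IsPolyhedral R) (hQc : IsCompact Q) (hRc : IsCompact R) (hQn : Q.Nonempty)
    (hRn : R.Nonempty) {ρ : ℝ} (hρ : 0 < ρ) (hKQ : Metric.cthickening ρ K ⊆ Q)
    (hLR : Metric.cthickening ρ L ⊆ R) :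
    ∃ s : Finset (E →L[ℝ] ℝ), ∃ h₀ c c' : s → ℝ,
      PositivelySpans (fun k : s => (k : E →L[ℝ] ℝ)) Finset.univ ∧
      IsSimplePolyhedron (fun k : s => (k : E →L[ℝ] ℝ)) Finset.univ h₀ ∧
      (polyhedron (fun k : s => (k : E →L[ℝ] ℝ)) Finset.univ h₀).Nonempty ∧
      c ∈ typeCone (fun k : s => (k : E →L[ℝ] ℝ)) h₀ ∧
      c' ∈ typeCone (fun k : s => (k : E →L[ℝ] ℝ)) h₀ ∧
      K ⊆ polyhedron (fun k : s => (k : E →L[ℝ] ℝ)) Finset.univ c ∧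
      polyhedron (fun k : s => (k : E →L[ℝ] ℝ)) Finset.univ c ⊆ Metric.cthickening ρ Q ∧
      L ⊆ polyhedron (fun k : s => (k : E →L[ℝ] ℝ)) Finset.univ c' ∧
      polyhedron (fun k : s => (k : E →L[ℝ] ℝ)) Finset.univ c' ⊆ Metric.cthickening ρ R := by
  classical
  obtain ⟨F, hF⟩ := hQ
  obtain ⟨G, hG⟩ := hR
  obtain ⟨H, hH⟩ := IsPolyhedral.add ⟨F, hF⟩ ⟨G, hG⟩
  set s : Finset (E →L[ℝ] ℝ) := F.image Prod.fst ∪ G.image Prod.fst ∪ H.image Prod.fst with hs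
  set u : s → E →L[ℝ] ℝ := fun k => k with hu
  choose a haQ ha using fun k : s => hQc.exists_isMaxOn hQn (u k).continuous.continuousOn
  choose b hbR hb using fun k : s => hRc.exists_isMaxOn hRn (u k).continuous.continuousOn
  set h : s → ℝ := fun k => u k (a k) with hh
  set h' : s → ℝ := fun k => u k (b k) with hh'
  have hPQ : polyhedron u Finset.univ h = Q := by
    rw [polyhedron_eq_of_support (F := F), ← hF]
    · exact fun p hp => ⟨⟨p.1, by
        simp only [hs, Finset.mem_union]
        exact Or.inl (Or.inl (Finset.mem_image_of_mem _ hp))⟩, rfl⟩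
    · exact fun k x hx => ha k (hF.symm.subset hx)
    · exact fun k => ⟨a k, hF.subset (haQ k), rfl⟩
  have hPR : polyhedron u Finset.univ h' = R := by
    rw [polyhedron_eq_of_support (F := G), ← hG]
    · exact fun p hp => ⟨⟨p.1, by
        simp only [hs, Finset.mem_union]
        exact Or.inl (Or.inr (Finset.mem_image_of_mem _ hp))⟩, rfl⟩
    · exact fun k x hx => hb k (hG.symm.subset hx)
    · exact fun k => ⟨b k, hG.subset (hbR k), rfl⟩
  have hPQR : polyhedron u Finset.univ (h + h') = Q + R := by
    rw [polyhedron_eq_of_support (F := H), ← hH]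
    · exact fun p hp => ⟨⟨p.1, by
        simp only [hs, Finset.mem_union]
        exact Or.inr (Finset.mem_image_of_mem _ hp)⟩, rfl⟩
    · intro k x hx
      obtain ⟨y, hy, z, hz, rfl⟩ := hH.symm.subset hx
      rw [map_add]
      exact add_le_add (ha k hy) (hb k hz)
    · exact fun k => ⟨a k + b k, hH.subset (Set.add_mem_add (haQ k) (hbR k)), map_add _ _ _⟩
  have hA : PositivelySpans u Finset.univ :=
    positivelySpans_of_isCompact (h := h) (hPQ ▸ hQn) (hPQ ▸ hQc)
  obtain ⟨h₀, hsimp, hne, hc, hc'⟩ := exists_mem_closedTypeCone hA (h := h) (h' := h')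
    (hPQ ▸ hQn) (hPR ▸ hRn) (by rw [hPQR, hPQ, hPR])
  obtain ⟨C, hC0, hC⟩ := (hA.isCompact_polyhedron h₀).isBounded.exists_pos_norm_le
  set η := ρ / C with hη
  have hη0 : 0 < η := by positivity
  have hηb : ∀ b ∈ polyhedron u Finset.univ h₀, ‖η • b‖ ≤ ρ := fun b hb => by
    rw [norm_smul, Real.norm_of_nonneg hη0.le]
    calc η * ‖b‖ ≤ η * C := by gcongr; exact hC b hb
      _ = ρ := by rw [hη]; field_simp
  have hh₀ : η • h₀ ∈ typeCone u h₀ := smul_mem_typeCone hη0 self_mem_typeCone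
  have main : ∀ (g : s → ℝ) (M N : Set E), g ∈ closedTypeCone u h₀ →
      polyhedron u Finset.univ g = N → Metric.cthickening ρ M ⊆ N →
      η • h₀ + g ∈ typeCone u h₀ ∧ M ⊆ polyhedron u Finset.univ (η • h₀ + g) ∧
        polyhedron u Finset.univ (η • h₀ + g) ⊆ Metric.cthickening ρ N := by
    intro g M N hg hgN hMN
    have hP : polyhedron u Finset.univ (η • h₀ + g) = η • polyhedron u Finset.univ h₀ + N := by
      rw [polyhedron_add_of_mem_closedTypeCone hA hsimp hne
        (typeCone_subset_closedTypeCone hh₀) hg, hgN, polyhedron_smul u _ h₀ hη0]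
    refine ⟨add_mem_typeCone hh₀ hg, ?_, ?_⟩
    · intro x hx
      obtain ⟨b, hb⟩ := hne
      rw [hP]
      refine ⟨η • b, Set.smul_mem_smul_set hb, x - η • b, hMN ?_, by simp⟩
      refine Metric.mem_cthickening_of_dist_le _ x _ _ hx ?_
      rw [dist_eq_norm, sub_sub_cancel_left, norm_neg]
      exact hηb b hb
    · rw [hP]
      rintro _ ⟨_, ⟨b, hb, rfl⟩, y, hy, rfl⟩
      refine Metric.mem_cthickening_of_dist_le _ y _ _ hy ?_
      simpa [dist_eq_norm] using hηb b hb
  obtain ⟨m1, m2, m3⟩ := main h K Q hc hPQ hKQ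
  obtain ⟨n1, n2, n3⟩ := main h' L R hc' hPR hLR
  exact ⟨s, h₀, _, _, hA, hsimp, hne, m1, n1, m2, m3, n2, n3⟩

end Approximation

namespace MvPolynomial

variable {ι : Type*}

theorem iterDirDeriv_perm {L L' : List (ι → ℝ)} (h : L.Perm L') (f : MvPolynomial ι ℝ) :
    iterDirDeriv L f = iterDirDeriv L' f := by
  induction h with
  | nil => rfl
  | cons c _ ih => rw [iterDirDeriv_cons, iterDirDeriv_cons, ih]
  | swap c c' L => simp only [iterDirDeriv_cons, dirDeriv_comm]
  | trans _ _ ih ih' => exact ih.trans ih'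

theorem IsHomogeneous.iterDirDeriv [Fintype ι] {f : MvPolynomial ι ℝ} (L : List (ι → ℝ))
    (hf : f.IsHomogeneous L.length) : iterDirDeriv L f = C (constantCoeff (iterDirDeriv L f)) := by
  induction L generalizing f with
  | nil =>
    have h := totalDegree_eq_zero_iff_eq_C.1 (Nat.le_zero.1 hf.totalDegree_le)
    exact h
  | cons c L ih =>
    rw [iterDirDeriv_cons, dirDeriv_iterDirDeriv]
    exact ih (hf.dirDeriv c)

theorem sum_powerset_eval_of_iterDirDeriv {κ : Type*} [DecidableEq κ] (c : κ → ι → ℝ)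
    {L : List κ} (hL : L.Nodup) {f : MvPolynomial ι ℝ} {r : ℝ}
    (hf : iterDirDeriv (L.map c) f = C r) (x : ι → ℝ) :
    ∑ S ∈ L.toFinset.powerset, (-1 : ℝ) ^ (L.length - S.card) * eval (x + ∑ j ∈ S, c j) f = r := by
  induction L generalizing f r x with
  | nil =>
    rw [List.map_nil, iterDirDeriv_nil] at hf
    simp [hf]
  | cons a L ih =>
    rw [List.nodup_cons] at hL
    have ha : a ∉ L.toFinset := by simpa using hL.1
    set D : (ι → ℝ) → ℝ := fun y =>
      ∑ S ∈ L.toFinset.powerset, (-1 : ℝ) ^ (L.length - S.card) * eval (y + ∑ j ∈ S, c j) f with hD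
    have hder : ∀ t : ℝ, HasDerivAt (fun t : ℝ => D (x + t • c a) - t * r) 0 t := fun t => by
      have h1 : HasDerivAt (fun t : ℝ => D (x + t • c a)) r t := by
        rw [List.map_cons, iterDirDeriv_cons, dirDeriv_iterDirDeriv] at hf
        rw [← ih hL.2 hf (x + t • c a)]
        refine HasDerivAt.fun_sum fun S _ => HasDerivAt.const_mul _ ?_
        simpa only [add_right_comm] using
          hasDerivAt_eval_add_smul f (x + ∑ j ∈ S, c j) (c a) t
      exact (h1.fun_sub ((hasDerivAt_id t).mul_const r)).congr_deriv (by simp)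
    have h01 := is_const_of_deriv_eq_zero (fun t => (hder t).differentiableAt)
      (fun t => (hder t).deriv) 1 0
    simp only [one_smul, one_mul, zero_smul, add_zero, zero_mul, sub_zero] at h01
    rw [List.toFinset_cons, Finset.sum_powerset_insert ha]
    have h2 : ∑ S ∈ L.toFinset.powerset,
        (-1 : ℝ) ^ ((a :: L).length - S.card) * eval (x + ∑ j ∈ S, c j) f = -D x := by
      rw [hD, ← Finset.sum_neg_distrib]
      refine Finset.sum_congr rfl fun S hS => ?_
      have hle : S.card ≤ L.length :=
        (Finset.card_le_card (Finset.mem_powerset.1 hS)).trans L.toFinset_card_le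
      rw [List.length_cons, Nat.succ_sub hle, pow_succ]
      ring
    have h3 : ∑ S ∈ L.toFinset.powerset, (-1 : ℝ) ^ ((a :: L).length - (insert a S).card) *
        eval (x + ∑ j ∈ insert a S, c j) f = D (x + c a) := by
      refine Finset.sum_congr rfl fun S hS => ?_
      have haS : a ∉ S := fun h => ha (Finset.mem_powerset.1 hS h)
      rw [Finset.card_insert_of_notMem haS, List.length_cons, Nat.add_sub_add_right,
        Finset.sum_insert haS, add_assoc]
    rw [h2, h3]
    linarith

end MvPolynomial

theorem List.map_finRange_ite {α : Type*} (c c' : α) (i k : ℕ) :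
    (List.finRange (i + k)).map (fun j : Fin (i + k) => if (j : ℕ) < i then c else c') =
      List.replicate i c ++ List.replicate k c' := by
  refine List.ext_getElem (by simp) fun n h1 h2 => ?_
  simp [List.getElem_append]

theorem mixedVolume_polyhedron_eq {d : ℕ} (hd : 0 < d) {ι : Type*} [Fintype ι]
    {u : ι → EuclideanSpace ℝ (Fin d) →L[ℝ] ℝ} {h₀ : ι → ℝ} (hA : PositivelySpans u Finset.univ)
    (hs : IsSimplePolyhedron u Finset.univ h₀) (hne : (polyhedron u Finset.univ h₀).Nonempty)
    {f : MvPolynomial ι ℝ} (hf : f.IsHomogeneous d)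
    (hfv : ∀ h ∈ typeCone u h₀, MvPolynomial.eval h f = volume.real (polyhedron u Finset.univ h))
    {c : Fin d → ι → ℝ} (hc : ∀ j, c j ∈ typeCone u h₀) :
    mixedVolume (fun j => polyhedron u Finset.univ (c j)) =
      MvPolynomial.constantCoeff (MvPolynomial.iterDirDeriv ((List.finRange d).map c) f) := by
  have hf' : f.IsHomogeneous ((List.finRange d).map c).length := by simpa using hf
  rw [← MvPolynomial.sum_powerset_eval_of_iterDirDeriv c (List.nodup_finRange d)
    hf'.iterDirDeriv 0, List.toFinset_finRange, Finset.powerset_univ, mixedVolume]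
  refine Finset.sum_congr rfl fun S _ => ?_
  have hc' := fun j => typeCone_subset_closedTypeCone (hc j)
  rw [List.length_finRange, zero_add]
  congr 1
  rcases S.eq_empty_or_nonempty with rfl | ⟨j, hj⟩
  · have : Nonempty (Fin d) := ⟨⟨0, hd⟩⟩
    have h0 : MvPolynomial.eval 0 f = 0 := by
      rw [MvPolynomial.eval_zero, MvPolynomial.constantCoeff_eq]
      exact hf.coeff_eq_zero (by simpa using hd.ne)
    rw [Finset.sum_empty, Finset.sum_empty, h0, ← Set.singleton_zero, measure_singleton]
    simp
  · rw [(polyhedron_sum_of_mem_closedTypeCone hA hs hne hc' S).1, hfv _ ?_]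
    · rfl
    · rw [← Finset.add_sum_erase S c hj]
      exact add_mem_typeCone (hc j) (polyhedron_sum_of_mem_closedTypeCone hA hs hne hc' _).2

theorem mixedVolume_log_concave_of_mem_typeCone {m k : ℕ} {ι : Type*} [Fintype ι]
    {u : ι → EuclideanSpace ℝ (Fin (m + 1 + (k + 1))) →L[ℝ] ℝ} {h₀ : ι → ℝ}
    (hA : PositivelySpans u Finset.univ)
    (hs : IsSimplePolyhedron u Finset.univ h₀) (hne : (polyhedron u Finset.univ h₀).Nonempty)
    {c c' : ι → ℝ} (hc : c ∈ typeCone u h₀) (hc' : c' ∈ typeCone u h₀) :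
    mixedVolume (fun j : Fin (m + 1 + (k + 1)) => if (j : ℕ) < m then
        polyhedron u Finset.univ c else polyhedron u Finset.univ c') *
      mixedVolume (fun j : Fin (m + 1 + (k + 1)) => if (j : ℕ) < m + 2 then
        polyhedron u Finset.univ c else polyhedron u Finset.univ c') ≤
      mixedVolume (fun j : Fin (m + 1 + (k + 1)) => if (j : ℕ) < m + 1 then
        polyhedron u Finset.univ c else polyhedron u Finset.univ c') ^ 2 := by
  classical
  obtain ⟨f, hf, hfv, -, hher⟩ := exists_volume_polynomial (m + 1 + (k + 1))
    (volume : Measure (EuclideanSpace ℝ (Fin (m + 1 + (k + 1))))) u Finset.univ (typeCone u h₀)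
    (isOpen_typeCone hs) (convex_typeCone u h₀) ⟨_, hc⟩
    (fun h hh => isSimplePolyhedron_of_mem_typeCone hA hs hne hh) hA (by simp)
  have key : ∀ i l : ℕ, i + l = m + 1 + (k + 1) →
      mixedVolume (fun j : Fin (m + 1 + (k + 1)) => if (j : ℕ) < i then
        polyhedron u Finset.univ c else polyhedron u Finset.univ c') =
      MvPolynomial.constantCoeff (MvPolynomial.iterDirDeriv
        (List.replicate i c ++ List.replicate l c') f) := fun i l hil => by
    have h1 := mixedVolume_polyhedron_eq (by omega) hA hs hne hf hfv
      (c := fun j => if (j : ℕ) < i then c else c') fun j => by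
        split_ifs <;> assumption
    rw [← List.map_finRange_ite, hil, ← h1]
    congr 1
    ext1 j
    split_ifs <;> rfl
  set L := List.replicate m c ++ List.replicate k c' with hL
  have hlor := MvPolynomial.Hereditary.lorentz ⟨_, hc⟩ (n := m + k) (L := L) (f := f)
    (S := Finset.univᶜ) (by convert hher using 1; omega) (by simp [hL]) (by
      intro g hg
      rw [hL, List.mem_append] at hg
      rcases hg with hg | hg <;> rw [List.eq_of_mem_replicate hg] <;> assumption) c' hc
  have e0 : (List.replicate m c ++ List.replicate (k + 2) c').Perm (c' :: c' :: L) := by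
    rw [List.replicate_succ, List.replicate_succ]
    exact List.perm_middle.trans (List.perm_middle.cons _)
  have e1 : (List.replicate (m + 1) c ++ List.replicate (k + 1) c').Perm (c' :: c :: L) := by
    rw [List.replicate_succ (n := k)]
    exact List.perm_middle
  rw [key m (k + 2) (by omega), key (m + 2) k (by omega), key (m + 1) (k + 1) (by omega),
    MvPolynomial.iterDirDeriv_perm e0, MvPolynomial.iterDirDeriv_perm e1]
  exact hlor

open Filter Topology in
theorem tendsto_mixedVolume {d : ℕ} {P : Fin d → Set (EuclideanSpace ℝ (Fin d))}
    (hP : ∀ j, IsCompact (P j)) {Q : ℕ → Fin d → Set (EuclideanSpace ℝ (Fin d))} {ε : ℕ → ℝ}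
    (hε : ∀ n, 0 ≤ ε n) (hε0 : Tendsto ε atTop (𝓝 0)) (hPQ : ∀ n j, P j ⊆ Q n j)
    (hQP : ∀ n j, Q n j ⊆ Metric.cthickening (ε n) (P j)) :
    Tendsto (fun n => mixedVolume (Q n)) atTop (𝓝 (mixedVolume P)) := by
  classical
  refine tendsto_finsetSum _ fun S _ => Tendsto.const_mul _ ?_
  have hc : ∀ S : Finset (Fin d), IsCompact (∑ j ∈ S, P j) := fun S => by
    induction S using Finset.induction_on with
    | empty => simp
    | insert a S ha ih => rw [Finset.sum_insert ha]; exact (hP a).add ih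
  have hsub : ∀ n, ∑ j ∈ S, Q n j ⊆ Metric.cthickening (S.card * ε n) (∑ j ∈ S, P j) := fun n => by
    rw [← (hc S).add_closedBall_zero (mul_nonneg (Nat.cast_nonneg _) (hε n))]
    induction S using Finset.induction_on with
    | empty => simp
    | insert a S ha ih =>
      rw [Finset.sum_insert ha, Finset.sum_insert ha, Finset.card_insert_of_notMem ha]
      refine (Set.add_subset_add (hQP n a) (ih (Finset.mem_univ S))).trans ?_
      rw [← (hP a).add_closedBall_zero (hε n), add_add_add_comm,
        closedBall_add_closedBall (hε n) (mul_nonneg (Nat.cast_nonneg _) (hε n))]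
      refine Set.add_subset_add_left ?_
      rw [zero_add]
      refine Metric.closedBall_subset_closedBall ?_
      push_cast
      linarith
  refine (ENNReal.tendsto_toReal (hc S).measure_lt_top.ne).comp ?_
  have hr : Tendsto (fun n => (S.card : ℝ) * ε n) atTop (𝓝 0) := by
    simpa using hε0.const_mul (S.card : ℝ)
  exact tendsto_of_tendsto_of_tendsto_of_le_of_le tendsto_const_nhds
    ((tendsto_measure_cthickening_of_isCompact (hc S)).comp hr)
    (fun n => measure_mono (Set.finsetSum_subset_finsetSum _ _ _ fun j _ => hPQ n j))
    fun n => measure_mono (hsub n)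

theorem exists_strongly_isomorphic_approximation {E : Type*} [NormedAddCommGroup E]
    [NormedSpace ℝ E] [FiniteDimensional ℝ E] {K L : Set E} (hKn : K.Nonempty)
    (hK : IsCompact K) (hKc : Convex ℝ K) (hLn : L.Nonempty) (hL : IsCompact L)
    (hLc : Convex ℝ L) {ε : ℝ} (hε : 0 < ε) :
    ∃ s : Finset (E →L[ℝ] ℝ), ∃ h₀ c c' : s → ℝ,
      PositivelySpans (fun k : s => (k : E →L[ℝ] ℝ)) Finset.univ ∧
      IsSimplePolyhedron (fun k : s => (k : E →L[ℝ] ℝ)) Finset.univ h₀ ∧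
      (polyhedron (fun k : s => (k : E →L[ℝ] ℝ)) Finset.univ h₀).Nonempty ∧
      c ∈ typeCone (fun k : s => (k : E →L[ℝ] ℝ)) h₀ ∧
      c' ∈ typeCone (fun k : s => (k : E →L[ℝ] ℝ)) h₀ ∧
      K ⊆ polyhedron (fun k : s => (k : E →L[ℝ] ℝ)) Finset.univ c ∧
      polyhedron (fun k : s => (k : E →L[ℝ] ℝ)) Finset.univ c ⊆ Metric.cthickening ε K ∧
      L ⊆ polyhedron (fun k : s => (k : E →L[ℝ] ℝ)) Finset.univ c' ∧
      polyhedron (fun k : s => (k : E →L[ℝ] ℝ)) Finset.univ c' ⊆ Metric.cthickening ε L := by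
  have : ProperSpace E := FiniteDimensional.proper ℝ E
  have main : ∀ M : Set E, M.Nonempty → IsCompact M → Convex ℝ M →
      ∃ Q, IsPolyhedral Q ∧ IsCompact Q ∧ Q.Nonempty ∧ Metric.cthickening (ε / 3) M ⊆ Q ∧
        Metric.cthickening (ε / 3) Q ⊆ Metric.cthickening ε M := by
    intro M hMn hM hMc
    obtain ⟨Q, hQ, hQc, hMQ, hQM⟩ := exists_isPolyhedral_between (hM.cthickening (r := ε / 3))
      (hMc.cthickening _) Metric.isOpen_thickening
      (Metric.cthickening_subset_thickening' (by positivity) (by linarith : ε / 3 < 2 * ε / 3) M)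
    refine ⟨Q, hQ, hQc, hMn.mono ((Metric.self_subset_cthickening M).trans hMQ), hMQ, ?_⟩
    refine (Metric.cthickening_subset_of_subset _
      (hQM.trans (Metric.thickening_subset_cthickening _ _))).trans ?_
    refine (Metric.cthickening_cthickening_subset (by positivity) (by positivity) M).trans ?_
    exact Metric.cthickening_mono (by linarith) M
  obtain ⟨Q, hQ, hQc, hQn, hKQ, hQK⟩ := main K hKn hK hKc
  obtain ⟨R, hR, hRc, hRn, hLR, hRL⟩ := main L hLn hL hLc
  obtain ⟨s, h₀, c, c', h1, h2, h3, h4, h5, h6, h7, h8, h9⟩ :=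
    exists_strongly_isomorphic_between hQ hR hQc hRc hQn hRn (by positivity) hKQ hLR
  exact ⟨s, h₀, c, c', h1, h2, h3, h4, h5, h6, h7.trans hQK, h8, h9.trans hRL⟩

/-- for convex bodies `P₁, P₂` in `ℝ^d`, the sequence
`V_i = V(P₁, …, P₁, P₂, …, P₂)` (with `P₁` repeated `i` times and `P₂` repeated `d − i` times)
is log-concave: `V_i^2 ≥ V_{i−1} ⬝ V_{i+1}` for `1 ≤ i ≤ d − 1`. -/
theorem mixedVolume_log_concave (d : ℕ) (P₁ P₂ : Set (EuclideanSpace ℝ (Fin d)))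
    (h₁ne : P₁.Nonempty) (h₁cpt : IsCompact P₁) (h₁conv : Convex ℝ P₁)
    (h₂ne : P₂.Nonempty) (h₂cpt : IsCompact P₂) (h₂conv : Convex ℝ P₂)
    (V : ℕ → ℝ)
    (hV : ∀ i, V i = mixedVolume (fun j : Fin d => if (j : ℕ) < i then P₁ else P₂)) :
    ∀ i, 1 ≤ i → i + 1 ≤ d → V (i - 1) * V (i + 1) ≤ V i ^ 2 := by
  intro i hi hid
  obtain ⟨m, rfl⟩ : ∃ m, i = m + 1 := ⟨i - 1, by omega⟩
  obtain ⟨k, rfl⟩ : ∃ k, d = m + 1 + (k + 1) := ⟨d - (m + 2), by omega⟩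
  choose s h₀ c c' hA hs hne hc hc' h1 h2 h3 h4 using fun n : ℕ =>
    exists_strongly_isomorphic_approximation h₁ne h₁cpt h₁conv h₂ne h₂cpt h₂conv
      (Nat.one_div_pos_of_nat (α := ℝ) (n := n))
  have hlim : ∀ i, Filter.Tendsto (fun n => mixedVolume
      (fun j : Fin (m + 1 + (k + 1)) => if (j : ℕ) < i then
        polyhedron (fun l : s n => (l : EuclideanSpace ℝ (Fin (m + 1 + (k + 1))) →L[ℝ] ℝ))
          Finset.univ (c n)
        else polyhedron (fun l : s n => (l : EuclideanSpace ℝ (Fin (m + 1 + (k + 1))) →L[ℝ] ℝ))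
          Finset.univ (c' n))) Filter.atTop (nhds (V i)) := fun i => by
    rw [hV]
    refine tendsto_mixedVolume (fun j => ?_) (fun n => Nat.one_div_pos_of_nat.le)
      tendsto_one_div_add_atTop_nhds_zero_nat (fun n j => ?_) fun n j => ?_
    · split_ifs <;> assumption
    · split_ifs
      exacts [h1 n, h3 n]
    · split_ifs
      exacts [h2 n, h4 n]
  exact le_of_tendsto_of_tendsto' ((hlim m).mul (hlim (m + 2))) ((hlim (m + 1)).pow 2) fun n =>
    mixedVolume_log_concave_of_mem_typeCone (hA n) (hs n) (hne n) (hc n) (hc' n)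
end

section
/- Let n be a natural number and let E be a finite set of real numbers of cardinality 2n+1. Then for every real number k, f(E, k) ≤ f({−n, −n+1, …, n−1, n}, 0), i.e., the number of subsets of E whose elements sum to k is at most the number of subsets of {−n, …, n} ∩ ℤ whose elements sum to 0. -/
/-- `f(E, k)`: the number of subsets of the finite set `E ⊆ ℝ` whose elements sum to `k`. -/
noncomputable def numSubsetsWithSum (E : Finset ℝ) (k : ℝ) : ℕ :=
  Set.ncard {S : Finset ℝ | S ⊆ E ∧ ∑ x ∈ S, x = k}

namespace ErdosMoser

open Finset

/-! ### Chains through the middle rank -/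

section Chains

variable {P : Type*} {r : P → ℤ} {w : P → ℝ} {φ : P → P}

theorem weight_iterate (hup : ∀ x, r x < 0 → r (φ x) = r x + 1 ∧ w x < w (φ x)) (m : ℕ) :
    ∀ x, r x ≤ -m → r (φ^[m] x) = r x + m ∧ w x ≤ w (φ^[m] x) ∧ (m ≠ 0 → w x < w (φ^[m] x)) := by
  induction m with
  | zero => intro x _; simp
  | succ m ih =>
    intro x hx
    push_cast at hx
    obtain ⟨h1, h2⟩ := hup x (by lia)
    obtain ⟨h3, h4, -⟩ := ih (φ x) (by lia)
    rw [Function.iterate_succ_apply]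
    refine ⟨by push_cast; lia, by linarith, fun _ => by linarith⟩

theorem iterate_injective (hup : ∀ x, r x < 0 → r (φ x) = r x + 1 ∧ w x < w (φ x))
    (hinj : ∀ x y, r x = r y → r x ≠ 0 → φ x = φ y → x = y) (m : ℕ) :
    ∀ x y, r x = -m → r y = -m → φ^[m] x = φ^[m] y → x = y := by
  induction m with
  | zero => intro x y _ _ h; simpa using h
  | succ m ih =>
    intro x y hx hy h
    push_cast at hx hy
    rw [Function.iterate_succ_apply, Function.iterate_succ_apply] at h
    exact hinj x y (by lia) (by lia)
      (ih _ _ (by have := hup x (by lia); lia) (by have := hup y (by lia); lia) h)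

theorem eq_of_iterate_eq (hup : ∀ x, r x < 0 → r (φ x) = r x + 1 ∧ w x < w (φ x))
    (hinj : ∀ x y, r x = r y → r x ≠ 0 → φ x = φ y → x = y) {x y : P} (hx : r x ≤ 0)
    (hy : r y ≤ 0) (hw : w x = w y) (h : φ^[(r x).natAbs] x = φ^[(r y).natAbs] y) : x = y := by
  wlog hxy : r x ≤ r y generalizing x y
  · exact (this hy hx hw.symm h.symm (by lia)).symm
  obtain ⟨d, hd⟩ := Int.le.dest hxy
  have hadd : (r x).natAbs = (r y).natAbs + d := by lia
  rw [hadd, Function.iterate_add_apply] at h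
  obtain ⟨h1, -, h3⟩ := weight_iterate hup d x (by lia)
  have key := iterate_injective hup hinj _ _ _ (by lia) (by lia) h
  rcases eq_or_ne d 0 with rfl | h0
  · simpa using key
  · have := h3 h0
    rw [key] at this
    linarith

/-- If every element off rank zero is matched towards rank zero, compatibly with `w`, then no level
set of `w` is larger than rank zero. -/
theorem card_level_le [Fintype P]
    (hup : ∀ x, r x < 0 → r (φ x) = r x + 1 ∧ w x < w (φ x))
    (hdown : ∀ x, 0 < r x → r (φ x) = r x - 1 ∧ w (φ x) < w x)
    (hinj : ∀ x y, r x = r y → r x ≠ 0 → φ x = φ y → x = y) (k : ℝ) :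
    #{x | w x = k} ≤ #{x | r x = 0} := by
  have hdown' : ∀ x, (-r) x < 0 → (-r) (φ x) = (-r) x + 1 ∧ (-w) x < (-w) (φ x) := by
    intro x hx
    simp only [Pi.neg_apply] at *
    obtain ⟨h1, h2⟩ := hdown x (by lia)
    exact ⟨by lia, by linarith⟩
  have hinj' : ∀ x y, (-r) x = (-r) y → (-r) x ≠ 0 → φ x = φ y → x = y := by
    simpa using hinj
  have mixed : ∀ x y, r x ≤ 0 → 0 < r y → w x = w y →
      φ^[(r x).natAbs] x ≠ φ^[(r y).natAbs] y := by
    intro x y hx hy hw h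
    have h1 := (weight_iterate hup (r x).natAbs x (by lia)).2.1
    have h2 := (weight_iterate hdown' (r y).natAbs y (by simp only [Pi.neg_apply]; lia)).2.2
      (by lia)
    simp only [Pi.neg_apply] at h2
    rw [h] at h1
    linarith
  refine card_le_card_of_injOn (fun x => φ^[(r x).natAbs] x) ?_ ?_
  · intro x _
    simp only [coe_filter, mem_univ, true_and, Set.mem_ofPred_eq]
    rcases le_total (r x) 0 with hx | hx
    · rw [(weight_iterate hup (r x).natAbs x (by lia)).1]; lia
    · have := (weight_iterate hdown' (r x).natAbs x (by simp only [Pi.neg_apply]; lia)).1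
      simp only [Pi.neg_apply] at this
      lia
  · intro x hx y hy h
    simp only [coe_filter, mem_univ, true_and, Set.mem_ofPred_eq] at hx hy h
    have hw : w x = w y := hx.trans hy.symm
    rcases le_or_gt (r x) 0 with h1 | h1 <;> rcases le_or_gt (r y) 0 with h2 | h2
    · exact eq_of_iterate_eq hup hinj h1 h2 hw h
    · exact (mixed x y h1 h2 hw h).elim
    · exact (mixed y x h2 h1 hw.symm h.symm).elim
    · exact eq_of_iterate_eq (r := -r) (w := -w) hdown' hinj' (by simp only [Pi.neg_apply]; lia)
        (by simp only [Pi.neg_apply]; lia) (by simpa using hw) (by simpa using h)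

end Chains

/-! ### From injective linear maps to matchings -/

/-- A linear map whose matrix is supported on a relation `R` and which is injective on the functions
supported on `A` yields a matching of `A` along `R`. -/
theorem exists_matching {P : Type*} [Fintype P] (R : P → P → Prop) (A : Set P)
    (L : (P → ℝ) →ₗ[ℝ] (P → ℝ)) (hR : ∀ v T, L v T ≠ 0 → ∃ S, R S T ∧ v S ≠ 0)
    (hL : ∀ v, (∀ S ∉ A, v S = 0) → L v = 0 → v = 0) :
    ∃ φ : A → P, Function.Injective φ ∧ ∀ S : A, R S (φ S) := by
  classical
  suffices hall : ∀ X : Finset A, #X ≤ #(X.biUnion fun S : A => ({T | R S T} : Finset P)) by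
    obtain ⟨φ, h1, h2⟩ := (all_card_le_biUnion_card_iff_exists_injective _).1 hall
    exact ⟨φ, h1, fun S => by simpa using h2 S⟩
  intro X
  set N : Finset P := X.biUnion fun S : A => ({T | R S T} : Finset P)
  let ι : (X → ℝ) →ₗ[ℝ] (P → ℝ) := Function.ExtendByZero.linearMap ℝ fun S : X => (S : A).1
  have hinj : Function.Injective fun S : X => (S : A).1 :=
    Subtype.val_injective.comp Subtype.val_injective
  have hι : ∀ v S, (∀ x : X, (x : A).1 ≠ S) → ι v S = 0 := fun v S h => by
    simpa [ι] using Function.extend_apply' (f := fun S : X => (S : A).1) v 0 S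
      (fun ⟨x, hx⟩ => h x hx)
  have hker : Function.Injective ((LinearMap.funLeft ℝ ℝ ((↑) : N → P)).comp (L.comp ι)) := by
    rw [← LinearMap.ker_eq_bot, LinearMap.ker_eq_bot']
    intro v hv
    have h0 : ι v = 0 := by
      refine hL _ (fun S hS => hι _ _ fun x hx => hS (hx ▸ x.1.2)) (funext fun T => ?_)
      by_contra hT
      obtain ⟨S, hST, hS⟩ := hR _ _ hT
      have : ∃ x : X, (x : A).1 = S := by
        by_contra! h
        exact hS (hι _ _ h)
      obtain ⟨x, rfl⟩ := this
      have hTN : T ∈ N := mem_biUnion.2 ⟨x, x.2, by simpa using hST⟩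
      exact hT (congrFun hv ⟨T, hTN⟩)
    funext x
    have := congrFun h0 (x : A).1
    simpa [ι, hinj.extend_apply] using this
  simpa using LinearMap.finrank_le_finrank_of_injective hker

/-! ### Raising and lowering operators on functions of subsets -/

section Operators

variable {α : Type*} [DecidableEq α]

/-- Exchange `a` and `b` in a finite set. -/
def exchange (a b : α) (S : Finset α) : Finset α := S.map (Equiv.swap a b).toEmbedding

theorem mem_exchange {a b x : α} {S : Finset α} :
    x ∈ exchange a b S ↔ Equiv.swap a b x ∈ S := by
  simp [exchange, mem_map_equiv]

@[simp] theorem exchange_exchange (a b : α) (S : Finset α) :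
    exchange a b (exchange a b S) = S := by
  ext x; simp [mem_exchange]

theorem exchange_comm (a b : α) (S : Finset α) : exchange a b S = exchange b a S := by
  ext x; simp [mem_exchange, Equiv.swap_comm]

theorem sum_exchange {M : Type*} [AddCommGroup M] {a b : α} {S : Finset α} (ha : a ∉ S)
    (hb : b ∈ S) (g : α → M) : ∑ x ∈ exchange a b S, g x = ∑ x ∈ S, g x - (g b - g a) := by
  rw [exchange, sum_map, eq_sub_iff_add_eq, ← eq_sub_iff_add_eq', ← sum_sub_distrib,
    sum_eq_single_of_mem b hb]
  · simp
  · intro x hx hxb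
    have hxa : x ≠ a := fun h => ha (h ▸ hx)
    simp [Equiv.swap_apply_of_ne_of_ne hxa hxb]

/-- The operator on functions of finite sets that moves `a` to `b`. -/
noncomputable def move (a b : α) : (Finset α → ℝ) →ₗ[ℝ] (Finset α → ℝ) where
  toFun v T := if a ∉ T ∧ b ∈ T then v (exchange a b T) else 0
  map_add' u v := by ext T; simp only [Pi.add_apply]; split_ifs <;> simp
  map_smul' c v := by ext T; simp

theorem move_apply (a b : α) (v : Finset α → ℝ) (T : Finset α) :
    move a b v T = if a ∉ T ∧ b ∈ T then v (exchange a b T) else 0 := rfl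

theorem sum_move_mul [Fintype α] (a b : α) (u v : Finset α → ℝ) :
    ∑ S, move a b u S * v S = ∑ S, u S * move b a v S := by
  refine sum_nbij' (exchange a b) (exchange a b) (by simp) (by simp) (by simp) (by simp) ?_
  intro S _
  simp only [move_apply, mem_exchange, exchange_comm b a, exchange_exchange,
    Equiv.swap_apply_left, Equiv.swap_apply_right]
  split_ifs <;> first | rfl | simp

theorem move_move_self {a b : α} (v : Finset α → ℝ) (S : Finset α) :
    move b a (move a b v) S - move a b (move b a v) S =
      ((if a ∈ S then 1 else 0) - if b ∈ S then 1 else 0) * v S := by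
  simp only [move_apply, mem_exchange, exchange_comm b a, exchange_exchange,
    Equiv.swap_apply_left, Equiv.swap_apply_right]
  by_cases ha : a ∈ S <;> by_cases hb : b ∈ S <;> simp [ha, hb]

/-- Lowering along `(a, b)` commutes with raising along `(c, d)`. -/
theorem move_move_comm {a b c d : α} (hab : a ≠ b) (hcd : c ≠ d) (hac : a ≠ c) (hbd : b ≠ d)
    (v : Finset α → ℝ) (S : Finset α) :
    move b a (move c d v) S = move c d (move b a v) S := by
  by_cases had : a = d
  · subst had
    by_cases hbc : b = c
    · subst hbc
      simp [move_apply, mem_exchange]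
    · simp only [move_apply, mem_exchange, Equiv.swap_apply_right]
      split_ifs <;> grind [Equiv.swap_apply_of_ne_of_ne]
  · by_cases hbc : b = c
    · subst hbc
      simp only [move_apply, mem_exchange, Equiv.swap_apply_left]
      split_ifs <;> grind [Equiv.swap_apply_of_ne_of_ne]
    · have hcomm : exchange c d (exchange b a S) = exchange b a (exchange c d S) := by
        ext x
        simp only [mem_exchange]
        have : Equiv.swap b a (Equiv.swap c d x) = Equiv.swap c d (Equiv.swap b a x) := by
          simp only [Equiv.swap_apply_def]; grind
        rw [this]
      simp only [move_apply, mem_exchange, hcomm, Equiv.swap_apply_of_ne_of_ne hac had,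
        Equiv.swap_apply_of_ne_of_ne hbc hbd,
        Equiv.swap_apply_of_ne_of_ne (Ne.symm hbc) (Ne.symm hac),
        Equiv.swap_apply_of_ne_of_ne (Ne.symm hbd) (Ne.symm had)]
      split_ifs <;> rfl

end Operators

section Level

variable {n : ℕ}

/-- The sum of a subset of `{-n, …, n}`, whose elements are indexed by `Fin (2 * n + 1)`. -/
def rank (S : Finset (Fin (2 * n + 1))) : ℤ := ∑ x ∈ S, ((x : ℤ) - n)

/-- The squared matrix entry of the raising operator between positions `i` and `i + 1`. -/
noncomputable def coeff (i : Fin (2 * n)) : ℝ := (i + 1) * (2 * n - i)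

theorem coeff_nonneg (i : Fin (2 * n)) : 0 ≤ coeff i := by
  have : (i : ℝ) ≤ 2 * n := by exact_mod_cast i.2.le
  exact mul_nonneg (by positivity) (by linarith)

variable (n) in
/-- The raising operator. -/
noncomputable def raise : (Finset (Fin (2 * n + 1)) → ℝ) →ₗ[ℝ] (Finset (Fin (2 * n + 1)) → ℝ) :=
  ∑ i : Fin (2 * n), √(coeff i) • move i.castSucc i.succ

variable (n) in
/-- The lowering operator, the adjoint of the raising operator. -/
noncomputable def lower : (Finset (Fin (2 * n + 1)) → ℝ) →ₗ[ℝ] (Finset (Fin (2 * n + 1)) → ℝ) :=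
  ∑ i : Fin (2 * n), √(coeff i) • move i.succ i.castSucc

theorem raise_apply (v : Finset (Fin (2 * n + 1)) → ℝ) (S : Finset (Fin (2 * n + 1))) :
    raise n v S = ∑ i : Fin (2 * n), √(coeff i) * move i.castSucc i.succ v S := by
  simp [raise, LinearMap.sum_apply]

theorem lower_apply (v : Finset (Fin (2 * n + 1)) → ℝ) (S : Finset (Fin (2 * n + 1))) :
    lower n v S = ∑ i : Fin (2 * n), √(coeff i) * move i.succ i.castSucc v S := by
  simp [lower, LinearMap.sum_apply]

theorem sum_coeff_mul_sub (S : Finset (Fin (2 * n + 1))) :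
    ∑ i : Fin (2 * n), coeff i *
      ((if i.castSucc ∈ S then 1 else 0) - if i.succ ∈ S then 1 else 0) = -2 * (rank S : ℝ) := by
  have h1 : ∑ x : Fin (2 * n + 1), ((x : ℝ) + 1) * (2 * n - x) * (if x ∈ S then 1 else 0) =
      ∑ i : Fin (2 * n), coeff i * (if i.castSucc ∈ S then 1 else 0) := by
    rw [Fin.sum_univ_castSucc]
    simp [coeff]
  have h2 : ∑ x : Fin (2 * n + 1), (x : ℝ) * (2 * n + 1 - x) * (if x ∈ S then 1 else 0) =
      ∑ i : Fin (2 * n), coeff i * (if i.succ ∈ S then 1 else 0) := by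
    rw [Fin.sum_univ_succ]
    simp [coeff]
  have h3 : (rank S : ℝ) = ∑ x : Fin (2 * n + 1), ((x : ℝ) - n) * (if x ∈ S then 1 else 0) := by
    simp [rank]
  simp only [mul_sub, sum_sub_distrib]
  rw [← h1, ← h2, h3, mul_sum, ← sum_sub_distrib]
  exact sum_congr rfl fun x _ => by ring

theorem sum_raise_sq_sub_sum_lower_sq (v : Finset (Fin (2 * n + 1)) → ℝ) :
    ∑ S, raise n v S ^ 2 - ∑ S, lower n v S ^ 2 = ∑ S, -2 * (rank S : ℝ) * v S ^ 2 := by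
  have h1 : ∑ S, raise n v S ^ 2 = ∑ i : Fin (2 * n), ∑ j : Fin (2 * n),
      √(coeff i) * √(coeff j) *
        ∑ S, v S * move i.succ i.castSucc (move j.castSucc j.succ v) S := by
    have h : ∀ i j : Fin (2 * n), ∑ S, v S * move i.succ i.castSucc (move j.castSucc j.succ v) S =
        ∑ S, move i.castSucc i.succ v S * move j.castSucc j.succ v S := fun i j =>
      (sum_move_mul _ _ _ _).symm
    simp only [h, mul_sum]
    simp only [raise_apply, sq, sum_mul_sum]
    rw [sum_comm]
    refine sum_congr rfl fun i _ => ?_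
    rw [sum_comm]
    exact sum_congr rfl fun j _ => sum_congr rfl fun S _ => by ring
  have h2 : ∑ S, lower n v S ^ 2 = ∑ i : Fin (2 * n), ∑ j : Fin (2 * n),
      √(coeff i) * √(coeff j) *
        ∑ S, v S * move j.castSucc j.succ (move i.succ i.castSucc v) S := by
    have h : ∀ i j : Fin (2 * n), ∑ S, v S * move j.castSucc j.succ (move i.succ i.castSucc v) S =
        ∑ S, move j.succ j.castSucc v S * move i.succ i.castSucc v S := fun i j =>
      (sum_move_mul _ _ _ _).symm
    simp only [h, mul_sum]
    simp only [lower_apply, sq, sum_mul_sum]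
    rw [sum_comm]
    refine sum_congr rfl fun i _ => ?_
    rw [sum_comm]
    exact sum_congr rfl fun j _ => sum_congr rfl fun S _ => by ring
  have h3 : ∀ i : Fin (2 * n), ∑ j : Fin (2 * n), √(coeff i) * √(coeff j) *
      ∑ S, v S * (move i.succ i.castSucc (move j.castSucc j.succ v) S -
        move j.castSucc j.succ (move i.succ i.castSucc v) S) =
      ∑ S, coeff i * ((if i.castSucc ∈ S then 1 else 0) - if i.succ ∈ S then 1 else 0)
        * v S ^ 2 := by
    intro i
    rw [sum_eq_single_of_mem i (mem_univ i), Real.mul_self_sqrt (coeff_nonneg i), mul_sum]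
    · exact sum_congr rfl fun S _ => by rw [move_move_self]; ring
    · intro j _ hj
      simp only [move_move_comm (Fin.castSucc_lt_succ (i := i)).ne
        (Fin.castSucc_lt_succ (i := j)).ne
        (fun h => hj (Fin.castSucc_injective _ h).symm)
        (fun h => hj (Fin.succ_injective _ h).symm), sub_self, mul_zero, sum_const_zero]
  rw [h1, h2]
  simp only [← sum_sub_distrib, ← mul_sub]
  rw [sum_congr rfl fun i _ => h3 i, sum_comm]
  exact sum_congr rfl fun S _ => by rw [← sum_mul, sum_coeff_mul_sub]

theorem eq_zero_of_raise_eq_zero {v : Finset (Fin (2 * n + 1)) → ℝ}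
    (hv : ∀ S, 0 ≤ rank S → v S = 0) (h : raise n v = 0) : v = 0 := by
  have key := sum_raise_sq_sub_sum_lower_sq v
  have h0 : 0 ≤ ∑ S, lower n v S ^ 2 := sum_nonneg fun S _ => sq_nonneg _
  have hpos : ∀ S ∈ univ, 0 ≤ -2 * (rank S : ℝ) * v S ^ 2 := fun S _ => by
    rcases le_or_gt 0 (rank S) with hS | hS
    · simp [hv S hS]
    · have : (rank S : ℝ) < 0 := by exact_mod_cast hS
      exact mul_nonneg (by linarith) (sq_nonneg _)
  have hsum : ∑ S, -2 * (rank S : ℝ) * v S ^ 2 = 0 := by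
    refine le_antisymm ?_ (sum_nonneg hpos)
    rw [← key, h]
    simpa using h0
  funext S
  rcases le_or_gt 0 (rank S) with hS | hS
  · exact hv S hS
  · simpa [hS.ne] using (sum_eq_zero_iff_of_nonneg hpos).1 hsum S (mem_univ S)

theorem eq_zero_of_lower_eq_zero {v : Finset (Fin (2 * n + 1)) → ℝ}
    (hv : ∀ S, rank S ≤ 0 → v S = 0) (h : lower n v = 0) : v = 0 := by
  have key := sum_raise_sq_sub_sum_lower_sq v
  have h0 : 0 ≤ ∑ S, raise n v S ^ 2 := sum_nonneg fun S _ => sq_nonneg _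
  have hneg : ∀ S ∈ univ, -2 * (rank S : ℝ) * v S ^ 2 ≤ 0 := fun S _ => by
    rcases le_or_gt (rank S) 0 with hS | hS
    · simp [hv S hS]
    · have : (0 : ℝ) < rank S := by exact_mod_cast hS
      exact mul_nonpos_of_nonpos_of_nonneg (by linarith) (sq_nonneg _)
  have hsum : ∑ S, -2 * (rank S : ℝ) * v S ^ 2 = 0 := by
    refine le_antisymm (sum_nonpos hneg) ?_
    rw [← key, h]
    simpa using h0
  funext S
  rcases le_or_gt (rank S) 0 with hS | hS
  · exact hv S hS
  · simpa [hS.ne'] using (sum_eq_zero_iff_of_nonpos hneg).1 hsum S (mem_univ S)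

/-- `T` arises from `S` by raising one element by one position. -/
def Covers (S T : Finset (Fin (2 * n + 1))) : Prop :=
  ∃ i : Fin (2 * n), i.castSucc ∉ T ∧ i.succ ∈ T ∧ S = exchange i.castSucc i.succ T

theorem Covers.rank_eq {S T : Finset (Fin (2 * n + 1))} (h : Covers S T) :
    rank T = rank S + 1 := by
  obtain ⟨i, h1, h2, rfl⟩ := h
  simp [rank, sum_exchange h1 h2]

theorem Covers.sum_lt {S T : Finset (Fin (2 * n + 1))} (h : Covers S T)
    {g : Fin (2 * n + 1) → ℝ} (hg : StrictMono g) : ∑ x ∈ S, g x < ∑ x ∈ T, g x := by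
  obtain ⟨i, h1, h2, rfl⟩ := h
  rw [sum_exchange h1 h2]
  have := hg (Fin.castSucc_lt_succ (i := i))
  linarith

theorem exists_covers_of_raise_ne_zero {v : Finset (Fin (2 * n + 1)) → ℝ}
    {T : Finset (Fin (2 * n + 1))} (h : raise n v T ≠ 0) : ∃ S, Covers S T ∧ v S ≠ 0 := by
  rw [raise_apply] at h
  obtain ⟨i, -, hi⟩ := exists_ne_zero_of_sum_ne_zero h
  have hm := right_ne_zero_of_mul hi
  rw [move_apply] at hm
  split_ifs at hm with hT
  · exact ⟨_, ⟨i, hT.1, hT.2, rfl⟩, hm⟩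
  · exact (hm rfl).elim

theorem exists_covers_of_lower_ne_zero {v : Finset (Fin (2 * n + 1)) → ℝ}
    {T : Finset (Fin (2 * n + 1))} (h : lower n v T ≠ 0) : ∃ S, Covers T S ∧ v S ≠ 0 := by
  rw [lower_apply] at h
  obtain ⟨i, -, hi⟩ := exists_ne_zero_of_sum_ne_zero h
  have hm := right_ne_zero_of_mul hi
  rw [move_apply, exchange_comm] at hm
  split_ifs at hm with hT
  · exact ⟨_, ⟨i, by simpa [mem_exchange] using hT.1, by simpa [mem_exchange] using hT.2,
      by simp⟩, hm⟩
  · exact (hm rfl).elim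

theorem card_sum_eq_le_card_rank_eq_zero {g : Fin (2 * n + 1) → ℝ} (hg : StrictMono g) (k : ℝ) :
    #{S : Finset (Fin (2 * n + 1)) | ∑ x ∈ S, g x = k} ≤
      #{S : Finset (Fin (2 * n + 1)) | rank S = 0} := by
  obtain ⟨φ, hφ, hφR⟩ := exists_matching Covers {S : Finset (Fin (2 * n + 1)) | rank S < 0}
    (raise n) (fun _ _ => exists_covers_of_raise_ne_zero)
    (fun v hv => eq_zero_of_raise_eq_zero fun S hS => hv S (not_lt.2 hS))
  obtain ⟨ψ, hψ, hψR⟩ := exists_matching (fun S T => Covers T S)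
    {S : Finset (Fin (2 * n + 1)) | 0 < rank S}
    (lower n) (fun _ _ => exists_covers_of_lower_ne_zero)
    (fun v hv => eq_zero_of_lower_eq_zero fun S hS => hv S (not_lt.2 hS))
  let θ : Finset (Fin (2 * n + 1)) → Finset (Fin (2 * n + 1)) := fun S =>
    if h : rank S < 0 then φ ⟨S, h⟩ else if h : 0 < rank S then ψ ⟨S, h⟩ else S
  have hneg : ∀ S (h : rank S < 0), θ S = φ ⟨S, h⟩ := fun S h => dif_pos h
  have hpos : ∀ S (h : 0 < rank S), θ S = ψ ⟨S, h⟩ := fun S h => by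
    simp only [θ, dif_neg h.le.not_gt, dif_pos h]
  refine card_level_le (r := rank) (w := fun S => ∑ x ∈ S, g x) (φ := θ) ?_ ?_ ?_ k
  · intro S hS
    rw [hneg S hS]
    exact ⟨(hφR ⟨S, hS⟩).rank_eq, (hφR ⟨S, hS⟩).sum_lt hg⟩
  · intro S hS
    rw [hpos S hS]
    exact ⟨eq_sub_of_add_eq (hψR ⟨S, hS⟩).rank_eq.symm, (hψR ⟨S, hS⟩).sum_lt hg⟩
  · intro S T hST h0 h
    rcases h0.lt_or_gt with hS | hS
    · rw [hneg S hS, hneg T (hST ▸ hS)] at h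
      exact congrArg Subtype.val (hφ h)
    · rw [hpos S hS, hpos T (hST ▸ hS)] at h
      exact congrArg Subtype.val (hψ h)

end Level

theorem numSubsetsWithSum_map {ι : Type*} [Fintype ι] [DecidableEq ι] (g : ι ↪ ℝ) (k : ℝ) :
    numSubsetsWithSum (univ.map g) k = #{S : Finset ι | ∑ x ∈ S, g x = k} := by
  rw [numSubsetsWithSum, ← Set.ncard_coe_finset, ← Set.ncard_image_of_injective _ (map_injective g)]
  congr 1
  ext S
  simp only [Set.mem_ofPred_eq, Set.mem_image, coe_filter, mem_univ, true_and]
  constructor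
  · rintro ⟨hS, hk⟩
    obtain ⟨T, -, rfl⟩ := subset_map_iff.1 hS
    exact ⟨T, by simpa using hk, rfl⟩
  · rintro ⟨T, hk, rfl⟩
    exact ⟨map_subset_map.2 (subset_univ T), by simpa using hk⟩

end ErdosMoser

open Finset ErdosMoser in
/-- Erdős–Moser conjecture, proved by Stanley: if `E ⊆ ℝ` has cardinality
`2n + 1`, then for every real `k`, `f(E, k) ≤ f({−n, …, n} ∩ ℤ, 0)`. -/
theorem erdos_moser (n : ℕ) (E : Finset ℝ) (hE : E.card = 2 * n + 1) (k : ℝ) :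
    numSubsetsWithSum E k ≤
      numSubsetsWithSum ((Finset.Icc (-(n : ℤ)) (n : ℤ)).image fun m : ℤ => (m : ℝ)) 0 := by
  have hinj : Function.Injective fun x : Fin (2 * n + 1) => (((x : ℤ) - n : ℤ) : ℝ) :=
    fun x y h => by simpa [Fin.ext_iff] using h
  let e : Fin (2 * n + 1) ↪ ℝ := ⟨_, hinj⟩
  have he : (Finset.Icc (-(n : ℤ)) (n : ℤ)).image (fun m : ℤ => (m : ℝ)) = univ.map e := by
    ext y
    simp only [mem_image, mem_Icc, mem_map, mem_univ, true_and, e, Function.Embedding.coeFn_mk]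
    constructor
    · rintro ⟨m, hm, rfl⟩
      exact ⟨⟨(m + n).toNat, by lia⟩, by congr 1; simp only; lia⟩
    · rintro ⟨x, rfl⟩
      exact ⟨(x : ℤ) - n, by have := x.2; lia, rfl⟩
  rw [he, ← map_orderEmbOfFin_univ E hE, numSubsetsWithSum_map, numSubsetsWithSum_map]
  have hrank : ∀ S : Finset (Fin (2 * n + 1)), ∑ x ∈ S, e x = 0 ↔ rank S = 0 := fun S => by
    simp only [e, Function.Embedding.coeFn_mk, rank]
    rw [← Int.cast_sum, Int.cast_eq_zero]
  simp only [hrank]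
  exact card_sum_eq_le_card_rank_eq_zero (E.orderEmbOfFin hE).strictMono k
end
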